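/- For b̄ sufficiently large the following holds: if f ∈ K(b̄) is a C³ Lorenz map with negative Schwarzian derivative that is infinitely renormalizable with combinatorial type ω̄ ∈ Ω(b̄)^ℕ, then f satisfies the weak Markov property. -/

import Mathlib

open Set Filter MeasureTheory Topology
open scoped Classical

noncomputable section

/-- The standard Lorenz family `Q(x)` with critical exponent `α`,
critical point `c`, and critical values `u`, `1 - v`. -/
def lorenzQ (α u v c : ℝ) (x : ℝ) : ℝ :=
  if x < c then u * (1 - ((c - x) / c) ^ α)
  else 1 + v * (-1 + ((x - c) / (1 - c)) ^ α)

/-- A Lorenz map on `[0,1] ∖ {c}` with critical exponent `α`, given by the data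
`(u, v, c, φ, ψ)` where `φ, ψ` are orientation-preserving homeomorphisms of `[0,1]`
(smoothness is imposed separately by `LorenzMap.IsCk`). -/
structure LorenzMap (α : ℝ) where
  u : ℝ
  v : ℝ
  c : ℝ
  φ : ℝ → ℝ
  ψ : ℝ → ℝ
  hu : u ∈ Icc (0 : ℝ) 1
  hv : v ∈ Icc (0 : ℝ) 1
  hc : c ∈ Ioo (0 : ℝ) 1
  hφ0 : φ 0 = 0
  hφ1 : φ 1 = 1
  hψ0 : ψ 0 = 0
  hψ1 : ψ 1 = 1
  hφmono : StrictMonoOn φ (Icc 0 1)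
  hψmono : StrictMonoOn ψ (Icc 0 1)
  hφcont : ContinuousOn φ (Icc 0 1)
  hψcont : ContinuousOn ψ (Icc 0 1)

namespace LorenzMap

variable {α : ℝ}

/-- The underlying interval map `f(x) = φ(Q(x))` for `x < c`, `ψ(Q(x))` for `x > c`
(the value at `x = c` itself is a junk convention; `c` is not in the domain). -/
def toFun (f : LorenzMap α) : ℝ → ℝ := fun x =>
  if x < f.c then f.φ (lorenzQ α f.u f.v f.c x) else f.ψ (lorenzQ α f.u f.v f.c x)

/-- Left critical value `ĉ₁ = lim_{x ↑ c} f(x) = φ(u)`. -/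
def cv1 (f : LorenzMap α) : ℝ := f.φ f.u

/-- Right critical value `ĉ₀ = lim_{x ↓ c} f(x) = ψ(1 - v)`. -/
def cv0 (f : LorenzMap α) : ℝ := f.ψ (1 - f.v)

/-- A Lorenz map is nontrivial if `ĉ₀ < c < ĉ₁`. -/
def IsNontrivial (f : LorenzMap α) : Prop := f.cv0 < f.c ∧ f.c < f.cv1

end LorenzMap

/-- `φ` is an orientation-preserving `C^k` diffeomorphism of `[0,1]` onto itself. -/
def IsOPDiffeo (k : ℕ) (φ : ℝ → ℝ) : Prop :=
  ContDiffOn ℝ k φ (Icc 0 1) ∧ φ 0 = 0 ∧ φ 1 = 1 ∧ StrictMonoOn φ (Icc 0 1) ∧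
    ∀ x ∈ Icc (0 : ℝ) 1, 0 < derivWithin φ (Icc 0 1) x

/-- A `C^k` Lorenz map: both diffeomorphic parts are orientation-preserving `C^k`
diffeomorphisms of `[0,1]`. -/
def LorenzMap.IsCk {α : ℝ} (k : ℕ) (f : LorenzMap α) : Prop :=
  IsOPDiffeo k f.φ ∧ IsOPDiffeo k f.ψ

/-- The Schwarzian derivative `Sf = f'''/f' - (3/2) (f''/f')²`. -/
def schwarzian (f : ℝ → ℝ) (x : ℝ) : ℝ :=
  deriv (deriv (deriv f)) x / deriv f x - (3 / 2) * (deriv (deriv f) x / deriv f x) ^ 2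

/-- `f` has negative Schwarzian derivative on `[0,1] ∖ {c}`. -/
def LorenzMap.NegSchwarzian {α : ℝ} (f : LorenzMap α) : Prop :=
  ∀ x ∈ Icc (0 : ℝ) 1 \ {f.c}, schwarzian f.toFun x < 0

/-- Distortion of a diffeomorphism of `[0,1]`:
`Dist φ = sup_{x,y ∈ [0,1]} log (φ'(x) / φ'(y))`. -/
def distortion (φ : ℝ → ℝ) : ℝ :=
  ⨆ x : Icc (0 : ℝ) 1, ⨆ y : Icc (0 : ℝ) 1,
    Real.log (derivWithin φ (Icc 0 1) x.1 / derivWithin φ (Icc 0 1) y.1)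

/-- Membership in the set `K(b̄)`: `f` is a `C¹` Lorenz map with
`α^{-b̄/α} ≤ 1 - c ≤ θ α^{-b̄σ/α²}` and `Dist φ, Dist ψ ≤ δ = (1/b̄)²`. -/
def memK (α σ θ : ℝ) (bbar : ℕ) (f : LorenzMap α) : Prop :=
  f.IsCk 1 ∧
  α ^ (-(bbar : ℝ) / α) ≤ 1 - f.c ∧
  1 - f.c ≤ θ * α ^ (-(bbar : ℝ) * σ / α ^ 2) ∧
  distortion f.φ ≤ (1 / (bbar : ℝ)) ^ 2 ∧ distortion f.ψ ≤ (1 / (bbar : ℝ)) ^ 2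

/-- The monotone type with `a` ones and `b` zeros (encoded as the pair `(a, b)`)
belongs to `Ω(b̄)`: `α + σ ≤ a + 1 ≤ 2α - σ` and `b̄ ≤ b ≤ (1 + (σ/α)² - β) b̄`. -/
def memOmega (α σ β : ℝ) (bbar : ℕ) (ab : ℕ × ℕ) : Prop :=
  1 ≤ ab.1 ∧ 1 ≤ ab.2 ∧
  α + σ ≤ (ab.1 : ℝ) + 1 ∧ (ab.1 : ℝ) + 1 ≤ 2 * α - σ ∧
  (bbar : ℝ) ≤ (ab.2 : ℝ) ∧ (ab.2 : ℝ) ≤ (1 + (σ / α) ^ 2 - β) * (bbar : ℝ)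

/-- `(p,q)` is a return interval around `c` on which the first-return map of `f`
is `f^{a+1}` on `L = (p,c)` and `f^{b+1}` on `R = (c,q)`, with monotone combinatorics:
`f^i(L) ⊂ (c,1)` for `1 ≤ i ≤ a` and `f^j(R) ⊂ (0,c)` for `1 ≤ j ≤ b`,
all intermediate iterates staying outside `(p,q)`. -/
def ReturnCond {α : ℝ} (f : LorenzMap α) (a b : ℕ) (p q : ℝ) : Prop :=
  1 ≤ a ∧ 1 ≤ b ∧ 0 ≤ p ∧ p < f.c ∧ f.c < q ∧ q ≤ 1 ∧ (0 < p ∨ q < 1) ∧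
  (∀ x ∈ Ioo p f.c,
    (∀ i : ℕ, 1 ≤ i → i ≤ a → f.toFun^[i] x ∈ Ioo f.c 1 ∧ f.toFun^[i] x ∉ Ioo p q) ∧
    f.toFun^[a + 1] x ∈ Ioo p q) ∧
  (∀ x ∈ Ioo f.c q,
    (∀ j : ℕ, 1 ≤ j → j ≤ b → f.toFun^[j] x ∈ Ioo 0 f.c ∧ f.toFun^[j] x ∉ Ioo p q) ∧
    f.toFun^[b + 1] x ∈ Ioo p q)

/-- A return interval which is maximal among all return intervals containing it. -/
def IsMaxReturnInterval {α : ℝ} (f : LorenzMap α) (a b : ℕ) (p q : ℝ) : Prop :=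
  ReturnCond f a b p q ∧
  ∀ a' b' : ℕ, ∀ p' q' : ℝ, ReturnCond f a' b' p' q' → Ioo p q ⊆ Ioo p' q' →
    p = p' ∧ q = q'

/-- `g` is the renormalization of `f`, of monotone type with `a` ones and `b` zeros:
`g` is the nontrivial Lorenz map obtained by affinely rescaling the first-return map
of `f` to the maximal return interval `(p,q)`. -/
def RenormOf {α : ℝ} (f : LorenzMap α) (a b : ℕ) (g : LorenzMap α) : Prop :=
  ∃ p q : ℝ, IsMaxReturnInterval f a b p q ∧
    g.c = (f.c - p) / (q - p) ∧ g.IsNontrivial ∧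
    (∀ x ∈ Ioo p f.c, g.toFun ((x - p) / (q - p)) = (f.toFun^[a + 1] x - p) / (q - p)) ∧
    (∀ x ∈ Ioo f.c q, g.toFun ((x - p) / (q - p)) = (f.toFun^[b + 1] x - p) / (q - p))

/-- `f` is renormalizable of monotone type `(01⋯1, 10⋯0)` with `a` ones and `b` zeros. -/
def MonRenormalizable {α : ℝ} (f : LorenzMap α) (a b : ℕ) : Prop :=
  ∃ g : LorenzMap α, RenormOf f a b g

/-- The renormalization operator (defined via choice on renormalizable maps
of monotone type; the identity on non-renormalizable maps). -/
def renormOp (α : ℝ) (f : LorenzMap α) : LorenzMap α :=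
  if h : ∃ g : LorenzMap α, ∃ a b : ℕ, RenormOf f a b g then h.choose else f

/-- `f` is infinitely renormalizable with (monotone) combinatorial type
`ω = (ω₀, ω₁, …)`, each `ω n` encoded as the pair (number of ones, number of zeros). -/
def InfRenormType (α : ℝ) (f : LorenzMap α) (ω : ℕ → ℕ × ℕ) : Prop :=
  ∀ n : ℕ, MonRenormalizable ((renormOp α)^[n] f) (ω n).1 (ω n).2

/-- `(p,q)` is a nice interval for `f`: an open subinterval of `[0,1]` containing the
critical point whose boundary orbits are disjoint from it. -/
def IsNiceInterval {α : ℝ} (f : LorenzMap α) (p q : ℝ) : Prop :=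
  0 ≤ p ∧ p < f.c ∧ f.c < q ∧ q ≤ 1 ∧
  (∀ n : ℕ, f.toFun^[n] p ∉ Ioo p q) ∧ (∀ n : ℕ, f.toFun^[n] q ∉ Ioo p q)

/-- The domain `⋃_{n ≥ 0} f^{-n}(C)` of the transfer map to `C`:
points of `[0,1]` some iterate of which lies in `C`, the critical point not being hit
before entering `C`. -/
def transferDomain {α : ℝ} (f : LorenzMap α) (C : Set ℝ) : Set ℝ :=
  {x ∈ Icc (0 : ℝ) 1 | ∃ n : ℕ, f.toFun^[n] x ∈ C ∧ ∀ j < n, f.toFun^[j] x ≠ f.c}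

/-- The transfer time to `C`: the least `n ≥ 0` with `f^n(x) ∈ C`. -/
def transferTime {α : ℝ} (f : LorenzMap α) (C : Set ℝ) (x : ℝ) : ℕ :=
  sInf {n : ℕ | f.toFun^[n] x ∈ C ∧ ∀ j < n, f.toFun^[j] x ≠ f.c}

/-- `(p,q)` contains a `δ`-scaled neighborhood of `(p',q')`: both components of the
difference have length greater than `δ (q' - p')`. -/
def ScaledInside (δ p q p' q' : ℝ) : Prop :=
  p < p' ∧ q' < q ∧ δ * (q' - p') < p' - p ∧ δ * (q' - p') < q - q'

/-- The weak Markov property: a nested sequence of nice intervals, each containing a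
`δ`-scaled neighborhood of the next, with almost everywhere defined transfer maps. -/
def LorenzMap.WeakMarkov {α : ℝ} (f : LorenzMap α) : Prop :=
  ∃ δ : ℝ, 0 < δ ∧ ∃ p q : ℕ → ℝ,
    (∀ n, IsNiceInterval f (p n) (q n)) ∧
    (∀ n, ScaledInside δ (p n) (q n) (p (n + 1)) (q (n + 1))) ∧
    (∀ n, volume (Icc (0 : ℝ) 1 \ transferDomain f (Ioo (p n) (q n))) = 0)

/-- `f` has a periodic attractor: a periodic orbit attracting an open set of points. -/
def LorenzMap.HasPeriodicAttractor {α : ℝ} (f : LorenzMap α) : Prop :=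
  ∃ p ∈ Icc (0 : ℝ) 1, ∃ m : ℕ, 1 ≤ m ∧ f.toFun^[m] p = p ∧
    ∃ U : Set ℝ, IsOpen U ∧ (U ∩ Icc (0 : ℝ) 1).Nonempty ∧
      ∀ x ∈ U ∩ Icc (0 : ℝ) 1, Tendsto (fun n => f.toFun^[n * m] x) atTop (𝓝 p)

/-- `W` is a wandering interval of `f`: a nondegenerate interval in `[0,1]` on which all
iterates are defined (no iterate meets the critical point), whose iterates are pairwise
disjoint, and whose forward orbit does not converge to a periodic orbit. -/
def LorenzMap.IsWanderingInterval {α : ℝ} (f : LorenzMap α) (W : Set ℝ) : Prop :=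
  W ⊆ Icc 0 1 ∧ W.OrdConnected ∧ (∃ x ∈ W, ∃ y ∈ W, x < y) ∧
  (∀ n : ℕ, f.c ∉ f.toFun^[n] '' W) ∧
  (∀ m n : ℕ, m ≠ n → Disjoint (f.toFun^[m] '' W) (f.toFun^[n] '' W)) ∧
  ¬ ∃ p ∈ Icc (0 : ℝ) 1, ∃ m : ℕ, 1 ≤ m ∧ f.toFun^[m] p = p ∧
      ∀ x ∈ W, Tendsto
        (fun n => Metric.infDist (f.toFun^[n] x) {y : ℝ | ∃ i < m, f.toFun^[i] p = y})
        atTop (𝓝 0)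


namespace LW

/-- cross-ratio quasi-contraction -/
def QCR (K : ℝ) (F : ℝ → ℝ) (e0 e1 : ℝ) : Prop :=
  ∀ x1 x2 x3 x4, e0 ≤ x1 → x1 < x2 → x2 < x3 → x3 < x4 → x4 ≤ e1 →
    (F x2 - F x1) * (F x4 - F x3) * ((x3 - x2) * (x4 - x1)) ≤
      K * ((x2 - x1) * (x4 - x3) * ((F x3 - F x2) * (F x4 - F x1)))

lemma QCR.mono {K : ℝ} {F : ℝ → ℝ} {e0 e1 d0 d1 : ℝ} (h : QCR K F e0 e1) (h0 : e0 ≤ d0)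
    (h1 : d1 ≤ e1) : QCR K F d0 d1 := fun x1 x2 x3 x4 a b c d e =>
  h x1 x2 x3 x4 (h0.trans a) b c d (e.trans h1)

lemma QCR.congr {K : ℝ} {F G : ℝ → ℝ} {e0 e1 : ℝ} (h : QCR K F e0 e1)
    (hFG : ∀ x ∈ Icc e0 e1, G x = F x) : QCR K G e0 e1 := by
  intro x1 x2 x3 x4 a b c d e
  rw [hFG x1 ⟨by linarith, by linarith⟩, hFG x2 ⟨by linarith, by linarith⟩,
    hFG x3 ⟨by linarith, by linarith⟩, hFG x4 ⟨by linarith, by linarith⟩]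
  exact h x1 x2 x3 x4 a b c d e

lemma QCR.comp {K : ℝ} {F G : ℝ → ℝ} {e0 e1 g0 g1 : ℝ} (hF : QCR K F e0 e1)
    (hG : QCR 1 G g0 g1) (mF : StrictMonoOn F (Icc e0 e1)) (mG : StrictMonoOn G (Icc g0 g1))
    (hm : MapsTo F (Icc e0 e1) (Icc g0 g1)) : QCR K (fun x => G (F x)) e0 e1 := by
  intro x1 x2 x3 x4 a b c d e
  have m1 : x1 ∈ Icc e0 e1 := ⟨by linarith, by linarith⟩
  have m2 : x2 ∈ Icc e0 e1 := ⟨by linarith, by linarith⟩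
  have m3 : x3 ∈ Icc e0 e1 := ⟨by linarith, by linarith⟩
  have m4 : x4 ∈ Icc e0 e1 := ⟨by linarith, by linarith⟩
  have f12 := mF m1 m2 b
  have f23 := mF m2 m3 c
  have f34 := mF m3 m4 d
  have g12 := mG (hm m1) (hm m2) f12
  have g23 := mG (hm m2) (hm m3) f23
  have g34 := mG (hm m3) (hm m4) f34
  have h1 := hF x1 x2 x3 x4 a b c d e
  have h2 := hG _ _ _ _ (hm m1).1 f12 f23 f34 (hm m4).2
  have pos : 0 < (F x3 - F x2) * (F x4 - F x1) := mul_pos (by linarith) (by linarith)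
  have pos' : 0 < (G (F x3) - G (F x2)) * (G (F x4) - G (F x1)) :=
    mul_pos (by linarith) (by linarith)
  have pc : 0 < (x3 - x2) * (x4 - x1) := mul_pos (by linarith) (by linarith)
  refine le_of_mul_le_mul_right ?_ pos
  calc _ = ((G (F x2) - G (F x1)) * (G (F x4) - G (F x3)) * ((F x3 - F x2) * (F x4 - F x1)))
          * ((x3 - x2) * (x4 - x1)) := by ring
    _ ≤ (1 * ((F x2 - F x1) * (F x4 - F x3) * ((G (F x3) - G (F x2)) * (G (F x4) - G (F x1)))))
          * ((x3 - x2) * (x4 - x1)) := mul_le_mul_of_nonneg_right h2 pc.le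
    _ = ((F x2 - F x1) * (F x4 - F x3) * ((x3 - x2) * (x4 - x1))) *
          ((G (F x3) - G (F x2)) * (G (F x4) - G (F x1))) := by ring
    _ ≤ (K * ((x2 - x1) * (x4 - x3) * ((F x3 - F x2) * (F x4 - F x1)))) *
          ((G (F x3) - G (F x2)) * (G (F x4) - G (F x1))) := mul_le_mul_of_nonneg_right h1 pos'.le
    _ = _ := by ring

/-- affine changes of coordinates -/
lemma QCR.affine {K : ℝ} {F : ℝ → ℝ} {e0 e1 : ℝ} (hF : QCR K F e0 e1) {s t p w d0 d1 : ℝ}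
    (hs : 0 < s) (h0 : e0 ≤ t + d0 * s) (h1 : t + d1 * s ≤ e1) :
    QCR K (fun x => (F (t + x * s) - p) / w) d0 d1 := by
  intro x1 x2 x3 x4 a b c d e
  have k : ∀ x y : ℝ, x < y → t + x * s < t + y * s := fun x y h => by nlinarith
  have h := hF (t + x1 * s) (t + x2 * s) (t + x3 * s) (t + x4 * s) (by nlinarith) (k _ _ b)
    (k _ _ c) (k _ _ d) (by nlinarith)
  have e1 : ∀ x y : ℝ, (F (t + x * s) - p) / w - (F (t + y * s) - p) / w =
      (F (t + x * s) - F (t + y * s)) * w⁻¹ := fun x y => by ring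
  simp only [e1]
  have : 0 ≤ w⁻¹ ^ 2 / s ^ 2 := by positivity
  have h2 := mul_le_mul_of_nonneg_right h this
  have es : s ≠ 0 := hs.ne'
  calc _ = _ := ?_
    _ ≤ _ := h2
    _ = _ := ?_
  · field_simp; ring
  · field_simp; ring

/-- bi-Lipschitz with constants `κ⁻¹, κ` -/
def BL (κ : ℝ) (F : ℝ → ℝ) : Prop :=
  ∀ x y, 0 ≤ x → x ≤ y → y ≤ 1 → F y - F x ≤ κ * (y - x) ∧ y - x ≤ κ * (F y - F x)

lemma BL.qcr {κ : ℝ} (hκ : 1 ≤ κ) {F : ℝ → ℝ} (h : BL κ F) : QCR (κ ^ 4) F 0 1 := by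
  intro x1 x2 x3 x4 a b c d e
  obtain ⟨h1, -⟩ := h x1 x2 a b.le (by linarith)
  obtain ⟨h2, -⟩ := h x3 x4 (by linarith) d.le e
  obtain ⟨-, h3⟩ := h x2 x3 (by linarith) c.le (by linarith)
  obtain ⟨-, h4⟩ := h x1 x4 (by linarith) (by linarith) e
  have k0 : 0 < κ := by linarith
  have p : ∀ {x y : ℝ}, 0 < x → x ≤ κ * y → 0 < y := fun hx hy => by
    by_contra hn; nlinarith
  have q3 := p (by linarith) h3
  have q4 := p (by linarith) h4
  have n1 : 0 ≤ F x2 - F x1 := by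
    obtain ⟨-, h5⟩ := h x1 x2 a b.le (by linarith)
    exact (p (by linarith) h5).le
  have n2 : 0 ≤ F x4 - F x3 := by
    obtain ⟨-, h5⟩ := h x3 x4 (by linarith) d.le e
    exact (p (by linarith) h5).le
  calc _ ≤ (κ * (x2 - x1)) * (κ * (x4 - x3)) * ((κ * (F x3 - F x2)) * (κ * (F x4 - F x1))) := by
        gcongr <;> first | linarith | nlinarith
    _ = _ := by ring

/-- Koebe principle -/
lemma koebe {K η : ℝ} (hK : 1 ≤ K) (hη : 0 ≤ η) {W : ℝ → ℝ} {e0 e1 i0 i1 : ℝ}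
    (mW : StrictMonoOn W (Icc e0 e1)) (cW : ContinuousOn W (Icc e0 e1)) (hW : QCR K W e0 e1)
    (h0 : e0 < i0) (h01 : i0 < i1) (h1 : i1 < e1)
    (hl : W i1 - W i0 ≤ η * (W i0 - W e0)) (hr : W i1 - W i0 ≤ η * (W e1 - W i1)) :
    let V := fun s => (W (i0 + s * (i1 - i0)) - W i0) / (W i1 - W i0)
    V 0 = 0 ∧ V 1 = 1 ∧ StrictMonoOn V (Icc 0 1) ∧ ContinuousOn V (Icc 0 1) ∧ QCR K V 0 1 ∧
      BL (K * (1 + η)) V := by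
  intro V
  have le01 : ∀ x y, e0 ≤ x → x < y → y ≤ e1 → W x < W y := fun x y a b c =>
    mW ⟨a, by linarith⟩ ⟨by linarith, c⟩ b
  have hw : 0 < W i1 - W i0 := by linarith [le01 i0 i1 h0.le h01 h1.le]
  have hs : 0 < i1 - i0 := by linarith
  have K' : 1 ≤ K * (1 + η) := by nlinarith
  have mp : MapsTo (fun s => i0 + s * (i1 - i0)) (Icc 0 1) (Icc e0 e1) := by
    intro s hs'
    constructor <;> simp only [mem_Icc] at * <;> nlinarith
  refine ⟨by simp [V], ?_, ?_, ?_, ?_, ?_⟩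
  · simp only [V, one_mul, add_sub_cancel]; exact div_self hw.ne'
  · intro x hx y hy hxy
    have := mW (mp hx) (mp hy) (by simp only; nlinarith)
    simp only [V]
    exact div_lt_div_of_pos_right (by simpa using this) hw
  · refine ContinuousOn.div_const (ContinuousOn.sub ?_ continuousOn_const) _
    exact cW.comp (by fun_prop) mp
  · exact hW.affine hs (by linarith) (by linarith)
  · -- adjacent intervals
    have adjR : ∀ x y z, i0 ≤ x → x < y → y < z → z ≤ i1 →
        (W y - W x) * (z - y) ≤ K * (1 + η) * ((y - x) * (W z - W y)) := by
      intro x y z a b c d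
      have h := hW x y z e1 (by linarith) b c (by linarith) le_rfl
      have q1 := le01 x y (by linarith) b (by linarith)
      have q2 := le01 y z (by linarith) c (by linarith)
      have q3 := le01 z e1 (by linarith) (by linarith) le_rfl
      have q4 : W z ≤ W i1 := by
        rcases d.lt_or_eq with d | d
        · exact (le01 _ _ (by linarith) d h1.le).le
        · rw [d]
      have q5 : W i0 ≤ W x := by
        rcases a.lt_or_eq with d | d
        · exact (le01 _ _ (by linarith) d (by linarith)).le
        · rw [d]
      have r1 : W e1 - W x ≤ (1 + η) * (W e1 - W z) := by nlinarith
      refine le_of_mul_le_mul_right ?_ (mul_pos (show 0 < W e1 - W z by linarith)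
        (show 0 < e1 - x by linarith))
      calc _ = (W y - W x) * (W e1 - W z) * ((z - y) * (e1 - x)) := by ring
        _ ≤ _ := h
        _ ≤ K * ((y - x) * (e1 - x) * ((W z - W y) * ((1 + η) * (W e1 - W z)))) := by
            gcongr <;> first | linarith | exact mul_nonneg (by linarith) (by linarith)
        _ = _ := by ring
    have adjL : ∀ x y z, i0 ≤ x → x < y → y < z → z ≤ i1 →
        (W z - W y) * (y - x) ≤ K * (1 + η) * ((z - y) * (W y - W x)) := by
      intro x y z a b c d
      have h := hW e0 x y z le_rfl (by linarith) b c (by linarith)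
      have q1 := le01 x y (by linarith) b (by linarith)
      have q2 := le01 y z (by linarith) c (by linarith)
      have q3 := le01 e0 x le_rfl (by linarith) (by linarith)
      have q4 : W z ≤ W i1 := by
        rcases d.lt_or_eq with d | d
        · exact (le01 _ _ (by linarith) d h1.le).le
        · rw [d]
      have q5 : W i0 ≤ W x := by
        rcases a.lt_or_eq with d | d
        · exact (le01 _ _ (by linarith) d (by linarith)).le
        · rw [d]
      have r1 : W z - W e0 ≤ (1 + η) * (W x - W e0) := by nlinarith
      refine le_of_mul_le_mul_right ?_ (mul_pos (show 0 < W x - W e0 by linarith)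
        (show 0 < z - e0 by linarith))
      calc _ = (W x - W e0) * (W z - W y) * ((y - x) * (z - e0)) := by ring
        _ ≤ _ := h
        _ ≤ K * ((z - e0) * (z - y) * ((W y - W x) * ((1 + η) * (W x - W e0)))) := by
            gcongr <;> first | linarith | exact mul_nonneg (by linarith) (by linarith)
        _ = _ := by ring
    have key : ∀ x y, i0 ≤ x → x < y → y ≤ i1 →
        (W y - W x) * (i1 - i0) ≤ K * (1 + η) * ((y - x) * (W i1 - W i0)) ∧
        (y - x) * (W i1 - W i0) ≤ K * (1 + η) * ((W y - W x) * (i1 - i0)) := by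
      intro x y a b c
      have q1 := le01 x y (by linarith) b (by linarith)
      have m1 : 0 < (y - x) * (W y - W x) := mul_pos (by linarith) (by linarith)
      have A : (W y - W x) * (x - i0) ≤ K * (1 + η) * ((y - x) * (W x - W i0)) ∧
          (W x - W i0) * (y - x) ≤ K * (1 + η) * ((x - i0) * (W y - W x)) := by
        rcases a.lt_or_eq with d | d
        · exact ⟨adjL i0 x y le_rfl d b c, adjR i0 x y le_rfl d b c⟩
        · rw [d]; simp
      have B : (W y - W x) * (i1 - y) ≤ K * (1 + η) * ((y - x) * (W i1 - W y)) ∧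
          (W i1 - W y) * (y - x) ≤ K * (1 + η) * ((i1 - y) * (W y - W x)) := by
        rcases c.lt_or_eq with d | d
        · exact ⟨adjR x y i1 a b d le_rfl, adjL x y i1 a b d le_rfl⟩
        · rw [d]; simp
      have C : (y - x) * (W y - W x) ≤ K * (1 + η) * ((y - x) * (W y - W x)) := by nlinarith
      constructor
      · nlinarith [A.1, B.1, C]
      · nlinarith [A.2, B.2, C]
    intro x y hx hxy hy
    rcases hxy.lt_or_eq with hxy | hxy
    · obtain ⟨k1, k2⟩ := key (i0 + x * (i1 - i0)) (i0 + y * (i1 - i0)) (by nlinarith)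
        (by nlinarith) (by nlinarith)
      have e : V y - V x = (W (i0 + y * (i1 - i0)) - W (i0 + x * (i1 - i0))) / (W i1 - W i0) := by
        simp only [V]; ring
      rw [e]
      constructor
      · rw [div_le_iff₀ hw]
        refine le_of_mul_le_mul_right ?_ hs
        linarith
      · rw [mul_div_assoc', le_div_iff₀ hw]
        refine le_of_mul_le_mul_right ?_ hs
        linarith
    · subst hxy; simp
end LW

namespace LW

/-- pointwise inequality from convexity of `1/√F'` -/
lemma schw_convex {F : ℝ → ℝ} {A B : ℝ} (hC : ContDiffOn ℝ 3 F (Ioo A B))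
    (hpos : ∀ x ∈ Ioo A B, 0 < deriv F x) (hS : ∀ x ∈ Ioo A B, schwarzian F x < 0) :
    ConvexOn ℝ (Ioo A B) (fun x => (deriv F x) ^ (-(1/2) : ℝ)) := by
  have hd1 : ContDiffOn ℝ 2 (deriv F) (Ioo A B) :=
    ((contDiffOn_succ_iff_deriv_of_isOpen (n := 2) isOpen_Ioo).1 (by
      have : (2 + 1 : WithTop ℕ∞) = 3 := by norm_num
      rw [this]; exact hC)).2.2
  have hd2 : ContDiffOn ℝ 1 (deriv (deriv F)) (Ioo A B) :=
    ((contDiffOn_succ_iff_deriv_of_isOpen (n := 1) isOpen_Ioo).1 (by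
      have : (1 + 1 : WithTop ℕ∞) = 2 := by norm_num
      rw [this]; exact hd1)).2.2
  have D1 : ∀ x ∈ Ioo A B, HasDerivAt (deriv F) (deriv (deriv F) x) x := fun x hx =>
    ((hd1.differentiableOn (by norm_num)).differentiableAt (isOpen_Ioo.mem_nhds hx)).hasDerivAt
  have D2 : ∀ x ∈ Ioo A B, HasDerivAt (deriv (deriv F)) (deriv (deriv (deriv F)) x) x :=
    fun x hx =>
    ((hd2.differentiableOn (by norm_num)).differentiableAt (isOpen_Ioo.mem_nhds hx)).hasDerivAt
  have H1 : ∀ x ∈ Ioo A B, HasDerivAt (fun x => (deriv F x) ^ (-(1/2) : ℝ))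
      (deriv (deriv F) x * (-(1/2)) * (deriv F x) ^ (-(1/2) - 1 : ℝ)) x := fun x hx => by
    exact (D1 x hx).rpow_const (Or.inl (hpos x hx).ne')
  have H2 : ∀ x ∈ Ioo A B, HasDerivAt
      (fun x => deriv (deriv F) x * (-(1/2)) * (deriv F x) ^ (-(1/2) - 1 : ℝ))
      (deriv (deriv (deriv F)) x * (-(1/2)) * (deriv F x) ^ (-(1/2) - 1 : ℝ) +
       deriv (deriv F) x * (-(1/2)) *
         (deriv (deriv F) x * (-(1/2) - 1) * (deriv F x) ^ (-(1/2) - 1 - 1 : ℝ))) x :=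
    fun x hx => ((D2 x hx).mul_const _).mul ((D1 x hx).rpow_const (Or.inl (hpos x hx).ne'))
  refine convexOn_of_hasDerivWithinAt2_nonneg (convex_Ioo A B)
    (f' := fun x => deriv (deriv F) x * (-(1/2)) * (deriv F x) ^ (-(1/2) - 1 : ℝ))
    (f'' := fun x => (deriv (deriv (deriv F)) x * (-(1/2)) * (deriv F x) ^ (-(1/2) - 1 : ℝ) +
       deriv (deriv F) x * (-(1/2)) *
         (deriv (deriv F) x * (-(1/2) - 1) * (deriv F x) ^ (-(1/2) - 1 - 1 : ℝ)))) ?_ ?_ ?_ ?_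
  · intro x hx; exact (H1 x hx).continuousAt.continuousWithinAt
  · rw [interior_Ioo]; intro x hx; exact (H1 x hx).hasDerivWithinAt
  · rw [interior_Ioo]; intro x hx; exact (H2 x hx).hasDerivWithinAt
  · rw [interior_Ioo]; intro x hx
    have hp := hpos x hx
    have hs := hS x hx
    unfold schwarzian at hs
    set d := deriv F x
    set d2 := deriv (deriv F) x
    set d3 := deriv (deriv (deriv F)) x
    have e : d ^ (-(1/2) - 1 : ℝ) = d ^ (-(1/2) - 1 - 1 : ℝ) * d := by
      conv_lhs => rw [show (-(1/2) - 1 : ℝ) = (-(1/2) - 1 - 1) + 1 by ring]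
      rw [Real.rpow_add hp, Real.rpow_one]
    have hz : 0 < d ^ (-(1/2) - 1 - 1 : ℝ) := Real.rpow_pos_of_pos hp _
    have e2 : d3 / d - 3 / 2 * (d2 / d) ^ 2 = (d3 * d - 3 / 2 * d2 ^ 2) / d ^ 2 := by
      field_simp
    rw [e2, div_neg_iff] at hs
    have hs' : d3 * d - 3 / 2 * d2 ^ 2 < 0 := by
      rcases hs with h | h
      · nlinarith [sq_nonneg d]
      · exact h.1
    simp only [e]
    nlinarith

lemma schw_two {F : ℝ → ℝ} {A B : ℝ} (hC : ContDiffOn ℝ 3 F (Ioo A B))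
    (hpos : ∀ x ∈ Ioo A B, 0 < deriv F x) (hS : ∀ x ∈ Ioo A B, schwarzian F x < 0)
    {x y : ℝ} (hx : A < x) (hxy : x < y) (hy : y < B) :
    deriv F x * deriv F y * (y - x) ^ 2 ≤ (F y - F x) ^ 2 := by
  have hcv := schw_convex hC hpos hS
  set h : ℝ → ℝ := fun x => (deriv F x) ^ (-(1/2) : ℝ) with hh
  have mx : x ∈ Ioo A B := ⟨hx, by linarith⟩
  have my : y ∈ Ioo A B := ⟨by linarith, hy⟩
  have hp : ∀ z ∈ Ioo A B, 0 < h z := fun z hz => Real.rpow_pos_of_pos (hpos z hz) _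
  have hsq : ∀ z ∈ Ioo A B, deriv F z * (h z) ^ 2 = 1 := fun z hz => by
    have := hpos z hz
    rw [hh]; simp only
    rw [← Real.rpow_natCast, ← Real.rpow_mul this.le]
    nth_rewrite 1 [← Real.rpow_one (deriv F z)]
    rw [← Real.rpow_add this]; norm_num
  have hpx := hp x mx
  have hpy := hp y my
  -- comparison function: linear interpolation `ell`
  set ell : ℝ → ℝ := fun z => ((y - z) * h x + (z - x) * h y) with hell
  have hlp : ∀ z ∈ Icc x y, 0 < ell z := fun z hz => by
    rw [hell]; simp only
    rcases hz.1.lt_or_eq with q | q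
    · nlinarith [mul_nonneg (sub_nonneg.2 hz.2) hpx.le, mul_pos (sub_pos.2 q) hpy]
    · rw [← q]; nlinarith
  have hle : ∀ z ∈ Ioo x y, h z * (y - x) ≤ ell z := fun z hz => by
    have hne : y - x ≠ 0 := sub_ne_zero.2 hxy.ne'
    have := hcv.2 mx my (show (0:ℝ) ≤ (y - z) / (y - x) by apply div_nonneg <;> linarith [hz.1, hz.2])
      (show (0:ℝ) ≤ (z - x) / (y - x) by apply div_nonneg <;> linarith [hz.1, hz.2])
      (by rw [← add_div, div_eq_one_iff_eq hne]; ring)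
    have e : ((y - z) / (y - x)) • x + ((z - x) / (y - x)) • y = z := by
      simp only [smul_eq_mul]; field_simp; ring
    rw [e] at this
    simp only [smul_eq_mul] at this
    calc h z * (y - x) ≤ ((y - z) / (y - x) * h x + (z - x) / (y - x) * h y) * (y - x) :=
          mul_le_mul_of_nonneg_right this (by linarith)
      _ = _ := by rw [hell]; field_simp
  -- antiderivative of 1/ell^2
  set G : ℝ → ℝ := fun z => (z - x) / (h x * ell z) with hG
  have hGd : ∀ z ∈ Icc x y, HasDerivAt G ((y - x) / (ell z) ^ 2) z := fun z hz => by
    have hl : HasDerivAt ell (-1 * h x + 1 * h y) z := by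
      rw [hell]
      exact ((((hasDerivAt_id z).const_sub y)).mul_const _).add
        (((hasDerivAt_id z).sub_const x).mul_const _)
    have := ((hasDerivAt_id z).sub_const x).div (hl.const_mul (h x))
      (mul_pos hpx (hlp z hz)).ne'
    refine this.congr_deriv ?_
    have hz0 := (hlp z hz).ne'
    have hx0 := hpx.ne'
    have e : ell z = (y - z) * h x + (z - x) * h y := rfl
    simp only [id]
    rw [div_eq_div_iff (by positivity) (by positivity), e]; ring
  have hFd : ∀ z ∈ Icc x y, HasDerivAt F (deriv F z) z := fun z hz => by
    have : z ∈ Ioo A B := ⟨by linarith [hz.1], by linarith [hz.2]⟩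
    exact ((hC.differentiableOn (by norm_num)).differentiableAt
      (isOpen_Ioo.mem_nhds this)).hasDerivAt
  have mono : MonotoneOn (fun z => F z - (y - x) * G z) (Icc x y) := by
    refine monotoneOn_of_hasDerivWithinAt_nonneg (convex_Icc x y)
      (f' := fun z => deriv F z - (y - x) * ((y - x) / (ell z) ^ 2)) ?_ ?_ ?_
    · intro z hz
      exact ((hFd z hz).sub ((hGd z hz).const_mul _)).continuousAt.continuousWithinAt
    · rw [interior_Icc]; intro z hz
      exact ((hFd z (Ioo_subset_Icc_self hz)).sub
        ((hGd z (Ioo_subset_Icc_self hz)).const_mul _)).hasDerivWithinAt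
    · rw [interior_Icc]; intro z hz
      have mz : z ∈ Ioo A B := ⟨by linarith [hz.1], by linarith [hz.2]⟩
      have h1 := hle z hz
      have h2 := hsq z mz
      have h3 := hlp z (Ioo_subset_Icc_self hz)
      have h4 := hp z mz
      have h5 := hpos z mz
      have : (y - x) * ((y - x) / (ell z) ^ 2) = (y - x) ^ 2 / (ell z) ^ 2 := by ring
      rw [this, sub_nonneg, div_le_iff₀ (by positivity)]
      have h6 : (h z * (y - x)) ^ 2 ≤ ell z ^ 2 :=
        pow_le_pow_left₀ (mul_nonneg h4.le (by linarith)) h1 2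
      calc (y - x) ^ 2 = deriv F z * (h z * (y - x)) ^ 2 := by
            rw [mul_pow, ← mul_assoc, h2, one_mul]
        _ ≤ _ := mul_le_mul_of_nonneg_left h6 h5.le
  have hm := mono (left_mem_Icc.2 hxy.le) (right_mem_Icc.2 hxy.le) hxy.le
  have e1 : G x = 0 := by simp [hG]
  have e2 : (y - x) * G y = (y - x) / (h x * h y) := by
    have hne : y - x ≠ 0 := sub_ne_zero.2 hxy.ne'
    simp only [hG, hell]; field_simp; ring
  simp only [e1, e2] at hm
  have h7 : (y - x) / (h x * h y) ≤ F y - F x := by linarith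
  have h8 : 0 ≤ (y - x) / (h x * h y) := by apply div_nonneg; linarith; positivity
  have h9 := pow_le_pow_left₀ h8 h7 2
  have hx1 := hsq x mx
  have hy1 := hsq y my
  refine le_trans (le_of_eq ?_) h9
  rw [div_pow, mul_pow, eq_div_iff (by positivity)]
  calc _ = (deriv F x * h x ^ 2) * (deriv F y * h y ^ 2) * (y - x) ^ 2 := by ring
    _ = _ := by rw [hx1, hy1]; ring

lemma schw_qcr_open {F : ℝ → ℝ} {A B : ℝ} (hC : ContDiffOn ℝ 3 F (Ioo A B))
    (hpos : ∀ x ∈ Ioo A B, 0 < deriv F x) (hS : ∀ x ∈ Ioo A B, schwarzian F x < 0)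
    {x1 x2 x3 x4 : ℝ} (h1 : A < x1) (h12 : x1 < x2) (h23 : x2 < x3) (h34 : x3 < x4) (h4 : x4 < B) :
    (F x2 - F x1) * (F x4 - F x3) * ((x3 - x2) * (x4 - x1)) ≤
      1 * ((x2 - x1) * (x4 - x3) * ((F x3 - F x2) * (F x4 - F x1))) := by
  have hFd : ∀ z ∈ Ioo A B, HasDerivAt F (deriv F z) z := fun z hz =>
    ((hC.differentiableOn (by norm_num)).differentiableAt (isOpen_Ioo.mem_nhds hz)).hasDerivAt
  have sm : StrictMonoOn F (Ioo A B) := by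
    refine strictMonoOn_of_deriv_pos (convex_Ioo A B)
      (fun z hz => (hFd z hz).continuousAt.continuousWithinAt) ?_
    rw [interior_Ioo]; exact hpos
  have lt : ∀ x y, A < x → x < y → y < B → F x < F y := fun x y a b c =>
    sm ⟨a, by linarith⟩ ⟨by linarith, c⟩ b
  -- first monotonicity
  have step1 : ∀ y, x2 < y → y < B →
      deriv F y / (F y - F x2) - 1 / (y - x2) ≤ deriv F y / (F y - F x1) - 1 / (y - x1) := by
    intro y hy hyB
    have anti : AntitoneOn (fun x => deriv F y / (F y - F x) - 1 / (y - x)) (Icc x1 x2) := by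
      have D : ∀ x ∈ Icc x1 x2, HasDerivAt (fun x => deriv F y / (F y - F x) - 1 / (y - x))
          (deriv F y * deriv F x / (F y - F x) ^ 2 - 1 / (y - x) ^ 2) x := by
        intro x hx
        have hlt := lt x y (by linarith [hx.1]) (by linarith [hx.2]) hyB
        have hm : x ∈ Ioo A B := ⟨by linarith [hx.1], by linarith [hx.2]⟩
        have n1 : F y - F x ≠ 0 := by linarith
        have n2 : y - x ≠ 0 := by linarith [hx.2]
        have a := (hasDerivAt_const x (deriv F y)).div ((hFd x hm).const_sub (F y)) n1
        have b := (hasDerivAt_const x (1 : ℝ)).div ((hasDerivAt_id x).const_sub y) n2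
        have := a.sub b
        refine this.congr_deriv ?_
        simp only [id, zero_mul, zero_sub, mul_neg, neg_neg, mul_one]
      refine antitoneOn_of_hasDerivWithinAt_nonpos (convex_Icc x1 x2)
        (f' := fun x => (deriv F y * deriv F x / (F y - F x) ^ 2 - 1 / (y - x) ^ 2)) ?_ ?_ ?_
      · intro x hx; exact (D x hx).continuousAt.continuousWithinAt
      · intro x hx; exact (D x (interior_subset hx)).hasDerivWithinAt
      · intro x hx
        have hx := interior_subset hx
        have hlt := lt x y (by linarith [hx.1]) (by linarith [hx.2]) hyB
        have := schw_two hC hpos hS (x := x) (y := y) (by linarith [hx.1]) (by linarith [hx.2]) hyB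
        rw [sub_nonpos, div_le_div_iff₀ (by nlinarith) (by nlinarith [hx.2])]
        linarith
    exact anti (left_mem_Icc.2 h12.le) (right_mem_Icc.2 h12.le) h12.le
  have mono : MonotoneOn (fun y => Real.log (F y - F x1) - Real.log (F y - F x2)
      - (Real.log (y - x1) - Real.log (y - x2))) (Icc x3 x4) := by
    have D : ∀ y ∈ Icc x3 x4, HasDerivAt (fun y => Real.log (F y - F x1) - Real.log (F y - F x2)
      - (Real.log (y - x1) - Real.log (y - x2))) (deriv F y / (F y - F x1) - deriv F y / (F y - F x2)
      - (1 / (y - x1) - 1 / (y - x2))) y := by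
      intro y hy
      have hm : y ∈ Ioo A B := ⟨by linarith [hy.1], by linarith [hy.2]⟩
      have q1 := lt x1 y h1 (by linarith [hy.1]) hm.2
      have q2 := lt x2 y (by linarith) (by linarith [hy.1]) hm.2
      have d := hFd y hm
      exact ((d.sub_const (F x1)).log (by linarith) |>.sub ((d.sub_const (F x2)).log (by linarith))).sub
        ((((hasDerivAt_id y).sub_const x1).log (by simp only [id]; linarith [hy.1])).sub
          (((hasDerivAt_id y).sub_const x2).log (by simp only [id]; linarith [hy.1])))
    refine monotoneOn_of_hasDerivWithinAt_nonneg (convex_Icc x3 x4)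
      (f' := fun y => (deriv F y / (F y - F x1) - deriv F y / (F y - F x2)
      - (1 / (y - x1) - 1 / (y - x2)))) ?_ ?_ ?_
    · intro x hx; exact (D x hx).continuousAt.continuousWithinAt
    · intro x hx; exact (D x (interior_subset hx)).hasDerivWithinAt
    · intro x hx
      have hx := interior_subset hx
      have := step1 x (by linarith [hx.1]) (by linarith [hx.2])
      linarith
  have hm := mono (left_mem_Icc.2 h34.le) (right_mem_Icc.2 h34.le) h34.le
  simp only at hm
  have a1 := lt x1 x3 h1 (by linarith) (by linarith)
  have a2 := lt x2 x3 (by linarith) (by linarith) (by linarith)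
  have a3 := lt x1 x4 h1 (by linarith) (by linarith)
  have a4 := lt x2 x4 (by linarith) (by linarith) (by linarith)
  have hlog : Real.log ((F x3 - F x1) * (x3 - x2) * ((F x4 - F x2) * (x4 - x1))) ≤
      Real.log ((F x4 - F x1) * (x4 - x2) * ((F x3 - F x2) * (x3 - x1))) := by
    have p : ∀ a b c d : ℝ, 0 < a → 0 < b → 0 < c → 0 < d →
        Real.log (a * b * (c * d)) = Real.log a + Real.log b + (Real.log c + Real.log d) := by
      intro a b c d ha hb hc hd
      rw [Real.log_mul (by positivity) (by positivity), Real.log_mul ha.ne' hb.ne',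
        Real.log_mul hc.ne' hd.ne']
    rw [p _ _ _ _ (by linarith) (by linarith) (by linarith) (by linarith),
      p _ _ _ _ (by linarith) (by linarith) (by linarith) (by linarith)]
    linarith
  have pp : ∀ a b c d : ℝ, 0 < a → 0 < b → 0 < c → 0 < d → 0 < a * b * (c * d) := by
    intro a b c d ha hb hc hd; positivity
  have := (Real.log_le_log_iff (pp _ _ _ _ (by linarith) (by linarith) (by linarith) (by linarith))
    (pp _ _ _ _ (by linarith) (by linarith) (by linarith) (by linarith))).1 hlog
  linarith

lemma schw_qcr {F G : ℝ → ℝ} {A B : ℝ} (hAB : A < B) (hC : ContDiffOn ℝ 3 F (Ioo A B))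
    (hpos : ∀ x ∈ Ioo A B, 0 < deriv F x) (hS : ∀ x ∈ Ioo A B, schwarzian F x < 0)
    (hFG : ∀ x ∈ Ioo A B, G x = F x) (cG : ContinuousOn G (Icc A B)) : QCR 1 G A B := by
  intro x1 x2 x3 x4 h1 h12 h23 h34 h4
  -- approximations
  set m := (A + B) / 2
  let γ : ℝ → ℝ → ℝ := fun x t => x + t * (m - x)
  have hin : ∀ x ∈ Icc A B, ∀ t ∈ Ioo (0:ℝ) 1, γ x t ∈ Ioo A B := by
    intro x hx t ht
    have h5 : A < m := by simp only [m]; linarith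
    have h6 : m < B := by simp only [m]; linarith
    constructor <;> simp only [γ] <;> nlinarith [hx.1, hx.2, ht.1, ht.2, mul_pos ht.1 (sub_pos.2 h5), mul_pos ht.1 (sub_pos.2 h6), mul_nonneg (sub_pos.2 ht.2).le (sub_nonneg.2 hx.1), mul_nonneg (sub_pos.2 ht.2).le (sub_nonneg.2 hx.2)]
  have ten : ∀ x ∈ Icc A B, Tendsto (fun t => G (γ x t)) (𝓝[>] 0) (𝓝 (G x)) := by
    intro x hx
    have c1 : Tendsto (γ x) (𝓝[>] 0) (𝓝[Icc A B] x) := by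
      refine tendsto_nhdsWithin_iff.2 ⟨?_, ?_⟩
      · have : Continuous (γ x) := by fun_prop
        have := (this.tendsto 0)
        simp only [γ, zero_mul, add_zero] at this
        exact this.mono_left nhdsWithin_le_nhds
      · filter_upwards [Ioo_mem_nhdsGT (show (0:ℝ) < 1 by norm_num)] with t ht
        exact Ioo_subset_Icc_self (hin x hx t ht)
    exact (cG x hx).tendsto.comp c1
  have ten' : ∀ x : ℝ, Tendsto (γ x) (𝓝[>] 0) (𝓝 x) := by
    intro x
    have : Continuous (γ x) := by fun_prop
    have := (this.tendsto 0)
    simp only [γ, zero_mul, add_zero] at this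
    exact this.mono_left nhdsWithin_le_nhds
  have m1 : x1 ∈ Icc A B := ⟨by linarith, by linarith⟩
  have m2 : x2 ∈ Icc A B := ⟨by linarith, by linarith⟩
  have m3 : x3 ∈ Icc A B := ⟨by linarith, by linarith⟩
  have m4 : x4 ∈ Icc A B := ⟨by linarith, by linarith⟩
  have L := ((((ten x2 m2).sub (ten x1 m1)).mul ((ten x4 m4).sub (ten x3 m3))).mul
    (((ten' x3).sub (ten' x2)).mul ((ten' x4).sub (ten' x1))))
  have R := (((((ten' x2).sub (ten' x1)).mul ((ten' x4).sub (ten' x3))).mul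
    (((ten x3 m3).sub (ten x2 m2)).mul ((ten x4 m4).sub (ten x1 m1)))).const_mul 1)
  refine le_of_tendsto_of_tendsto L R ?_
  filter_upwards [Ioo_mem_nhdsGT (show (0:ℝ) < 1 by norm_num)] with t ht
  rw [hFG _ (hin x1 m1 t ht), hFG _ (hin x2 m2 t ht), hFG _ (hin x3 m3 t ht),
    hFG _ (hin x4 m4 t ht)]
  have o : ∀ x y : ℝ, x < y → γ x t < γ y t := fun x y h => by
    simp only [γ]; nlinarith [ht.2]
  exact schw_qcr_open hC hpos hS (hin x1 m1 t ht).1 (o _ _ h12) (o _ _ h23) (o _ _ h34)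
    (hin x4 m4 t ht).2
end LW

namespace LW

/-- conjugation by `x ↦ 1 - x` -/
def flp (F : ℝ → ℝ) : ℝ → ℝ := fun x => 1 - F (1 - x)

lemma flp_flp (F : ℝ → ℝ) : flp (flp F) = F := by funext x; simp [flp]

lemma flp_iter (F : ℝ → ℝ) (n : ℕ) (x : ℝ) : (flp F)^[n] x = 1 - F^[n] (1 - x) := by
  induction n generalizing x with
  | zero => simp
  | succ n ih => rw [Function.iterate_succ_apply, ih, Function.iterate_succ_apply]; simp [flp]

lemma QCR.flip {K : ℝ} {F : ℝ → ℝ} {e0 e1 : ℝ} (h : QCR K F e0 e1) :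
    QCR K (flp F) (1 - e1) (1 - e0) := by
  intro x1 x2 x3 x4 a b c d e
  have := h (1 - x4) (1 - x3) (1 - x2) (1 - x1) (by linarith) (by linarith) (by linarith)
    (by linarith) (by linarith)
  simp only [flp]
  linarith

lemma BL.flip {κ : ℝ} {F : ℝ → ℝ} (h : BL κ F) : BL κ (flp F) := by
  intro x y a b c
  have := h (1 - y) (1 - x) (by linarith) (by linarith) (by linarith)
  simp only [flp]
  constructor <;> linarith [this.1, this.2]

lemma sm_flip {F : ℝ → ℝ} {A B : ℝ} (h : StrictMonoOn F (Icc A B)) :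
    StrictMonoOn (flp F) (Icc (1 - B) (1 - A)) := by
  intro x hx y hy hxy
  have := h (a := 1 - y) ⟨by linarith [hy.2], by linarith [hy.1]⟩ (b := 1 - x)
    ⟨by linarith [hx.2], by linarith [hx.1]⟩ (by linarith)
  simp only [flp]; linarith

lemma cont_flip {F : ℝ → ℝ} {A B : ℝ} (h : ContinuousOn F (Icc A B)) :
    ContinuousOn (flp F) (Icc (1 - B) (1 - A)) := by
  have : ContinuousOn (fun x => F (1 - x)) (Icc (1 - B) (1 - A)) :=
    h.comp (by fun_prop) (fun x hx => ⟨by linarith [hx.2], by linarith [hx.1]⟩)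
  exact continuousOn_const.sub this

structure Pair (fl fr : ℝ → ℝ) (c : ℝ) : Prop where
  c0 : 0 < c
  c1 : c < 1
  fl0 : fl 0 = 0
  fr1 : fr 1 = 1
  mL : StrictMonoOn fl (Icc 0 c)
  mR : StrictMonoOn fr (Icc c 1)
  cL : ContinuousOn fl (Icc 0 c)
  cR : ContinuousOn fr (Icc c 1)
  l1 : fl c ≤ 1
  r0 : 0 ≤ fr c

lemma Pair.flip {fl fr : ℝ → ℝ} {c : ℝ} (h : Pair fl fr c) : Pair (flp fr) (flp fl) (1 - c) where
  c0 := by linarith [h.c1]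
  c1 := by linarith [h.c0]
  fl0 := by simp [flp, h.fr1]
  fr1 := by simp [flp, h.fl0]
  mL := by have := sm_flip h.mR; rwa [sub_self] at this
  mR := by have := sm_flip h.mL; rwa [sub_zero] at this
  cL := by have := cont_flip h.cR; rwa [sub_self] at this
  cR := by have := cont_flip h.cL; rwa [sub_zero] at this
  l1 := by simp [flp, h.r0]
  r0 := by simp [flp, h.l1]

structure Diff (K κ : ℝ) (φ : ℝ → ℝ) : Prop where
  z : φ 0 = 0
  o : φ 1 = 1
  m : StrictMonoOn φ (Icc 0 1)
  cn : ContinuousOn φ (Icc 0 1)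
  q : QCR K φ 0 1
  bl : BL κ φ

def Sf (α c x : ℝ) : ℝ := ((c - x) / c) ^ α

def Half (α K κ : ℝ) (F : ℝ → ℝ) (c : ℝ) : Prop :=
  ∃ (u : ℝ) (φ : ℝ → ℝ), 0 < u ∧ u ≤ 1 ∧ Diff K κ φ ∧
    (∀ x ∈ Icc 0 c, F x = φ (u * (1 - Sf α c x))) ∧ QCR 1 F 0 c

lemma Sf_zero {α c : ℝ} (hc : 0 < c) : Sf α c 0 = 1 := by
  simp [Sf, div_self hc.ne']

lemma Sf_c {α c : ℝ} (hα : 1 < α) : Sf α c c = 0 := by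
  simp [Sf, Real.zero_rpow (by linarith : α ≠ 0)]

lemma Sf_nonneg {α c x : ℝ} (hc : 0 < c) (hx : x ≤ c) : 0 ≤ Sf α c x :=
  Real.rpow_nonneg (div_nonneg (by linarith) hc.le) _

lemma Sf_anti {α c x y : ℝ} (hα : 1 < α) (hc : 0 < c) (hxy : x < y) (hy : y ≤ c) :
    Sf α c y < Sf α c x :=
  Real.rpow_lt_rpow (div_nonneg (by linarith) hc.le)
    (div_lt_div_of_pos_right (by linarith) hc) (by linarith)

lemma Sf_le_one {α c x : ℝ} (hα : 1 < α) (hc : 0 < c) (hx : 0 ≤ x) (hxc : x ≤ c) :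
    Sf α c x ≤ 1 := by
  rw [← Sf_zero (α := α) hc]
  rcases hx.lt_or_eq with h | h
  · exact (Sf_anti hα hc h hxc).le
  · rw [h]

lemma Sf_cont {α c : ℝ} (hα : 1 < α) : Continuous (Sf α c) := by
  unfold Sf
  exact ((continuous_const.sub continuous_id).div_const _).rpow_const
    (fun x => Or.inr (by linarith))

lemma q_mem {α c u x : ℝ} (hα : 1 < α) (hc : 0 < c) (hu : 0 ≤ u) (hu1 : u ≤ 1)
    (hx : x ∈ Icc 0 c) : u * (1 - Sf α c x) ∈ Icc 0 u := by
  have h1 := Sf_le_one hα hc hx.1 hx.2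
  have h2 := Sf_nonneg (α := α) hc hx.2
  constructor <;> nlinarith

/-- basic properties of a branch -/
lemma branch_basic {α c u : ℝ} {φ F : ℝ → ℝ} (hα : 1 < α) (hc : 0 < c) (hu : 0 < u) (hu1 : u ≤ 1)
    (z : φ 0 = 0) (o : φ 1 = 1) (m : StrictMonoOn φ (Icc 0 1)) (cn : ContinuousOn φ (Icc 0 1))
    (hF : ∀ x ∈ Icc 0 c, F x = φ (u * (1 - Sf α c x))) :
    F 0 = 0 ∧ StrictMonoOn F (Icc 0 c) ∧ ContinuousOn F (Icc 0 c) ∧ F c ≤ 1 ∧ F c = φ u := by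
  have hm : ∀ x ∈ Icc 0 c, u * (1 - Sf α c x) ∈ Icc (0:ℝ) 1 := fun x hx =>
    ⟨(q_mem hα hc hu.le hu1 hx).1, (q_mem hα hc hu.le hu1 hx).2.trans hu1⟩
  have ec : F c = φ u := by
    rw [hF c ⟨hc.le, le_rfl⟩, Sf_c hα]; simp
  refine ⟨?_, ?_, ?_, ?_, ec⟩
  · rw [hF 0 ⟨le_rfl, hc.le⟩, Sf_zero hc]; simp [z]
  · intro x hx y hy hxy
    rw [hF x hx, hF y hy]
    refine m (hm x hx) (hm y hy) ?_
    have := Sf_anti hα hc hxy hy.2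
    nlinarith
  · have : ContinuousOn (fun x => φ (u * (1 - Sf α c x))) (Icc 0 c) :=
      cn.comp (by have := Sf_cont (c := c) hα; fun_prop) hm
    exact this.congr hF
  · rw [ec, ← o]
    exact m.monotoneOn ⟨hu.le, hu1⟩ (right_mem_Icc.2 zero_le_one) hu1

lemma Half.basic {α K κ c : ℝ} {F : ℝ → ℝ} (hα : 1 < α) (hc : 0 < c) (h : Half α K κ F c) :
    F 0 = 0 ∧ StrictMonoOn F (Icc 0 c) ∧ ContinuousOn F (Icc 0 c) ∧ F c ≤ 1 := by
  obtain ⟨u, φ, hu, hu1, hD, hF, -⟩ := h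
  have := branch_basic hα hc hu hu1 hD.z hD.o hD.m hD.cn hF
  exact ⟨this.1, this.2.1, this.2.2.1, this.2.2.2.1⟩

lemma pair_of_half {α K κ c : ℝ} {fl fr : ℝ → ℝ} (hα : 1 < α) (hc : 0 < c) (hc1 : c < 1)
    (hl : Half α K κ fl c) (hr : Half α K κ (flp fr) (1 - c)) : Pair fl fr c := by
  obtain ⟨a1, a2, a3, a4⟩ := hl.basic hα hc
  obtain ⟨b1, b2, b3, b4⟩ := hr.basic hα (by linarith)
  refine ⟨hc, hc1, a1, ?_, a2, ?_, a3, ?_, a4, ?_⟩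
  · simp [flp] at b1; linarith
  · have := sm_flip b2; simpa [flp_flp] using this
  · have := cont_flip b3; simpa [flp_flp] using this
  · simp [flp] at b4; linarith

lemma Half.ineq {α K κ c : ℝ} {F : ℝ → ℝ} (hα : 1 < α) (hκ : 1 ≤ κ) (hc : 0 < c)
    (h : Half α K κ F c) {x y : ℝ} (hx : 0 ≤ x) (hxy : x ≤ y) (hy : y ≤ c) :
    F y - F x ≤ κ ^ 2 * F c * (Sf α c x - Sf α c y) ∧
      F c * (Sf α c x - Sf α c y) ≤ κ ^ 2 * (F y - F x) := by
  obtain ⟨u, φ, hu, hu1, hD, hF, -⟩ := h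
  have hb := branch_basic hα hc hu hu1 hD.z hD.o hD.m hD.cn hF
  rw [hb.2.2.2.2, hF x ⟨hx, by linarith⟩, hF y ⟨by linarith, hy⟩]
  have mx := q_mem hα hc hu.le hu1 (show x ∈ Icc 0 c from ⟨hx, by linarith⟩)
  have my := q_mem hα hc hu.le hu1 (show y ∈ Icc 0 c from ⟨by linarith, hy⟩)
  have hs : Sf α c y ≤ Sf α c x := by
    rcases hxy.lt_or_eq with h | h
    · exact (Sf_anti hα hc h hy).le
    · rw [h]
  have h1 := hD.bl (u * (1 - Sf α c x)) (u * (1 - Sf α c y)) mx.1 (by nlinarith)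
    (my.2.trans hu1)
  have h2 := hD.bl 0 u le_rfl hu.le hu1
  rw [hD.z] at h2
  have k0 : 0 < κ := by linarith
  have e : u * (1 - Sf α c y) - u * (1 - Sf α c x) = u * (Sf α c x - Sf α c y) := by ring
  rw [e] at h1
  set D := Sf α c x - Sf α c y
  have hD0 : 0 ≤ D := by simp only [D]; linarith
  simp only [sub_zero] at h2
  constructor
  · calc _ ≤ κ * (u * D) := h1.1
      _ ≤ κ * ((κ * φ u) * D) := by gcongr; exact h2.2
      _ = _ := by ring
  · calc φ u * D ≤ (κ * u) * D := by gcongr; exact h2.1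
      _ = κ * (u * D) := by ring
      _ ≤ κ * (κ * (φ (u * (1 - Sf α c y)) - φ (u * (1 - Sf α c x)))) :=
        mul_le_mul_of_nonneg_left h1.2 k0.le
      _ = _ := by ring

/-! level zero -/

def lb {α : ℝ} (f : LorenzMap α) : ℝ → ℝ := fun x => f.φ (f.u * (1 - Sf α f.c x))
def rb {α : ℝ} (f : LorenzMap α) : ℝ → ℝ :=
  fun x => f.ψ (1 + f.v * (-1 + ((x - f.c) / (1 - f.c)) ^ α))

lemma toFun_lt {α : ℝ} (f : LorenzMap α) {x : ℝ} (h : x < f.c) : f.toFun x = lb f x := by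
  simp [LorenzMap.toFun, lorenzQ, lb, h, Sf]
lemma toFun_ge {α : ℝ} (f : LorenzMap α) {x : ℝ} (h : f.c ≤ x) : f.toFun x = rb f x := by
  simp [LorenzMap.toFun, lorenzQ, rb, not_lt.2 h]

lemma lb_c {α : ℝ} (hα : 1 < α) (f : LorenzMap α) : lb f f.c = f.cv1 := by
  simp [lb, Sf_c hα, LorenzMap.cv1]
lemma rb_c {α : ℝ} (hα : 1 < α) (f : LorenzMap α) : rb f f.c = f.cv0 := by
  simp [rb, LorenzMap.cv0, Real.zero_rpow (by linarith : α ≠ 0)]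
  ring_nf

lemma flp_rb {α : ℝ} (f : LorenzMap α) (x : ℝ) :
    flp (rb f) x = flp f.ψ (f.v * (1 - Sf α (1 - f.c) x)) := by
  simp only [flp, rb, Sf]
  congr 2
  rw [show (1 - x - f.c) = 1 - f.c - x by ring]; ring

lemma pair_of_lorenz {α : ℝ} (hα : 1 < α) (f : LorenzMap α) (hu : f.u ≠ 0) (hv : f.v ≠ 0) :
    Pair (lb f) (rb f) f.c := by
  have c0 := f.hc.1
  have c1 := f.hc.2
  obtain ⟨a1, a2, a3, a4, -⟩ := branch_basic (F := lb f) hα c0 (lt_of_le_of_ne f.hu.1 hu.symm) f.hu.2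
    f.hφ0 f.hφ1 f.hφmono f.hφcont (fun x _ => rfl)
  have sm := sm_flip f.hψmono
  have cf := cont_flip f.hψcont
  simp only [sub_self, sub_zero] at sm cf
  obtain ⟨b1, b2, b3, b4, -⟩ := branch_basic (F := flp (rb f)) (c := 1 - f.c) (φ := flp f.ψ) hα
    (by linarith) (lt_of_le_of_ne f.hv.1 hv.symm) f.hv.2 (by simp [flp, f.hψ1]) (by simp [flp, f.hψ0])
    sm cf (fun x _ => flp_rb f x)
  refine ⟨c0, c1, a1, ?_, a2, ?_, a3, ?_, a4, ?_⟩
  · simp [flp] at b1; linarith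
  · have := sm_flip b2; simpa [flp_flp] using this
  · have := cont_flip b3; simpa [flp_flp] using this
  · simp [flp] at b4; linarith

lemma bl_of_distortion {φ : ℝ → ℝ} (h : IsOPDiffeo 1 φ) {δ : ℝ} (hδ : distortion φ ≤ δ) :
    BL (Real.exp δ) φ := by
  obtain ⟨hC, h0, h1, hm, hp⟩ := h
  set d := fun x => derivWithin φ (Icc 0 1) x with hd
  have hcd : ContinuousOn d (Icc 0 1) :=
    hC.continuousOn_derivWithin (uniqueDiffOn_Icc zero_lt_one) (by norm_num)
  have hdiff : DifferentiableOn ℝ φ (Icc 0 1) := hC.differentiableOn (by norm_num)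
  have hcl : ContinuousOn (fun x => Real.log (d x)) (Icc 0 1) := hcd.log (fun x hx => (hp x hx).ne')
  obtain ⟨B, hB⟩ := isCompact_Icc.exists_bound_of_continuousOn hcl
  have key : ∀ x ∈ Icc (0:ℝ) 1, ∀ y ∈ Icc (0:ℝ) 1, Real.log (d x / d y) ≤ 2 * B := by
    intro x hx y hy
    rw [Real.log_div (hp x hx).ne' (hp y hy).ne']
    have := abs_le.1 (hB x hx)
    have := abs_le.1 (hB y hy)
    linarith
  haveI : Nonempty (Icc (0:ℝ) 1) := ⟨⟨0, by norm_num, by norm_num⟩⟩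
  have key2 : ∀ x ∈ Icc (0:ℝ) 1, ∀ y ∈ Icc (0:ℝ) 1, Real.log (d x / d y) ≤ δ := by
    intro x hx y hy
    refine le_trans ?_ hδ
    unfold distortion
    have b1 : ∀ x : Icc (0:ℝ) 1, BddAbove (range fun y : Icc (0:ℝ) 1 =>
        Real.log (derivWithin φ (Icc 0 1) x.1 / derivWithin φ (Icc 0 1) y.1)) := fun x => by
      refine ⟨2 * B, ?_⟩
      rintro _ ⟨y, rfl⟩
      exact key x.1 x.2 y.1 y.2
    refine le_trans ?_ (le_ciSup (f := fun x : Icc (0:ℝ) 1 => ⨆ y : Icc (0:ℝ) 1,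
      Real.log (derivWithin φ (Icc 0 1) x.1 / derivWithin φ (Icc 0 1) y.1)) ?_ ⟨x, hx⟩)
    · exact le_ciSup (b1 ⟨x, hx⟩) ⟨y, hy⟩
    · refine ⟨2 * B, ?_⟩
      rintro _ ⟨x, rfl⟩
      exact ciSup_le (fun y => key x.1 x.2 y.1 y.2)
  have mvt : ∀ x y, 0 ≤ x → x < y → y ≤ 1 → ∃ ξ ∈ Icc (0:ℝ) 1, φ y - φ x = d ξ * (y - x) := by
    intro x y hx hxy hy
    obtain ⟨ξ, hξ, e⟩ := exists_deriv_eq_slope φ hxy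
      (hdiff.continuousOn.mono (Icc_subset_Icc hx hy))
      (hdiff.mono ((Ioo_subset_Icc_self).trans (Icc_subset_Icc hx hy)))
    have hm : ξ ∈ Ioo (0:ℝ) 1 := ⟨by linarith [hξ.1], by linarith [hξ.2]⟩
    refine ⟨ξ, Ioo_subset_Icc_self hm, ?_⟩
    have : d ξ = deriv φ ξ := derivWithin_of_mem_nhds (Icc_mem_nhds hm.1 hm.2)
    rw [this, e]; field_simp [sub_ne_zero.2 hxy.ne']
  obtain ⟨z, hz, ez⟩ := mvt 0 1 le_rfl zero_lt_one le_rfl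
  rw [h0, h1] at ez
  have dz : d z = 1 := by linarith
  have up : ∀ x ∈ Icc (0:ℝ) 1, d x ≤ Real.exp δ := fun x hx => by
    have := key2 x hx z hz
    rw [dz, div_one] at this
    exact (Real.log_le_iff_le_exp (hp x hx)).1 this
  have dn : ∀ x ∈ Icc (0:ℝ) 1, 1 ≤ Real.exp δ * d x := fun x hx => by
    have := key2 z hz x hx
    have hp := hp x hx
    rw [dz, Real.log_le_iff_le_exp (by positivity)] at this
    rwa [div_le_iff₀ hp] at this
  intro x y hx hxy hy
  rcases hxy.lt_or_eq with h | h
  · obtain ⟨ξ, hξ, e⟩ := mvt x y hx h hy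
    rw [e]
    have u1 := up ξ hξ
    have u2 := dn ξ hξ
    constructor <;> nlinarith
  · subst h; simp

lemma diff_of_distortion {φ : ℝ → ℝ} (h : IsOPDiffeo 1 φ) {δ : ℝ} (hδ0 : 0 ≤ δ)
    (hδ : distortion φ ≤ δ) : Diff (Real.exp (4 * δ)) (Real.exp δ) φ where
  z := h.2.1
  o := h.2.2.1
  m := h.2.2.2.1
  cn := h.1.continuousOn
  bl := bl_of_distortion h hδ
  q := by
    have := (bl_of_distortion h hδ).qcr (Real.one_le_exp hδ0)
    rwa [← Real.exp_nat_mul] at this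

lemma Diff.flip {K κ : ℝ} {φ : ℝ → ℝ} (h : Diff K κ φ) : Diff K κ (flp φ) where
  z := by simp [flp, h.o]
  o := by simp [flp, h.z]
  m := by simpa using sm_flip h.m
  cn := by simpa using cont_flip h.cn
  q := by simpa using h.q.flip
  bl := h.bl.flip

lemma neg_schw_pos {F : ℝ → ℝ} {A B : ℝ} (hm : StrictMonoOn F (Ioo A B))
    (hS : ∀ x ∈ Ioo A B, schwarzian F x < 0) : ∀ x ∈ Ioo A B, 0 < deriv F x := by
  intro x hx
  have h0 : 0 ≤ deriv F x := by
    rw [← derivWithin_of_mem_nhds (isOpen_Ioo.mem_nhds hx)]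
    exact hm.monotoneOn.derivWithin_nonneg
  refine lt_of_le_of_ne h0 (fun h => ?_)
  have := hS x hx
  simp [schwarzian, ← h] at this

lemma half_level0 {α : ℝ} (hα : 1 < α) (f : LorenzMap α) (hu : f.u ≠ 0) (hv : f.v ≠ 0)
    (h3 : f.IsCk 3) (hS : f.NegSchwarzian) {δ : ℝ} (hδ0 : 0 ≤ δ)
    (h1 : f.IsCk 1) (hφ : distortion f.φ ≤ δ) (hψ : distortion f.ψ ≤ δ) :
    Half α (Real.exp (4 * δ)) (Real.exp δ) (lb f) f.c ∧
    Half α (Real.exp (4 * δ)) (Real.exp δ) (flp (rb f)) (1 - f.c) := by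
  have P := pair_of_lorenz hα f hu hv
  have c0 := f.hc.1
  have c1 := f.hc.2
  refine ⟨⟨f.u, f.φ, lt_of_le_of_ne f.hu.1 hu.symm, f.hu.2, diff_of_distortion h1.1 hδ0 hφ,
    fun x _ => rfl, ?_⟩, ⟨f.v, flp f.ψ, lt_of_le_of_ne f.hv.1 hv.symm, f.hv.2,
    (diff_of_distortion h1.2 hδ0 hψ).flip, fun x _ => flp_rb f x, ?_⟩⟩
  · have hC : ContDiffOn ℝ 3 f.toFun (Ioo 0 f.c) := by
      have : ContDiffOn ℝ 3 (lb f) (Ioo 0 f.c) := by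
        have := h3.1.1
        refine ContDiffOn.comp (g := f.φ) (t := Icc 0 1) (by exact_mod_cast this) ?_ ?_
        · refine contDiffOn_const.mul (contDiffOn_const.sub ?_)
          unfold Sf
          refine ContDiffOn.rpow_const_of_ne (by fun_prop) ?_
          intro x hx
          exact (div_pos (by linarith [hx.2]) c0).ne'
        · intro x hx
          have := q_mem hα c0 f.hu.1 f.hu.2 (Ioo_subset_Icc_self hx)
          exact ⟨this.1, this.2.trans f.hu.2⟩
      exact this.congr (fun x hx => toFun_lt f hx.2)
    have hs : ∀ x ∈ Ioo 0 f.c, schwarzian f.toFun x < 0 := fun x hx =>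
      hS x ⟨⟨hx.1.le, by linarith [hx.2]⟩, by simpa using hx.2.ne⟩
    refine schw_qcr c0 hC (neg_schw_pos ?_ hs) hs (fun x hx => (toFun_lt f hx.2).symm) P.cL
    intro x hx y hy hxy
    rw [toFun_lt f hx.2, toFun_lt f hy.2]
    exact P.mL (Ioo_subset_Icc_self hx) (Ioo_subset_Icc_self hy) hxy
  · have hC : ContDiffOn ℝ 3 f.toFun (Ioo f.c 1) := by
      have : ContDiffOn ℝ 3 (rb f) (Ioo f.c 1) := by
        have := h3.2.1
        refine ContDiffOn.comp (g := f.ψ) (t := Icc 0 1) (by exact_mod_cast this) ?_ ?_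
        · refine contDiffOn_const.add (contDiffOn_const.mul (contDiffOn_const.add ?_))
          refine ContDiffOn.rpow_const_of_ne (by fun_prop) ?_
          intro x hx
          exact (div_pos (by linarith [hx.1]) (by linarith : (0:ℝ) < 1 - f.c)).ne'
        · intro x hx
          have := q_mem (α := α) (c := 1 - f.c) (x := 1 - x) hα (by linarith) f.hv.1 f.hv.2
            ⟨by linarith [hx.2], by linarith [hx.1]⟩
          simp only [Sf, show 1 - f.c - (1 - x) = x - f.c by ring] at this
          have h2 := this.2.trans f.hv.2
          have h3 := this.1
          constructor <;> linarith
      exact this.congr (fun x hx => toFun_ge f hx.1.le)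
    have hs : ∀ x ∈ Ioo f.c 1, schwarzian f.toFun x < 0 := fun x hx =>
      hS x ⟨⟨by linarith [hx.1], hx.2.le⟩, by simpa using hx.1.ne'⟩
    have : QCR 1 (rb f) f.c 1 := by
      refine schw_qcr c1 hC (neg_schw_pos ?_ hs) hs (fun x hx => (toFun_ge f hx.1.le).symm) P.cR
      intro x hx y hy hxy
      rw [toFun_ge f hx.1.le, toFun_ge f hy.1.le]
      exact P.mR (Ioo_subset_Icc_self hx) (Ioo_subset_Icc_self hy) hxy
    simpa using this.flip
end LW

namespace LW

structure Comb (fl fr : ℝ → ℝ) (c : ℝ) (a b : ℕ) (p q : ℝ) : Prop where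
  ha : 1 ≤ a
  hb : 1 ≤ b
  p0 : 0 < p
  pc : p < c
  cq : c < q
  q1 : q < 1
  Lp : ∀ i < a, fr^[i] (fl p) ∈ Ico q 1
  Lc : ∀ i < a, fr^[i] (fl c) ∈ Ico q 1
  Lr : fr^[a] (fl p) = p
  Ld : fr^[a] (fl c) ∈ Ioc c q
  Rq : ∀ j < b, fl^[j] (fr q) ∈ Ioc 0 p
  Rc : ∀ j < b, fl^[j] (fr c) ∈ Ioc 0 p
  Rr : fl^[b] (fr q) = q
  Rd : fl^[b] (fr c) ∈ Ico p c

lemma Comb.flip {fl fr : ℝ → ℝ} {c : ℝ} {a b : ℕ} {p q : ℝ} (h : Comb fl fr c a b p q) :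
    Comb (flp fr) (flp fl) (1 - c) b a (1 - q) (1 - p) := by
  obtain ⟨h1, h2, h3, h4, h5, h6, h7, h8, h9, h10, h11, h12, h13, h14⟩ := h
  refine ⟨h2, h1, by linarith, by linarith, by linarith, by linarith, ?_, ?_, ?_, ?_, ?_, ?_, ?_, ?_⟩
  · intro i hi; have := h11 i hi
    simp only [flp_iter, flp, sub_sub_cancel, mem_Ico, mem_Ioc] at this ⊢
    constructor <;> linarith
  · intro i hi; have := h12 i hi
    simp only [flp_iter, flp, sub_sub_cancel, mem_Ico, mem_Ioc] at this ⊢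
    constructor <;> linarith
  · simp only [flp_iter, flp, sub_sub_cancel, h13]
  · simp only [flp_iter, flp, sub_sub_cancel, mem_Ico, mem_Ioc] at h14 ⊢
    constructor <;> linarith
  · intro i hi; have := h7 i hi
    simp only [flp_iter, flp, sub_sub_cancel, mem_Ico, mem_Ioc] at this ⊢
    constructor <;> linarith
  · intro i hi; have := h8 i hi
    simp only [flp_iter, flp, sub_sub_cancel, mem_Ico, mem_Ioc] at this ⊢
    constructor <;> linarith
  · simp only [flp_iter, flp, sub_sub_cancel, h9]
  · simp only [flp_iter, flp, sub_sub_cancel, mem_Ico, mem_Ioc] at h10 ⊢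
    constructor <;> linarith

def nextL (fl fr : ℝ → ℝ) (a : ℕ) (p q : ℝ) : ℝ → ℝ :=
  fun y => (fr^[a] (fl (p + y * (q - p))) - p) / (q - p)

lemma flp_next {fl fr : ℝ → ℝ} {b : ℕ} {p q : ℝ} (h : p < q) (y : ℝ) :
    flp (nextL fr fl b p q) y = nextL (flp fr) (flp fl) b (1 - q) (1 - p) y := by
  have : q - p ≠ 0 := by linarith
  simp only [flp, nextL, flp_iter, sub_sub_cancel]
  have e1 : 1 - (1 - q + y * (1 - p - (1 - q))) = p + (1 - y) * (q - p) := by ring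
  have e2 : 1 - p - (1 - q) = q - p := by ring
  rw [e1, e2]; field_simp; ring

lemma orbit_eq {fl fr T : ℝ → ℝ} {c : ℝ} {a : ℕ} {p : ℝ}
    (hTl : ∀ x ∈ Ioo 0 c, T x = fl x) (hTr : ∀ x ∈ Ioo c 1, T x = fr x)
    (hp : 0 ≤ p)
    (hret : ∀ x ∈ Ioo p c, ∀ i : ℕ, 1 ≤ i → i ≤ a → T^[i] x ∈ Ioo c 1) :
    ∀ x ∈ Ioo p c, ∀ i ≤ a, T^[i + 1] x = fr^[i] (fl x) := by
  intro x hx i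
  induction i with
  | zero => intro _; simp [hTl x ⟨by linarith [hx.1], hx.2⟩]
  | succ i ih =>
    intro hi
    rw [Function.iterate_succ_apply', Function.iterate_succ_apply' fr, ← ih (by omega)]
    exact hTr _ (hret x hx (i + 1) (by omega) hi)

lemma ret_props {fl fr : ℝ → ℝ} {c : ℝ} (P : Pair fl fr c) {a : ℕ} {p q : ℝ}
    (hp : 0 ≤ p) (hpc : p < c) (hcq : c < q) (hq : q ≤ 1)
    (h : ∀ x ∈ Ioo p c, ∀ i < a, fr^[i] (fl x) ∈ Icc q 1) :
    ∀ i ≤ a, ContinuousOn (fun x => fr^[i] (fl x)) (Icc p c) ∧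
      StrictMonoOn (fun x => fr^[i] (fl x)) (Icc p c) ∧
      (i < a → ∀ x ∈ Icc p c, fr^[i] (fl x) ∈ Icc q 1) := by
  intro i
  induction i with
  | zero =>
    intro _
    have c0 : ContinuousOn (fun x => fr^[0] (fl x)) (Icc p c) := by
      simpa using P.cL.mono (Icc_subset_Icc_left hp)
    refine ⟨c0, ?_, ?_⟩
    · simpa using P.mL.mono (Icc_subset_Icc_left hp)
    · intro ha
      have := MapsTo.closure_of_continuousOn (s := Ioo p c) (t := Icc q 1)
        (fun x hx => h x hx 0 ha) (by rw [closure_Ioo hpc.ne]; exact c0)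
      rw [closure_Ioo hpc.ne, closure_Icc] at this
      exact this
  | succ i ih =>
    intro hi
    obtain ⟨h1, h2, h3⟩ := ih (by omega)
    have h3 := h3 (by omega)
    have hm : ∀ x ∈ Icc p c, fr^[i] (fl x) ∈ Icc c 1 := fun x hx =>
      ⟨by linarith [(h3 x hx).1], (h3 x hx).2⟩
    have e : (fun x => fr^[i + 1] (fl x)) = fun x => fr (fr^[i] (fl x)) := by
      funext x; rw [Function.iterate_succ_apply']
    have c1 : ContinuousOn (fun x => fr^[i + 1] (fl x)) (Icc p c) := by
      rw [e]; exact P.cR.comp h1 hm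
    refine ⟨c1, ?_, ?_⟩
    · rw [e]; intro x hx y hy hxy; exact P.mR (hm x hx) (hm y hy) (h2 hx hy hxy)
    · intro ha
      have := MapsTo.closure_of_continuousOn (s := Ioo p c) (t := Icc q 1)
        (fun x hx => h x hx (i + 1) ha) (by rw [closure_Ioo hpc.ne]; exact c1)
      rw [closure_Ioo hpc.ne, closure_Icc] at this
      exact this

lemma half_comb {fl fr T G : ℝ → ℝ} {c c' : ℝ} (P : Pair fl fr c) {a : ℕ} (ha : 1 ≤ a) {p q : ℝ}
    (hTl : ∀ x ∈ Ioo 0 c, T x = fl x) (hTr : ∀ x ∈ Ioo c 1, T x = fr x)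
    (hp : 0 ≤ p) (hpc : p < c) (hcq : c < q) (hq : q ≤ 1)
    (hret : ∀ x ∈ Ioo p c, ∀ i : ℕ, 1 ≤ i → i ≤ a → T^[i] x ∈ Ioo c 1 ∧ T^[i] x ∉ Ioo p q)
    (hc' : c' = (c - p) / (q - p)) (cG : ContinuousOn G (Icc 0 c')) (G0 : G 0 = 0)
    (hG : ∀ x ∈ Ioo p c, G ((x - p) / (q - p)) = (T^[a + 1] x - p) / (q - p))
    (Gc : c' < G c') (G1 : G c' ≤ 1) :
    0 < p ∧ (∀ i < a, fr^[i] (fl p) ∈ Ico q 1) ∧ (∀ i < a, fr^[i] (fl c) ∈ Icc q 1) ∧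
    fr^[a] (fl p) = p ∧ fr^[a] (fl c) ∈ Ioc c q ∧ ∀ y ∈ Icc 0 c', G y = nextL fl fr a p q y := by
  have oe := orbit_eq hTl hTr hp (fun x hx i h1 h2 => (hret x hx i h1 h2).1)
  have rp := ret_props P hp hpc hcq hq (a := a) (fun x hx i hi => by
    rw [← oe x hx i hi.le]
    have := hret x hx (i + 1) (by omega) (by omega)
    refine ⟨?_, this.1.2.le⟩
    by_contra hlt
    exact this.2 ⟨by linarith [this.1.1], by linarith⟩)
  have w : 0 < q - p := by linarith
  have wn : q - p ≠ 0 := w.ne'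
  have eqG : EqOn (fun x => G ((x - p) / (q - p))) (fun x => (fr^[a] (fl x) - p) / (q - p))
      (Icc p c) := by
    refine EqOn.of_subset_closure (s := Ioo p c) ?_ ?_ ?_ Ioo_subset_Icc_self
      (by rw [closure_Ioo hpc.ne])
    · intro x hx; simp only; rw [hG x hx, oe x hx a le_rfl]
    · refine cG.comp (by fun_prop) ?_
      intro x hx
      rw [hc']
      exact ⟨div_nonneg (by linarith [hx.1]) w.le, div_le_div_of_nonneg_right (by linarith [hx.2]) w.le⟩
    · exact ((rp a le_rfl).1.sub continuousOn_const).div_const _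
  have ep := eqG (left_mem_Icc.2 hpc.le)
  have ec := eqG (right_mem_Icc.2 hpc.le)
  simp only [sub_self, zero_div, G0, ← hc'] at ep ec
  have ep' : fr^[a] (fl p) = p := by
    have := ep.symm; rw [div_eq_zero_iff] at this
    rcases this with h | h <;> linarith
  refine ⟨?_, ?_, ?_, ep', ?_, ?_⟩
  · refine lt_of_le_of_ne hp (fun h => ?_)
    have := ((rp 0 (by omega)).2.2 (by omega) p (left_mem_Icc.2 hpc.le)).1
    rw [← h] at this
    simp [P.fl0] at this
    linarith [P.c0]
  · intro i hi
    have h1 := (rp i hi.le).2.2 hi p (left_mem_Icc.2 hpc.le)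
    have h2 := (rp i hi.le).2.2 hi c (right_mem_Icc.2 hpc.le)
    have h3 := (rp i hi.le).2.1 (left_mem_Icc.2 hpc.le) (right_mem_Icc.2 hpc.le) hpc
    simp only at h3
    exact ⟨h1.1, by linarith [h2.2]⟩
  · intro i hi
    exact (rp i hi.le).2.2 hi c (right_mem_Icc.2 hpc.le)
  · rw [ec] at Gc G1
    rw [hc', div_lt_div_iff_of_pos_right w] at Gc
    rw [div_le_one w] at G1
    exact ⟨by linarith, by linarith⟩
  · intro y hy
    rw [hc'] at hy
    have hx : p + y * (q - p) ∈ Icc p c := by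
      refine ⟨by nlinarith [hy.1], ?_⟩
      have := hy.2; rw [le_div_iff₀ w] at this; linarith
    have := eqG hx
    simp only at this
    rw [show (p + y * (q - p) - p) / (q - p) = y by field_simp; ring] at this
    exact this

lemma nontriv_uv {α : ℝ} (g : LorenzMap α) (h : g.IsNontrivial) : g.u ≠ 0 ∧ g.v ≠ 0 := by
  constructor
  · intro e
    have := h.2
    simp only [LorenzMap.cv1, e, g.hφ0] at this
    linarith [g.hc.1]
  · intro e
    have := h.1
    simp only [LorenzMap.cv0, e, sub_zero, g.hψ1] at this
    linarith [g.hc.2]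

lemma return_uv {α : ℝ} (f : LorenzMap α) {a b : ℕ} {p q : ℝ} (h : ReturnCond f a b p q) :
    f.u ≠ 0 ∧ f.v ≠ 0 := by
  obtain ⟨ha, hb, hp, hpc, hcq, hq, -, hL, hR⟩ := h
  constructor
  · intro e
    have hx : (p + f.c) / 2 ∈ Ioo p f.c := ⟨by linarith, by linarith⟩
    have := ((hL _ hx).1 1 le_rfl ha).1.1
    simp only [Function.iterate_one] at this
    rw [toFun_lt f hx.2, lb, e, zero_mul, f.hφ0] at this
    linarith [f.hc.1]
  · intro e
    have hx : (q + f.c) / 2 ∈ Ioo f.c q := ⟨by linarith, by linarith⟩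
    have := ((hR _ hx).1 1 le_rfl hb).1.2
    simp only [Function.iterate_one] at this
    rw [toFun_ge f hx.1.le, rb, e, zero_mul, add_zero, f.hψ1] at this
    linarith [f.hc.2]

/-- combinatorics extracted from a renormalization, for given interval -/
lemma comb_of_interval {α : ℝ} (hα : 1 < α) (f g : LorenzMap α) {a b : ℕ} {p q : ℝ}
    (h : ReturnCond f a b p q) (hc : g.c = (f.c - p) / (q - p)) (hn : g.IsNontrivial)
    (hGL : ∀ x ∈ Ioo p f.c, g.toFun ((x - p) / (q - p)) = (f.toFun^[a + 1] x - p) / (q - p))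
    (hGR : ∀ x ∈ Ioo f.c q, g.toFun ((x - p) / (q - p)) = (f.toFun^[b + 1] x - p) / (q - p)) :
    Pair (lb f) (rb f) f.c ∧ Pair (lb g) (rb g) g.c ∧
    Comb (lb f) (rb f) f.c a b p q ∧
    (∀ y ∈ Icc 0 g.c, lb g y = nextL (lb f) (rb f) a p q y) ∧
    (∀ y ∈ Icc 0 (1 - g.c), flp (rb g) y =
      nextL (flp (rb f)) (flp (lb f)) b (1 - q) (1 - p) y) := by
  have P := pair_of_lorenz hα f (return_uv f h).1 (return_uv f h).2
  have Pg := pair_of_lorenz hα g (nontriv_uv g hn).1 (nontriv_uv g hn).2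
  obtain ⟨ha, hb, hp, hpc, hcq, hq, -, hL, hR⟩ := h
  have w : 0 < q - p := by linarith
  have wn : q - p ≠ 0 := w.ne'
  have HL := half_comb (T := f.toFun) (G := lb g) (c' := g.c) P ha
    (fun x hx => toFun_lt f hx.2) (fun x hx => toFun_ge f hx.1.le) hp hpc hcq hq
    (fun x hx => (hL x hx).1) hc Pg.cL Pg.fl0 (fun x hx => by
      rw [← hGL x hx, toFun_lt]
      rw [hc]; gcongr; exact hx.2) (by rw [lb_c hα]; exact hn.2) Pg.l1
  have P' := P.flip
  have Pg' := Pg.flip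
  have HR := half_comb (T := flp f.toFun) (G := flp (rb g)) (c' := 1 - g.c) (p := 1 - q)
    (q := 1 - p) P' hb
    (fun x hx => by simp only [flp]; rw [toFun_ge f (by linarith [hx.2])])
    (fun x hx => by simp only [flp]; rw [toFun_lt f (by linarith [hx.1])])
    (by linarith) (by linarith) (by linarith) (by linarith)
    (fun x hx i h1 h2 => by
      have := (hR (1 - x) ⟨by linarith [hx.2], by linarith [hx.1]⟩).1 i h1 h2
      rw [flp_iter]
      refine ⟨⟨by linarith [this.1.2], by linarith [this.1.1]⟩, fun hh => this.2
        ⟨by linarith [hh.2], by linarith [hh.1]⟩⟩)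
    (by rw [hc, show 1 - p - (1 - q) = q - p by ring]; field_simp; ring) Pg'.cL Pg'.fl0
    (fun x hx => by
      have h1 := hGR (1 - x) ⟨by linarith [hx.2], by linarith [hx.1]⟩
      rw [flp_iter]
      rw [toFun_ge g (by rw [hc]; gcongr; linarith [hx.2])] at h1
      have e : 1 - (x - (1 - q)) / (1 - p - (1 - q)) = (1 - x - p) / (q - p) := by
        rw [show 1 - p - (1 - q) = q - p by ring]; field_simp; ring
      simp only [flp]
      rw [e, h1, show 1 - p - (1 - q) = q - p by ring]; field_simp; ring)
    (by simp only [flp, sub_sub_cancel]; rw [rb_c hα]; linarith [hn.1]) Pg'.l1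
  obtain ⟨L1, L2, L3, L4, L5, L6⟩ := HL
  obtain ⟨R1, R2, R3, R4, R5, R6⟩ := HR
  have q1 : q < 1 := by linarith
  refine ⟨P, Pg, ⟨ha, hb, L1, hpc, hcq, q1, L2, ?_, L4, L5, ?_, ?_, ?_, ?_⟩, L6, R6⟩
  · intro i hi
    refine ⟨(L3 i hi).1, lt_of_le_of_ne (L3 i hi).2 (fun e => ?_)⟩
    have h1 : (rb f)^[a] (lb f f.c) = 1 := by
      rw [show a = (a - i) + i by omega, Function.iterate_add_apply, e,
        Function.iterate_fixed P.fr1]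
    linarith [L5.2]
  · intro i hi; have := R2 i hi
    simp only [flp_iter, flp, sub_sub_cancel, mem_Ico, mem_Ioc] at this ⊢
    constructor <;> linarith
  · intro i hi; have := R3 i hi
    simp only [flp_iter, flp, sub_sub_cancel, mem_Icc, mem_Ioc] at this ⊢
    refine ⟨lt_of_le_of_ne (by linarith) (fun e => ?_), by linarith⟩
    have h1 : (lb f)^[b] (rb f f.c) = 0 := by
      rw [show b = (b - i) + i by omega, Function.iterate_add_apply, ← e,
        Function.iterate_fixed P.fl0]
    simp only [flp_iter, flp, sub_sub_cancel, mem_Ioc] at R5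
    linarith [R5.2]
  · simp only [flp_iter, flp, sub_sub_cancel] at R4; linarith
  · simp only [flp_iter, flp, sub_sub_cancel, mem_Ioc] at R5 ⊢
    constructor <;> linarith

lemma domR {fl fr : ℝ → ℝ} {c : ℝ} (P : Pair fl fr c) (hq : QCR 1 fr c 1) (hrc : fr c < c) :
    ∀ n, ∃ e ∈ Ico c 1, fr^[n + 1] e = fr c ∧ StrictMonoOn fr^[n + 1] (Icc e 1) ∧
      ContinuousOn fr^[n + 1] (Icc e 1) ∧ QCR 1 fr^[n + 1] e 1 ∧
      ∀ x ∈ Icc c 1, (∀ i < n + 1, fr^[i] x ∈ Icc c 1) → e ≤ x := by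
  intro n
  induction n with
  | zero =>
    refine ⟨c, ⟨le_rfl, P.c1⟩, ?_⟩
    simp only [zero_add, Function.iterate_one]
    exact ⟨trivial, P.mR, P.cR, hq, fun x hx _ => hx.1⟩
  | succ n ih =>
    obtain ⟨e, he, h1, h2, h3, h4, h5⟩ := ih
    obtain ⟨e', he', ee⟩ := intermediate_value_Icc P.c1.le P.cR
      (show e ∈ Icc (fr c) (fr 1) from ⟨by linarith [he.1], by rw [P.fr1]; exact he.2.le⟩)
    have hl : e' < 1 := lt_of_le_of_ne he'.2 (fun h => by
      rw [h, P.fr1] at ee; linarith [he.2])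
    have mm : StrictMonoOn fr (Icc e' 1) := P.mR.mono (Icc_subset_Icc_left he'.1)
    have mp : MapsTo fr (Icc e' 1) (Icc e 1) := by
      intro x hx
      constructor
      · rw [← ee]; exact mm.monotoneOn (left_mem_Icc.2 hl.le) hx hx.1
      · rw [← P.fr1]; exact mm.monotoneOn hx (right_mem_Icc.2 hl.le) hx.2
    refine ⟨e', ⟨he'.1, hl⟩, ?_, ?_, ?_, ?_, ?_⟩
    · rw [Function.iterate_succ_apply, ee, h1]
    · rw [Function.iterate_succ]; exact h2.comp mm mp
    · rw [Function.iterate_succ]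
      exact h3.comp (P.cR.mono (Icc_subset_Icc_left he'.1)) mp
    · rw [Function.iterate_succ]
      exact (hq.mono he'.1 le_rfl).comp h4 mm h2 mp
    · intro x hx hi
      have h6 := h5 (fr x) (by simpa using hi 1 (by omega)) (fun i hi' => by
        have := hi (i + 1) (by omega)
        rwa [Function.iterate_succ_apply] at this)
      by_contra hlt
      have := P.mR hx he' (not_le.1 hlt)
      linarith

lemma Half.congr {α K κ c : ℝ} {F G : ℝ → ℝ} (h : Half α K κ F c)
    (e : ∀ x ∈ Icc 0 c, G x = F x) : Half α K κ G c := by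
  obtain ⟨u, φ, h1, h2, h3, h4, h5⟩ := h
  exact ⟨u, φ, h1, h2, h3, fun x hx => by rw [e x hx, h4 x hx], h5.congr e⟩

lemma Half.next {α K κ c : ℝ} {fl fr : ℝ → ℝ} (hα : 1 < α) (hK : 1 ≤ K) (P : Pair fl fr c)
    (hl : Half α K κ fl c) (hqr : QCR 1 fr c 1) {a b : ℕ} {p q : ℝ} (C : Comb fl fr c a b p q)
    {η : ℝ} (hη : 0 ≤ η) (s1 : q - p ≤ η * (p - fr c)) (s2 : q - p ≤ η * (1 - q)) :
    Half α K (K * (1 + η)) (nextL fl fr a p q) ((c - p) / (q - p)) := by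
  obtain ⟨u, φ, hu, hu1, hD, hF, hQ⟩ := hl
  have c0 := P.c0
  have pc := C.pc
  have cq := C.cq
  have q1 := C.q1
  have p0 := C.p0
  have w : 0 < q - p := by linarith
  have hb := branch_basic hα P.c0 hu hu1 hD.z hD.o hD.m hD.cn hF
  have hrp : fr c < p := by nlinarith
  have ha := C.ha
  obtain ⟨e, he, d1, d2, d3, d4, d5⟩ := domR P hqr (by linarith) (a - 1)
  rw [show a - 1 + 1 = a by omega] at d1 d2 d3 d4 d5
  have mp : p ∈ Icc 0 c := ⟨by linarith, pc.le⟩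
  have mc : c ∈ Icc 0 c := ⟨by linarith, le_rfl⟩
  have lp := d5 (fl p) ⟨by linarith [(C.Lp 0 ha).1, show fr^[0] (fl p) = fl p from rfl],
    (C.Lp 0 ha).2.le⟩ (fun i hi => ⟨by linarith [(C.Lp i hi).1], (C.Lp i hi).2.le⟩)
  have lc := d5 (fl c) ⟨by linarith [(C.Lc 0 ha).1, show fr^[0] (fl c) = fl c from rfl],
    (C.Lc 0 ha).2.le⟩ (fun i hi => ⟨by linarith [(C.Lc i hi).1], (C.Lc i hi).2.le⟩)
  obtain ⟨e0, he0, ee⟩ := intermediate_value_Icc zero_le_one hD.cn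
    (show e ∈ Icc (φ 0) (φ 1) from ⟨by rw [hD.z]; linarith [he.1], by rw [hD.o]; exact he.2.le⟩)
  have e01 : e0 < 1 := lt_of_le_of_ne he0.2 (fun h => by rw [h, hD.o] at ee; linarith [he.2])
  have mφ : StrictMonoOn φ (Icc e0 1) := hD.m.mono (Icc_subset_Icc_left he0.1)
  have mapφ : MapsTo φ (Icc e0 1) (Icc e 1) := by
    intro x hx
    constructor
    · rw [← ee]; exact mφ.monotoneOn (left_mem_Icc.2 e01.le) hx hx.1
    · rw [← hD.o]; exact mφ.monotoneOn hx (right_mem_Icc.2 e01.le) hx.2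
  set W : ℝ → ℝ := fun t => fr^[a] (φ t) with hW
  have mW : StrictMonoOn W (Icc e0 1) := d2.comp mφ mapφ
  have cW : ContinuousOn W (Icc e0 1) :=
    d3.comp (hD.cn.mono (Icc_subset_Icc_left he0.1)) mapφ
  have qW : QCR K W e0 1 := (hD.q.mono he0.1 le_rfl).comp d4 mφ d2 mapφ
  set i0 := u * (1 - Sf α c p) with hi0
  have i0m := q_mem hα c0 hu.le hu1 mp
  rw [← hi0] at i0m
  have φi0 : φ i0 = fl p := (hF p mp).symm
  have φu : φ u = fl c := hb.2.2.2.2.symm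
  have W0 : W e0 = fr c := by simp only [hW, ee, d1]
  have W1 : W 1 = 1 := by simp only [hW, hD.o]; exact Function.iterate_fixed P.fr1 a
  have Wi0 : W i0 = p := by simp only [hW, φi0, C.Lr]
  have e0i0 : e0 < i0 := by
    by_contra hlt
    have h1 := hD.m.monotoneOn (a := i0) ⟨i0m.1, by linarith [i0m.2]⟩ he0 (not_lt.1 hlt)
    rw [φi0, ee] at h1
    have : fl p = e := le_antisymm h1 lp
    have h2 := C.Lr
    rw [this, d1] at h2
    linarith
  have i01 : i0 ≤ 1 := by linarith [i0m.2]
  obtain ⟨i1, hi1, ei1⟩ := intermediate_value_Icc i01 (cW.mono (Icc_subset_Icc_left e0i0.le))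
    (show q ∈ Icc (W i0) (W 1) from ⟨by rw [Wi0]; linarith, by rw [W1]; linarith⟩)
  have i0i1 : i0 < i1 := lt_of_le_of_ne hi1.1 (fun h => by rw [← h, Wi0] at ei1; linarith)
  have i11 : i1 < 1 := lt_of_le_of_ne hi1.2 (fun h => by rw [h, W1] at ei1; linarith)
  obtain ⟨v0, v1, v2, v3, v4, v5⟩ := koebe hK hη mW cW qW e0i0 i0i1 i11
    (by rw [ei1, Wi0, W0]; exact s1) (by rw [ei1, Wi0, W1]; exact s2)
  have Wu : W u = fr^[a] (fl c) := by simp only [hW, φu]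
  have hSp : 0 < Sf α c p := Real.rpow_pos_of_pos (div_pos (by linarith) c0) _
  have i0u : i0 < u := by rw [hi0]; nlinarith
  have ui1 : u ≤ i1 := by
    by_contra hlt
    have := mW (a := i1) ⟨by linarith, i11.le⟩ (b := u) ⟨by linarith, hu1⟩ (not_le.1 hlt)
    rw [ei1, Wu] at this
    linarith [C.Ld.2]
  have di : 0 < i1 - i0 := by linarith
  refine ⟨(u - i0) / (i1 - i0), _, div_pos (by linarith) di,
    (div_le_one di).2 (by linarith), ⟨v0, v1, v2, v3, v4, v5⟩, ?_, ?_⟩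
  · intro y hy
    have hy2 : y * (q - p) ≤ c - p := by have := hy.2; rwa [le_div_iff₀ w] at this
    have hy1 : 0 ≤ y * (q - p) := mul_nonneg hy.1 w.le
    have hx : p + y * (q - p) ∈ Icc 0 c := ⟨by linarith, by linarith⟩
    have hS : Sf α c (p + y * (q - p)) = Sf α c p * Sf α ((c - p) / (q - p)) y := by
      unfold Sf
      have cp : c - p ≠ 0 := by linarith
      rw [← Real.mul_rpow (div_nonneg (by linarith) c0.le)]
      · congr 1
        field_simp; ring
      · exact div_nonneg (by linarith [hy.2]) (div_nonneg (by linarith) w.le)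
    simp only [nextL]
    rw [hF _ hx, ei1, Wi0]
    have : i0 + (u - i0) / (i1 - i0) * (1 - Sf α ((c - p) / (q - p)) y) * (i1 - i0) =
        u * (1 - Sf α c (p + y * (q - p))) := by
      rw [hS, hi0] at *
      field_simp; ring
    rw [this]
  · have m1 : StrictMonoOn fl (Icc p c) := P.mL.mono (Icc_subset_Icc_left p0.le)
    have m2 : MapsTo fl (Icc p c) (Icc e 1) := fun x hx =>
      ⟨lp.trans (m1.monotoneOn (left_mem_Icc.2 pc.le) hx hx.1),
       (m1.monotoneOn hx (right_mem_Icc.2 pc.le) hx.2).trans P.l1⟩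
    have := (hQ.mono p0.le le_rfl).comp d4 m1 d2 m2
    refine QCR.affine this w (by linarith) ?_
    rw [div_mul_cancel₀ _ w.ne']; linarith
end LW

namespace LW

def Tf (α c x : ℝ) : ℝ := ((x - c) / (1 - c)) ^ α

structure Est (α k : ℝ) (fl fr : ℝ → ℝ) (c : ℝ) : Prop where
  L : ∀ x y, 0 ≤ x → x ≤ y → y ≤ c → fl y - fl x ≤ k * fl c * (Sf α c x - Sf α c y) ∧
    fl c * (Sf α c x - Sf α c y) ≤ k * (fl y - fl x)
  R : ∀ x y, c ≤ x → x ≤ y → y ≤ 1 → fr y - fr x ≤ k * (1 - fr c) * (Tf α c y - Tf α c x) ∧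
    (1 - fr c) * (Tf α c y - Tf α c x) ≤ k * (fr y - fr x)

lemma est_of_half {α K κ c : ℝ} {fl fr : ℝ → ℝ} (hα : 1 < α) (hκ : 1 ≤ κ) (hc : 0 < c) (hc1 : c < 1)
    (hl : Half α K κ fl c) (hr : Half α K κ (flp fr) (1 - c)) : Est α (κ ^ 2) fl fr c where
  L := fun x y h1 h2 h3 => hl.ineq hα hκ hc h1 h2 h3
  R := fun x y h1 h2 h3 => by
    have := hr.ineq hα hκ (by linarith) (x := 1 - y) (y := 1 - x) (by linarith) (by linarith)
      (by linarith)
    simp only [flp, Sf, sub_sub_cancel] at this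
    simp only [Tf]
    rw [show 1 - c - (1 - y) = y - c by ring, show 1 - c - (1 - x) = x - c by ring] at this
    constructor <;> linarith [this.1, this.2]

lemma tangent {α s t : ℝ} (hα : 1 < α) (hs : 0 ≤ s) (ht : 0 ≤ t) :
    t ^ α + α * t ^ (α - 1) * (s - t) ≤ s ^ α := by
  rcases ht.lt_or_eq with h | h
  · have h1 := one_add_mul_self_le_rpow_one_add (s := (s - t) / t) (p := α)
      (by rw [le_div_iff₀ h]; linarith) hα.le
    have e : t * (1 + (s - t) / t) = s := by field_simp; ring
    have e2 : t ^ α = t ^ (α - 1) * t := by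
      rw [← Real.rpow_add_one h.ne']; congr 1; ring
    calc t ^ α + α * t ^ (α - 1) * (s - t) = t ^ α * (1 + α * ((s - t) / t)) := by
          rw [e2]; field_simp
      _ ≤ t ^ α * (1 + (s - t) / t) ^ α := by gcongr
      _ = s ^ α := by
          rw [← Real.mul_rpow ht (by rw [← e] at hs; exact nonneg_of_mul_nonneg_right hs h), e]
  · subst h
    rw [Real.zero_rpow (by linarith), Real.zero_rpow (by linarith)]
    simp; positivity

lemma chain_le {D : ℕ → ℝ} {M : ℝ} (hM : 0 ≤ M) {a : ℕ} (h : ∀ i < a, D (i + 1) ≤ M * D i) :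
    D a ≤ M ^ a * D 0 := by
  induction a with
  | zero => simp
  | succ a ih =>
    calc D (a + 1) ≤ M * D a := h a (by omega)
      _ ≤ M * (M ^ a * D 0) := mul_le_mul_of_nonneg_left (ih (fun i hi => h i (by omega))) hM
      _ = _ := by ring

structure Lev (α k : ℝ) (fl fr : ℝ → ℝ) (c : ℝ) (a b : ℕ) (p q : ℝ) : Prop where
  hα : 1 < α
  k1 : 1 ≤ k
  k2 : k ≤ 2
  P : Pair fl fr c
  E : Est α k fl fr c
  C : Comb fl fr c a b p q
  eps : 1 - c ≤ 1 / 16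
  aeps : 8 * α * (1 - c) ≤ 1
  a2 : (a : ℝ) + 1 ≤ 2 * α

variable {α k c p q : ℝ} {fl fr : ℝ → ℝ} {a b : ℕ}

def C1 (α : ℝ) : ℝ := (2 * α) ^ (2 * α) * 2 * 2 ^ α

lemma C1_pos (hα : 1 < α) : 0 < C1 α := by unfold C1; positivity

lemma Lev.flp_lt (h : Lev α k fl fr c a b p q) : fl p < fl c :=
  h.P.mL ⟨h.C.p0.le, h.C.pc.le⟩ ⟨h.P.c0.le, le_rfl⟩ h.C.pc

lemma Lev.iter_lt (h : Lev α k fl fr c a b p q) : ∀ i ≤ a, fr^[i] (fl p) < fr^[i] (fl c) := by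
  intro i
  induction i with
  | zero => intro _; exact h.flp_lt
  | succ i ih =>
    intro hi
    have h1 := h.C.Lp i (by omega)
    have h2 := h.C.Lc i (by omega)
    rw [Function.iterate_succ_apply', Function.iterate_succ_apply']
    exact h.P.mR ⟨by linarith [h1.1, h.C.cq], h1.2.le⟩ ⟨by linarith [h2.1, h.C.cq], h2.2.le⟩
      (ih (by omega))

lemma Lev.iter_lt' (h : Lev α k fl fr c a b p q) : ∀ i ≤ b, fl^[i] (fr c) < fl^[i] (fr q) := by
  intro i
  induction i with
  | zero =>
    intro _
    exact h.P.mR ⟨le_rfl, h.P.c1.le⟩ ⟨h.C.cq.le, h.C.q1.le⟩ h.C.cq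
  | succ i ih =>
    intro hi
    have h1 := h.C.Rq i (by omega)
    have h2 := h.C.Rc i (by omega)
    rw [Function.iterate_succ_apply', Function.iterate_succ_apply']
    exact h.P.mL ⟨h2.1.le, by linarith [h2.2, h.C.pc]⟩ ⟨h1.1.le, by linarith [h1.2, h.C.pc]⟩
      (ih (by omega))

lemma Lev.r1 (h : Lev α k fl fr c a b p q) : fr c < c := by
  have := (h.C.Rc 0 h.C.hb).2
  simp at this
  linarith [h.C.pc]

lemma Lev.lq (h : Lev α k fl fr c a b p q) : q ≤ fl c := (h.C.Lc 0 h.C.ha).1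

lemma Lev.E1 (h : Lev α k fl fr c a b p q) : (1 - c) ^ a ≤ C1 α * (c - p) ^ (α - 1) := by
  have hα := h.hα
  have k1 := h.k1
  have k2 := h.k2
  have c0 := h.P.c0
  have e0 : 0 < 1 - c := by linarith [h.P.c1]
  have pc := h.C.pc
  have cq := h.C.cq
  have hfc : 0 ≤ fr c := h.P.r0
  have hrc := h.r1
  have ep := h.eps
  have chain := chain_le (D := fun i => fr^[i] (fl c) - fr^[i] (fl p)) (M := 2 * α / (1 - c))
    (by positivity) (a := a) (fun i hi => by
      have h1 := h.C.Lp i hi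
      have h2 := h.C.Lc i hi
      have h3 := h.iter_lt i hi.le
      simp only [Function.iterate_succ_apply']
      set x := fr^[i] (fl p)
      set y := fr^[i] (fl c)
      have hR := (h.E.R x y (by linarith [h1.1]) h3.le h2.2.le).1
      have ht := tangent (s := (x - c) / (1 - c)) (t := (y - c) / (1 - c)) hα
        (div_nonneg (by linarith [h1.1]) e0.le) (div_nonneg (by linarith [h2.1]) e0.le)
      have ht1 : ((y - c) / (1 - c)) ^ (α - 1) ≤ 1 :=
        Real.rpow_le_one (div_nonneg (by linarith [h2.1]) e0.le)
          ((div_le_one e0).2 (by linarith [h2.2])) (by linarith)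
      have hd : (y - c) / (1 - c) - (x - c) / (1 - c) = (y - x) / (1 - c) := by
        rw [← sub_div]; congr 1; ring
      have hd0 : 0 ≤ (y - x) / (1 - c) := div_nonneg (by linarith) e0.le
      have hT : Tf α c y - Tf α c x ≤ α * ((y - x) / (1 - c)) := by
        unfold Tf
        have : α * ((y - c) / (1 - c)) ^ (α - 1) * ((y - x) / (1 - c)) ≤
            α * 1 * ((y - x) / (1 - c)) := by gcongr
        have e : (x - c) / (1 - c) - (y - c) / (1 - c) = -((y - x) / (1 - c)) := by linarith
        rw [e] at ht
        linarith
      have hT0 : 0 ≤ α * ((y - x) / (1 - c)) := by positivity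
      calc fr y - fr x ≤ k * (1 - fr c) * (Tf α c y - Tf α c x) := hR
        _ ≤ k * (1 - fr c) * (α * ((y - x) / (1 - c))) := by
            apply mul_le_mul_of_nonneg_left hT
            exact mul_nonneg (by linarith) (by linarith)
        _ ≤ 2 * 1 * (α * ((y - x) / (1 - c))) := by
            apply mul_le_mul_of_nonneg_right _ hT0
            nlinarith
        _ = _ := by ring)
  simp only [Function.iterate_zero, id, h.C.Lr] at chain
  have hl : c - p ≤ fr^[a] (fl c) - p := by linarith [h.C.Ld.1]
  have hL := (h.E.L p c h.C.p0.le pc.le le_rfl).1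
  rw [Sf_c hα, sub_zero] at hL
  have hl0 : 0 < c - p := by linarith
  have hS : Sf α c p ≤ 2 ^ α * (c - p) ^ α := by
    unfold Sf
    rw [← Real.mul_rpow (by norm_num) hl0.le]
    apply Real.rpow_le_rpow (div_nonneg hl0.le c0.le) _ (by linarith)
    rw [div_le_iff₀ c0]
    nlinarith
  have hS0 : 0 ≤ Sf α c p := Sf_nonneg c0 pc.le
  have hL2 : fl c - fl p ≤ 2 * (2 ^ α * (c - p) ^ α) := by
    have hfl : fl c ≤ 1 := h.P.l1
    have hfl0 : 0 ≤ fl c := by linarith [h.lq]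
    calc _ ≤ k * fl c * Sf α c p := hL
      _ ≤ 2 * 1 * Sf α c p := by gcongr
      _ = 2 * Sf α c p := by ring
      _ ≤ _ := by gcongr
  have hpow : (2 * α) ^ a ≤ (2 * α) ^ (2 * α) := by
    rw [← Real.rpow_natCast]
    exact Real.rpow_le_rpow_of_exponent_le (by linarith) (by linarith [h.a2])
  have fin : c - p ≤ (2 * α / (1 - c)) ^ a * (2 * (2 ^ α * (c - p) ^ α)) :=
    hl.trans (chain.trans (mul_le_mul_of_nonneg_left hL2 (by positivity)))
  have e2 : (c - p) ^ α = (c - p) ^ (α - 1) * (c - p) := by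
    rw [← Real.rpow_add_one hl0.ne']; congr 1; ring
  rw [div_pow, e2] at fin
  have ea : 0 < (1 - c) ^ a := by positivity
  have : (1 - c) ^ a * (c - p) ≤ (2 * α) ^ a * (2 * (2 ^ α * ((c - p) ^ (α - 1) * (c - p)))) := by
    calc (1 - c) ^ a * (c - p) ≤ (1 - c) ^ a *
        ((2 * α) ^ a / (1 - c) ^ a * (2 * (2 ^ α * ((c - p) ^ (α - 1) * (c - p))))) :=
          mul_le_mul_of_nonneg_left fin ea.le
      _ = _ := by field_simp
  have h4 : (1 - c) ^ a ≤ (2 * α) ^ a * (2 * (2 ^ α * (c - p) ^ (α - 1))) := by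
    refine le_of_mul_le_mul_right (le_trans this (le_of_eq ?_)) hl0
    ring
  refine h4.trans ?_
  unfold C1
  have h5 : 0 ≤ (c - p) ^ (α - 1) := by positivity
  calc _ ≤ (2 * α) ^ (2 * α) * (2 * (2 ^ α * (c - p) ^ (α - 1))) := by gcongr
    _ = _ := by ring

/-- distance to `c` in units of `c` contracts -/
lemma Lev.ystep (h : Lev α k fl fr c a b p q) {x : ℝ} (hx0 : 0 ≤ x) (hxc : x ≤ c) :
    1 - fl x / c ≤ k * (1 - x / c) ^ α := by
  have c0 := h.P.c0
  have hL := (h.E.L x c hx0 hxc le_rfl).1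
  rw [Sf_c h.hα, sub_zero] at hL
  have hfx : 0 ≤ fl x := by
    rw [← h.P.fl0]; exact h.P.mL.monotoneOn ⟨le_rfl, c0.le⟩ ⟨hx0, hxc⟩ hx0
  have e : Sf α c x = (1 - x / c) ^ α := by
    unfold Sf; congr 1; field_simp
  rw [← e]
  have hlc : c ≤ fl c := by linarith [h.lq, h.C.cq]
  by_cases hk : k * Sf α c x ≤ 1
  · have : c * (1 - k * Sf α c x) ≤ fl x := by nlinarith
    have h2 : 1 - k * Sf α c x ≤ fl x / c := by rw [le_div_iff₀ c0]; linarith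
    linarith
  · have : 0 ≤ fl x / c := div_nonneg hfx c0.le
    linarith

def xz (α : ℝ) : ℝ := 2 ^ (-α - 2)

lemma xz_pos (α : ℝ) : 0 < xz α := by unfold xz; positivity

lemma xz_le (hα : 1 < α) : xz α ≤ 1 / 8 := by
  unfold xz
  calc (2:ℝ) ^ (-α - 2) ≤ 2 ^ (-3 : ℝ) :=
        Real.rpow_le_rpow_of_exponent_le (by norm_num) (by linarith)
    _ = 1 / 8 := by
        rw [show (-3 : ℝ) = ((-3 : ℤ) : ℝ) by norm_num, Real.rpow_intCast]; norm_num

lemma Lev.lemA (h : Lev α k fl fr c a b p q) (hk : k * (1 - xz α) ^ ((α - 1) / 2) ≤ 1)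
    (hA : (1 - xz α) ^ (((1 + α) / 2) ^ (b - 1)) < c - p) {x : ℝ}
    (hx : ∀ j < b, fl^[j] x ∈ Icc 0 p) : x < xz α * c := by
  have hα := h.hα
  have c0 := h.P.c0
  have z0 := xz_pos α
  have z1 := xz_le hα
  have g1 : 1 < (1 + α) / 2 := by linarith
  have hb := h.C.hb
  by_contra hlt
  push Not at hlt
  have key : ∀ j < b, 1 - fl^[j] x / c ≤ (1 - xz α) ^ (((1 + α) / 2) ^ j) := by
    intro j
    induction j with
    | zero =>
      intro _
      simp only [Function.iterate_zero, id, pow_zero, Real.rpow_one]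
      have : xz α ≤ x / c := by rwa [le_div_iff₀ c0]
      linarith
    | succ j ih =>
      intro hj
      have hm := hx j (by omega)
      have hxc : fl^[j] x ≤ c := by linarith [hm.2, h.C.pc]
      have h1 := h.ystep hm.1 hxc
      rw [← Function.iterate_succ_apply' fl] at h1
      have y0 : 0 ≤ 1 - fl^[j] x / c := by
        rw [sub_nonneg, div_le_one c0]; exact hxc
      have h2 := Real.rpow_le_rpow y0 (ih (by omega)) (by linarith : 0 ≤ α)
      rw [← Real.rpow_mul (by linarith)] at h2
      set G := ((1 + α) / 2) ^ j with hG
      have hG1 : 1 ≤ G := one_le_pow₀ g1.le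
      have e : G * α = ((1 + α) / 2) ^ (j + 1) + G * ((α - 1) / 2) := by
        rw [pow_succ, ← hG]; ring
      rw [e, Real.rpow_add (by linarith)] at h2
      have h3 : (1 - xz α) ^ (G * ((α - 1) / 2)) ≤ (1 - xz α) ^ ((α - 1) / 2) :=
        Real.rpow_le_rpow_of_exponent_ge (by linarith) (by linarith) (by nlinarith)
      have h4 : 0 ≤ (1 - xz α) ^ (((1 + α) / 2) ^ (j + 1)) :=
        Real.rpow_nonneg (by linarith) _
      have k1 := h.k1
      calc _ ≤ k * (1 - fl^[j] x / c) ^ α := h1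
        _ ≤ k * ((1 - xz α) ^ (((1 + α) / 2) ^ (j + 1)) * (1 - xz α) ^ (G * ((α - 1) / 2))) := by
            gcongr
        _ ≤ k * ((1 - xz α) ^ (((1 + α) / 2) ^ (j + 1)) * (1 - xz α) ^ ((α - 1) / 2)) := by
            gcongr
        _ = (1 - xz α) ^ (((1 + α) / 2) ^ (j + 1)) * (k * (1 - xz α) ^ ((α - 1) / 2)) := by ring
        _ ≤ _ := mul_le_of_le_one_right h4 hk
  have h5 := key (b - 1) (by omega)
  have h6 := (hx (b - 1) (by omega)).2
  have h7 : fl^[b - 1] x / c ≤ p / c := by gcongr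
  have h8 : c - p ≤ 1 - p / c := by
    have : 1 - p / c = (c - p) / c := by field_simp
    rw [this, le_div_iff₀ c0]
    nlinarith [h.P.c1, h.C.pc]
  linarith

lemma Lev.cv0_small (h : Lev α k fl fr c a b p q) (hk : k * (1 - xz α) ^ ((α - 1) / 2) ≤ 1)
    (hA : (1 - xz α) ^ (((1 + α) / 2) ^ (b - 1)) < c - p) :
    fr c ≤ c / 8 ∧ q - c ≤ (1 - c) / 2 := by
  have hα := h.hα
  have c0 := h.P.c0
  have z1 := xz_le hα
  have z0 := xz_pos α
  have pc := h.C.pc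
  have e0 : 0 < 1 - c := by linarith [h.P.c1]
  have h1 := h.lemA hk hA (x := fr c) (fun j hj => ⟨(h.C.Rc j hj).1.le, (h.C.Rc j hj).2⟩)
  have h2 := h.lemA hk hA (x := fr q) (fun j hj => ⟨(h.C.Rq j hj).1.le, (h.C.Rq j hj).2⟩)
  have h3 : fr c ≤ c / 8 := by nlinarith
  refine ⟨h3, ?_⟩
  by_contra hlt
  push Not at hlt
  have hR := (h.E.R c q le_rfl h.C.cq.le h.C.q1.le).2
  have t0 : Tf α c c = 0 := by simp [Tf, Real.zero_rpow (by linarith : α ≠ 0)]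
  rw [t0, sub_zero] at hR
  have hT : 2 ^ (-α) ≤ Tf α c q := by
    unfold Tf
    rw [Real.rpow_neg (by norm_num), ← Real.inv_rpow (by norm_num)]
    apply Real.rpow_le_rpow (by norm_num) _ (by linarith)
    rw [le_div_iff₀ e0]; linarith
  have hx : xz α = 2 ^ (-α) / 4 := by
    unfold xz
    rw [Real.rpow_sub (by norm_num)]; norm_num
  have hp2 : (0:ℝ) < 2 ^ (-α) := by positivity
  have hfc : 0 ≤ fr c := h.P.r0
  have hc1 := h.P.c1
  have hfq : 0 ≤ fr q - fr c := by
    have := h.P.mR ⟨le_rfl, h.P.c1.le⟩ ⟨h.C.cq.le, h.C.q1.le⟩ h.C.cq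
    linarith
  have k2 := h.k2
  nlinarith
end LW

namespace LW
variable {α k c p q : ℝ} {fl fr : ℝ → ℝ} {a b : ℕ}

lemma Tf_c (hα : 1 < α) (c : ℝ) : Tf α c c = 0 := by
  simp [Tf, Real.zero_rpow (by linarith : α ≠ 0)]

lemma Lev.e0 (h : Lev α k fl fr c a b p q) : 0 < 1 - c := by linarith [h.P.c1]

lemma Lev.E4 (h : Lev α k fl fr c a b p q) (h8 : fr c ≤ c / 8) {z : ℝ} (hz : c ≤ z) (hz1 : z ≤ 1) :
    1 - z ≤ 4 * (1 - c) * (1 - fr z) := by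
  have e0 := h.e0
  have hR := (h.E.R z 1 hz hz1 le_rfl).2
  rw [h.P.fr1] at hR
  have h1 : Tf α c 1 = 1 := by simp [Tf, div_self e0.ne']
  have t0 : 0 ≤ (z - c) / (1 - c) := div_nonneg (by linarith) e0.le
  have t1 : (z - c) / (1 - c) ≤ 1 := (div_le_one e0).2 (by linarith)
  have h2 : Tf α c z ≤ (z - c) / (1 - c) := by
    have := Real.rpow_le_rpow_of_exponent_ge' t0 t1 zero_le_one h.hα.le
    rwa [Real.rpow_one] at this
  have e : 1 - (z - c) / (1 - c) = (1 - z) / (1 - c) := by field_simp; ring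
  have hfz : fr z ≤ 1 := by
    rw [← h.P.fr1]; exact h.P.mR.monotoneOn ⟨hz, hz1⟩ ⟨h.P.c1.le, le_rfl⟩ hz1
  have hc1 := h.P.c1
  have k2 := h.k2
  have k1 := h.k1
  have q1 : (7/8) * ((1 - z) / (1 - c)) ≤ 2 * (1 - fr z) := by
    rw [← e]
    calc _ ≤ (1 - fr c) * (Tf α c 1 - Tf α c z) := by
          rw [h1]; apply mul_le_mul <;> linarith
      _ ≤ k * (1 - fr z) := hR
      _ ≤ _ := by gcongr
  have q2 : (1 - z) / (1 - c) ≤ 4 * (1 - fr z) := by linarith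
  rw [div_le_iff₀ e0] at q2
  linarith

lemma Lev.frflc (h : Lev α k fl fr c a b p q) : c ≤ fr (fl c) := by
  have ha := h.C.ha
  rcases Nat.lt_or_ge 1 a with h1 | h1
  · have := (h.C.Lc 1 h1).1
    simp at this
    linarith [h.C.cq]
  · have : a = 1 := by omega
    have h2 := h.C.Ld
    rw [this] at h2
    exact h2.1.le

lemma Lev.fl_le (h : Lev α k fl fr c a b p q) : fl c ≤ 1 := h.P.l1

lemma Lev.flc (h : Lev α k fl fr c a b p q) (h8 : fr c ≤ c / 8) : 1 - fl c ≤ 4 * (1 - c) ^ 2 := by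
  have h1 := h.E4 h8 (z := fl c) (by linarith [h.lq, h.C.cq]) h.fl_le
  have := h.frflc
  have e0 := h.e0
  nlinarith

lemma Lev.flq (h : Lev α k fl fr c a b p q) (h8 : fr c ≤ c / 8) (hr : q - c ≤ (1 - c) / 2) :
    (1 - c) / 4 ≤ fl c - q := by
  have h1 := h.flc h8
  have := h.eps
  have e0 := h.e0
  nlinarith

lemma Lev.slope (h : Lev α k fl fr c a b p q) (h8 : fr c ≤ c / 8) {x y : ℝ} (hx : c ≤ x)
    (hxy : x ≤ y) (hy : y ≤ 1) (hfy : c ≤ fr y) : y - x ≤ 8 * (1 - c) * (fr y - fr x) := by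
  have e0 := h.e0
  have hα := h.hα
  have hR := (h.E.R x y hx hxy hy).2
  have h4 := h.E4 h8 (z := y) (by linarith) hy
  have ht0 : 0 ≤ (x - c) / (1 - c) := div_nonneg (by linarith) e0.le
  have htt : (x - c) / (1 - c) ≤ (y - c) / (1 - c) := by gcongr
  have ht1 : (y - c) / (1 - c) ≤ 1 := (div_le_one e0).2 (by linarith)
  have hT : (1 / 2) * ((y - x) / (1 - c)) ≤ Tf α c y - Tf α c x := by
    have hd : (y - x) / (1 - c) = (y - c) / (1 - c) - (x - c) / (1 - c) := by
      rw [← sub_div]; congr 1; ring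
    rw [hd]
    unfold Tf
    have h5 : 1 - (y - c) / (1 - c) ≤ 4 * (1 - c) := by
      have e : 1 - (y - c) / (1 - c) = (1 - y) / (1 - c) := by field_simp; ring
      rw [e, div_le_iff₀ e0]
      nlinarith
    set t := (x - c) / (1 - c)
    set t' := (y - c) / (1 - c)
    have h6 := tangent (s := t') (t := 1) hα (by linarith) zero_le_one
    simp only [Real.one_rpow, mul_one] at h6
    have h7 : 1 / 2 ≤ t' ^ α := by nlinarith [h.aeps]
    have tp : 0 < t' := by
      rcases (ht0.trans htt).lt_or_eq with h | h
      · exact h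
      · rw [← h, Real.zero_rpow (by linarith)] at h7; norm_num at h7
    have e1 : t' ^ α = t' ^ (α - 1) * t' := by
      rw [← Real.rpow_add_one tp.ne']; congr 1; ring
    have e2 : t ^ α ≤ t' ^ (α - 1) * t := by
      rcases ht0.lt_or_eq with h | h
      · have : t ^ α = t ^ (α - 1) * t := by
          rw [← Real.rpow_add_one h.ne']; congr 1; ring
        rw [this]
        gcongr

      · rw [← h, Real.zero_rpow (by linarith)]; simp
    have h8 : 1 / 2 ≤ t' ^ (α - 1) := by
      have : 0 ≤ t' ^ (α - 1) := by positivity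
      nlinarith
    nlinarith
  have h0 : 0 ≤ (y - x) / (1 - c) := div_nonneg (by linarith) e0.le
  have hfm : fr x ≤ fr y := h.P.mR.monotoneOn ⟨hx, hxy.trans hy⟩ ⟨hx.trans hxy, hy⟩ hxy
  have hc1 := h.P.c1
  have k2 := h.k2
  have q1 : (7/8) * ((1 / 2) * ((y - x) / (1 - c))) ≤ 2 * (fr y - fr x) := by
    calc _ ≤ (1 - fr c) * (Tf α c y - Tf α c x) := by
          apply mul_le_mul <;> linarith
      _ ≤ k * (fr y - fr x) := hR
      _ ≤ _ := by gcongr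
  have q2 : (y - x) / (1 - c) ≤ 8 * (fr y - fr x) := by linarith
  rw [div_le_iff₀ e0] at q2
  linarith

lemma Lev.E5 (h : Lev α k fl fr c a b p q) (h8 : fr c ≤ c / 8) :
    (c - p) ^ α ≤ 4 * (8 * (1 - c)) ^ a * (q - p) := by
  have e0 := h.e0
  have hα := h.hα
  have pc := h.C.pc
  have cq := h.C.cq
  have key : ∀ i ≤ a, fl c - fl p ≤ (8 * (1 - c)) ^ i * (fr^[i] (fl c) - fr^[i] (fl p)) := by
    intro i
    induction i with
    | zero => intro _; simp
    | succ i ih =>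
      intro hi
      have h1 := h.C.Lp i (by omega)
      have h2 := h.C.Lc i (by omega)
      have h3 : c ≤ fr (fr^[i] (fl c)) := by
        rw [← Function.iterate_succ_apply' fr]
        rcases Nat.lt_or_ge (i + 1) a with h4 | h4
        · exact cq.le.trans (h.C.Lc _ h4).1
        · have : i + 1 = a := by omega
          change c ≤ fr^[i + 1] (fl c)
          rw [this]; exact h.C.Ld.1.le
      have h5 := h.slope h8 (x := fr^[i] (fl p)) (y := fr^[i] (fl c)) (by linarith [h1.1])
        (h.iter_lt i (by omega)).le h2.2.le h3
      rw [Function.iterate_succ_apply', Function.iterate_succ_apply', pow_succ]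
      calc _ ≤ _ := ih (by omega)
        _ ≤ (8 * (1 - c)) ^ i * (8 * (1 - c) * (fr (fr^[i] (fl c)) - fr (fr^[i] (fl p)))) := by
            gcongr
        _ = _ := by ring
  have h1 := key a le_rfl
  rw [h.C.Lr] at h1
  have h2 : fl c - fl p ≤ (8 * (1 - c)) ^ a * (q - p) :=
    h1.trans (by gcongr; exact h.C.Ld.2)
  have hL := (h.E.L p c h.C.p0.le pc.le le_rfl).2
  rw [Sf_c hα, sub_zero] at hL
  have c0 := h.P.c0
  have l0 : 0 < c - p := by linarith
  have hS : (c - p) ^ α ≤ Sf α c p := by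
    unfold Sf
    apply Real.rpow_le_rpow l0.le _ (by linarith)
    rw [le_div_iff₀ c0]
    nlinarith [h.P.c1]
  have hlp := h.flp_lt
  have hp : 0 ≤ (c - p) ^ α := by positivity
  have h3 : (15/16) * (c - p) ^ α ≤ 2 * (fl c - fl p) := by
    calc _ ≤ fl c * Sf α c p := by
          apply mul_le_mul _ hS hp _ <;> linarith [h.eps, h.lq]
      _ ≤ k * (fl c - fl p) := hL
      _ ≤ _ := by gcongr; exact h.k2
  linarith

/-- the two orbits on the left branch -/
lemma Lev.XY (h : Lev α k fl fr c a b p q) {j : ℕ} (hj : j < b) :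
    0 ≤ fl^[j] (fr c) ∧ fl^[j] (fr c) < fl^[j] (fr q) ∧ fl^[j] (fr q) < c :=
  ⟨(h.C.Rc j hj).1.le, h.iter_lt' j hj.le, lt_of_le_of_lt (h.C.Rq j hj).2 h.C.pc⟩

lemma Sf_eq (hc : 0 < c) (x : ℝ) : Sf α c x = (1 - x / c) ^ α := by
  unfold Sf; congr 1; field_simp

lemma Lev.D0 (h : Lev α k fl fr c a b p q) (h8 : fr c ≤ c / 8) :
    (7/16) * ((q - c) / (1 - c)) ^ α ≤ fr q - fr c ∧ fr q - fr c ≤ 2 * ((q - c) / (1 - c)) ^ α := by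
  have cq := h.C.cq
  have e0 := h.e0
  have hR := h.E.R c q le_rfl cq.le h.C.q1.le
  rw [Tf_c h.hα, sub_zero] at hR
  have hp : 0 ≤ Tf α c q := Real.rpow_nonneg (div_nonneg (by linarith) e0.le) _
  change (7/16) * Tf α c q ≤ _ ∧ _ ≤ 2 * Tf α c q
  have hm := h.P.mR ⟨le_rfl, h.P.c1.le⟩ ⟨cq.le, h.C.q1.le⟩ cq
  have k1 := h.k1
  have k2 := h.k2
  have hr0 := h.P.r0
  have c1 := h.P.c1
  constructor
  · have h1 : (7/8) * Tf α c q ≤ 2 * (fr q - fr c) := by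
      calc _ ≤ (1 - fr c) * Tf α c q := by gcongr; linarith
        _ ≤ k * (fr q - fr c) := hR.2
        _ ≤ _ := by gcongr
    linarith
  · refine hR.1.trans ?_
    have : k * (1 - fr c) ≤ 2 := by nlinarith
    gcongr

lemma Lev.E6 (h : Lev α k fl fr c a b p q) (h8 : fr c ≤ c / 8) (hr : q - c ≤ (1 - c) / 2)
    (hkb : k ^ (2 * b) ≤ 2) :
    α ^ b * (1 - c) * ((q - c) / (1 - c)) ^ α ≤ 128 * (q - fl^[b] (fr c)) := by
  have hα := h.hα
  have c0 := h.P.c0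
  have e0 := h.e0
  have k1 := h.k1
  have hb := h.C.hb
  set X : ℕ → ℝ := fun j => 1 - fl^[j] (fr c) / c with hX
  set Y : ℕ → ℝ := fun j => 1 - fl^[j] (fr q) / c with hY
  have hY0 : ∀ j < b, 0 < Y j := fun j hj => by
    have := h.XY hj
    simp only [hY, sub_pos]; rw [div_lt_one c0]; exact this.2.2
  have hXY : ∀ j ≤ b, Y j < X j := fun j hj => by
    simp only [hX, hY]
    have := div_lt_div_of_pos_right (h.iter_lt' j hj) c0
    linarith
  have stepY : ∀ j < b, Y (j + 1) ≤ k * Y j ^ α := fun j hj => by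
    have := h.XY hj
    simp only [hY, Function.iterate_succ_apply']
    exact h.ystep (by linarith) this.2.2.le
  have hlc : c ≤ fl c := by linarith [h.lq, h.C.cq]
  have stepD : ∀ j < b, α * Y j ^ (α - 1) * (X j - Y j) ≤ k * (X (j + 1) - Y (j + 1)) :=
    fun j hj => by
    have h1 := h.XY hj
    have hL := (h.E.L _ _ h1.1 h1.2.1.le h1.2.2.le).2
    rw [Sf_eq c0, Sf_eq c0, ← Function.iterate_succ_apply' fl, ← Function.iterate_succ_apply' fl] at hL
    have ht := tangent (s := X j) (t := Y j) hα ((hY0 j hj).le.trans (hXY j hj.le).le) (hY0 j hj).le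
    have hm : 0 ≤ X j ^ α - Y j ^ α := by
      have : Y j ^ α ≤ X j ^ α :=
        Real.rpow_le_rpow (hY0 j hj).le (hXY j hj.le).le (by linarith)
      linarith
    have h2 : c * (X j ^ α - Y j ^ α) ≤ k * (fl^[j + 1] (fr q) - fl^[j + 1] (fr c)) :=
      le_trans (by gcongr) hL
    have h3 : X (j + 1) - Y (j + 1) = (fl^[j + 1] (fr q) - fl^[j + 1] (fr c)) / c := by
      simp only [hX, hY]; ring
    rw [h3, ← mul_div_assoc, le_div_iff₀ c0]
    nlinarith
  have tele : ∀ n < b, α ^ n * (X 0 - Y 0) * Y n ≤ k ^ (2 * n) * (X n - Y n) * Y 0 := by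
    intro n
    induction n with
    | zero => intro _; simp
    | succ n ih =>
      intro hn
      have i1 := ih (by omega)
      have yn := hY0 n (by omega)
      have yn1 := hY0 (n + 1) hn
      have y00 := hY0 0 (by omega)
      have dn : 0 < X n - Y n := by linarith [hXY n (by omega)]
      have dn1 : 0 < X (n + 1) - Y (n + 1) := by linarith [hXY (n + 1) (by omega)]
      have s1 := stepY n (by omega)
      have s2 := stepD n (by omega)
      have ey : Y n ^ α = Y n ^ (α - 1) * Y n := by
        rw [← Real.rpow_add_one yn.ne']; congr 1; ring
      have s3 : α * Y (n + 1) * (X n - Y n) ≤ k ^ 2 * (X (n + 1) - Y (n + 1)) * Y n := by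
        calc α * Y (n + 1) * (X n - Y n) ≤ α * (k * Y n ^ α) * (X n - Y n) := by gcongr
          _ = k * Y n * (α * Y n ^ (α - 1) * (X n - Y n)) := by rw [ey]; ring
          _ ≤ k * Y n * (k * (X (n + 1) - Y (n + 1))) := by gcongr
          _ = _ := by ring
      have : (α ^ (n + 1) * (X 0 - Y 0) * Y (n + 1)) * Y n ≤
          (k ^ (2 * (n + 1)) * (X (n + 1) - Y (n + 1)) * Y 0) * Y n := by
        calc _ = α * Y (n + 1) * (α ^ n * (X 0 - Y 0) * Y n) := by ring
          _ ≤ α * Y (n + 1) * (k ^ (2 * n) * (X n - Y n) * Y 0) := by gcongr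
          _ = k ^ (2 * n) * Y 0 * (α * Y (n + 1) * (X n - Y n)) := by ring
          _ ≤ k ^ (2 * n) * Y 0 * (k ^ 2 * (X (n + 1) - Y (n + 1)) * Y n) := by gcongr
          _ = _ := by ring
      exact le_of_mul_le_mul_right this yn
  obtain ⟨n, rfl⟩ : ∃ n, b = n + 1 := ⟨b - 1, by omega⟩
  have t1 := tele n (by omega)
  have yn := hY0 n (by omega)
  have y00 := hY0 0 (by omega)
  have y01 : Y 0 ≤ 1 := by
    have := h.XY (j := 0) (by omega)
    simp only [hY, Function.iterate_zero, id]
    have : 0 ≤ fr q / c := div_nonneg (by simpa using (this.1.trans this.2.1.le)) c0.le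
    linarith
  have ey : Y n ^ α = Y n ^ (α - 1) * Y n := by
    rw [← Real.rpow_add_one yn.ne']; congr 1; ring
  have s2 := stepD n (by omega)
  have dn : 0 ≤ X n - Y n := by linarith [hXY n (by omega)]
  have dn1 : 0 < X (n + 1) - Y (n + 1) := by linarith [hXY (n + 1) (by omega)]
  have d0 : 0 < X 0 - Y 0 := by linarith [hXY 0 (by omega)]
  have h1 : α ^ (n + 1) * (X 0 - Y 0) * Y n ^ α ≤ 2 * (X (n + 1) - Y (n + 1)) := by
    calc _ = α * Y n ^ (α - 1) * (α ^ n * (X 0 - Y 0) * Y n) := by rw [ey]; ring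
      _ ≤ α * Y n ^ (α - 1) * (k ^ (2 * n) * (X n - Y n) * Y 0) := by gcongr
      _ = k ^ (2 * n) * Y 0 * (α * Y n ^ (α - 1) * (X n - Y n)) := by ring
      _ ≤ k ^ (2 * n) * 1 * (k * (X (n + 1) - Y (n + 1))) := by gcongr
      _ = k ^ (2 * n + 1) * (X (n + 1) - Y (n + 1)) := by ring
      _ ≤ k ^ (2 * (n + 1)) * (X (n + 1) - Y (n + 1)) := by
          gcongr
          omega

      _ ≤ _ := by gcongr
  have hyn : (1 - c) / 8 ≤ Y n ^ α := by
    have hh := h.XY (j := n) (by omega)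
    have hL := (h.E.L (fl^[n] (fr q)) c (by linarith) hh.2.2.le le_rfl).1
    rw [Sf_c hα, sub_zero, Sf_eq c0, ← Function.iterate_succ_apply' fl, h.C.Rr] at hL
    have := h.flq h8 hr
    have hp : 0 ≤ Y n ^ α := by positivity
    have : k * fl c * Y n ^ α ≤ 2 * 1 * Y n ^ α := by
      have fl0 : 0 ≤ fl c := by linarith
      have := h.k2
      gcongr
      exact h.fl_le
    linarith
  have hD0 : (7/16) * ((q - c) / (1 - c)) ^ α ≤ X 0 - Y 0 := by
    refine (h.D0 h8).1.trans ?_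
    have : X 0 - Y 0 = (fr q - fr c) / c := by simp only [hX, hY, Function.iterate_zero, id]; ring
    rw [this, le_div_iff₀ c0]
    have : 0 < fr q - fr c := by
      have := h.iter_lt' 0 (by omega); simpa using this
    nlinarith [h.P.c1]
  have hDb : X (n + 1) - Y (n + 1) ≤ 2 * (q - fl^[n + 1] (fr c)) := by
    have : X (n + 1) - Y (n + 1) = (q - fl^[n + 1] (fr c)) / c := by
      simp only [hX, hY, h.C.Rr]; ring
    rw [this, div_le_iff₀ c0]
    have : fl^[n + 1] (fr c) < q := lt_trans h.C.Rd.2 h.C.cq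
    nlinarith [h.eps]
  have hq : 0 ≤ ((q - c) / (1 - c)) ^ α :=
    Real.rpow_nonneg (div_nonneg (by linarith [h.C.cq]) e0.le) _
  have h2 : α ^ (n + 1) * ((7/16) * ((q - c) / (1 - c)) ^ α) * ((1 - c) / 8) ≤
      2 * (2 * (q - fl^[n + 1] (fr c))) := by
    refine le_trans ?_ (h1.trans (by gcongr))
    gcongr
  have h3 : 0 ≤ q - fl^[n + 1] (fr c) := by linarith [h.C.Rd.2, h.C.cq]
  linarith

set_option maxHeartbeats 1000000 in
lemma Lev.E10 (h : Lev α k fl fr c a b p q) (h8 : fr c ≤ c / 8) (hr : q - c ≤ (1 - c) / 2)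
    (hl : c - p ≤ (1 - c) / 2) {ρ : ℝ} (hρ0 : 0 ≤ ρ) (hρ : 1 - c ≤ ρ * ((1 - c) / 8) ^ (1 / α))
    (hW : (k ^ 2 * (1 + 2 * (1 - c)) * (1 + ρ)) ^ b ≤ 2) :
    q - fl^[b] (fr c) ≤ 64 * (α ^ b * (1 - c) * ((q - c) / (1 - c)) ^ α) := by
  have hα := h.hα
  have c0 := h.P.c0
  have e0 := h.e0
  have k1 := h.k1
  have k2 := h.k2
  have hb := h.C.hb
  have ep := h.eps
  set μ := 1 + 2 * (1 - c) with hμ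
  set X : ℕ → ℝ := fun j => 1 - fl^[j] (fr c) / c with hX
  set D : ℕ → ℝ := fun j => (fl^[j] (fr q) - fl^[j] (fr c)) / c with hD
  have hX0 : ∀ j < b, 0 < X j := fun j hj => by
    have := h.XY hj
    simp only [hX, sub_pos]; rw [div_lt_one c0]; linarith
  have hD0 : ∀ j ≤ b, 0 < D j := fun j hj => div_pos (by linarith [h.iter_lt' j hj]) c0
  have hlc : c ≤ fl c := by linarith [h.lq, h.C.cq]
  have stepD : ∀ j < b, D (j + 1) ≤ k * μ * α * X j ^ (α - 1) * D j := fun j hj => by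
    have h1 := h.XY hj
    have hL := (h.E.L _ _ h1.1 h1.2.1.le h1.2.2.le).1
    rw [Sf_eq c0, Sf_eq c0, ← Function.iterate_succ_apply' fl, ← Function.iterate_succ_apply' fl] at hL
    have y0 : 0 ≤ 1 - fl^[j] (fr q) / c := by rw [sub_nonneg, div_le_one c0]; exact h1.2.2.le
    have ht := tangent (s := 1 - fl^[j] (fr q) / c) (t := X j) hα y0 (hX0 j hj).le
    have e : 1 - fl^[j] (fr q) / c - X j = - D j := by simp only [hX, hD]; ring
    rw [e] at ht
    have d0 := hD0 j hj.le
    have x0 := hX0 j hj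
    have hm : fl c ≤ μ * c := by
      have := h.fl_le
      nlinarith
    simp only [hD]
    rw [div_le_iff₀ c0]
    calc _ ≤ _ := hL
      _ ≤ k * fl c * (α * X j ^ (α - 1) * D j) := by
          have fl0 : 0 ≤ fl c := by linarith
          refine mul_le_mul_of_nonneg_left ?_ (by positivity)
          simp only [hX] at ht ⊢
          linarith
      _ ≤ k * (μ * c) * (α * X j ^ (α - 1) * D j) := by gcongr
      _ = _ := by simp only [hD]; ring
  have hxn : ∀ j < b, fl^[j + 1] (fr c) ≤ c := fun j hj => by
    rcases Nat.lt_or_ge (j + 1) b with h4 | h4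
    · have := h.XY h4; linarith
    · have : j + 1 = b := by omega
      rw [this]; exact h.C.Rd.2.le
  have stepX : ∀ j < b, X j ^ α ≤ k * (X (j + 1) + (1 - c)) := fun j hj => by
    have h1 := h.XY hj
    have hL := (h.E.L (fl^[j] (fr c)) c h1.1 (by linarith) le_rfl).2
    rw [Sf_c hα, sub_zero, Sf_eq c0, ← Function.iterate_succ_apply' fl] at hL
    have h2 := hxn j hj
    have flp : 0 < fl c := by linarith
    have h3 : X j ^ α ≤ k * (1 - fl^[j + 1] (fr c) / fl c) := by
      refine le_of_mul_le_mul_left (le_trans hL (le_of_eq ?_)) flp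
      field_simp
    have x0 : 0 ≤ fl^[j + 1] (fr c) := by
      rw [Function.iterate_succ_apply', ← h.P.fl0]
      exact h.P.mL.monotoneOn ⟨le_rfl, c0.le⟩ ⟨h1.1, by linarith⟩ h1.1
    have h4 : fl^[j + 1] (fr c) ≤ fl^[j + 1] (fr c) / fl c := by
      rw [le_div_iff₀ flp]; nlinarith [h.fl_le]
    have h5 : fl^[j + 1] (fr c) / c ≤ fl^[j + 1] (fr c) + (1 - c) := by
      rw [div_le_iff₀ c0]; nlinarith
    refine h3.trans ?_
    gcongr
    simp only [hX]
    linarith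
  have lowX : ∀ j < b, (1 - c) / 8 ≤ X j ^ α := fun j hj => by
    have hh := h.XY hj
    have hL := (h.E.L (fl^[j] (fr c)) c hh.1 (by linarith) le_rfl).1
    rw [Sf_c hα, sub_zero, Sf_eq c0, ← Function.iterate_succ_apply' fl] at hL
    have := h.flq h8 hr
    have hp : 0 ≤ X j ^ α := Real.rpow_nonneg (hX0 j hj).le _
    have : k * fl c * X j ^ α ≤ 2 * 1 * X j ^ α := by
      gcongr
      · linarith
      · exact h.fl_le
    have := hxn j hj
    have := h.C.cq
    linarith
  have epsX : ∀ j < b, 1 - c ≤ ρ * X j := fun j hj => by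
    refine hρ.trans ?_
    gcongr
    calc ((1 - c) / 8) ^ (1 / α) ≤ (X j ^ α) ^ (1 / α) :=
          Real.rpow_le_rpow (by positivity) (lowX j hj) (by positivity)
      _ = X j := by
          rw [← Real.rpow_mul (hX0 j hj).le, mul_one_div_cancel (by linarith), Real.rpow_one]
  set W := k ^ 2 * μ * (1 + ρ) with hWd
  have μ1 : 1 ≤ μ := by linarith
  have W0 : 0 ≤ W := by positivity
  have tele : ∀ n < b, D n * X 0 ≤ W ^ n * α ^ n * X n * D 0 := by
    intro n
    induction n with
    | zero => intro _; simp [mul_comm]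
    | succ n ih =>
      intro hn
      have i1 := ih (by omega)
      have xn := hX0 n (by omega)
      have xn1 := hX0 (n + 1) hn
      have x00 := hX0 0 (by omega)
      have d00 := hD0 0 (by omega)
      have dn := hD0 n (by omega)
      have s1 := stepX n (by omega)
      have s2 := stepD n (by omega)
      have ey : X n ^ α = X n ^ (α - 1) * X n := by
        rw [← Real.rpow_add_one xn.ne']; congr 1; ring
      have s3 : D (n + 1) * X n ≤ W * α * X (n + 1) * D n := by
        calc D (n + 1) * X n ≤ k * μ * α * X n ^ (α - 1) * D n * X n := by gcongr
          _ = k * μ * α * D n * X n ^ α := by rw [ey]; ring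
          _ ≤ k * μ * α * D n * (k * (X (n + 1) + (1 - c))) := by gcongr
          _ ≤ k * μ * α * D n * (k * (X (n + 1) + ρ * X (n + 1))) := by
              gcongr; exact epsX _ hn
          _ = _ := by rw [hWd]; ring
      have : (D (n + 1) * X 0) * X n ≤ (W ^ (n + 1) * α ^ (n + 1) * X (n + 1) * D 0) * X n := by
        calc _ = D (n + 1) * X n * X 0 := by ring
          _ ≤ W * α * X (n + 1) * D n * X 0 := by gcongr
          _ = W * α * X (n + 1) * (D n * X 0) := by ring
          _ ≤ W * α * X (n + 1) * (W ^ n * α ^ n * X n * D 0) := by gcongr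
          _ = _ := by ring
      exact le_of_mul_le_mul_right this xn
  obtain ⟨n, rfl⟩ : ∃ n, b = n + 1 := ⟨b - 1, by omega⟩
  have t1 := tele n (by omega)
  have xn := hX0 n (by omega)
  have x00 : 1 / 2 ≤ X 0 := by
    simp only [hX, Function.iterate_zero, id]
    have : fr c / c ≤ 1 / 8 := by rw [div_le_iff₀ c0]; linarith
    linarith
  have d00 := hD0 0 (by omega)
  have dn := hD0 n (by omega)
  have ey : X n ^ α = X n ^ (α - 1) * X n := by
    rw [← Real.rpow_add_one xn.ne']; congr 1; ring
  have xb : X n ^ α ≤ 4 * (1 - c) := by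
    refine (stepX n (by omega)).trans ?_
    have : X (n + 1) ≤ 1 - c := by
      simp only [hX]
      have : p / c ≤ fl^[n + 1] (fr c) / c := by gcongr; exact h.C.Rd.1
      have h2 : c - (1 - c) / 2 ≤ p := by linarith
      have h3 : c ≤ p / c := by
        rw [le_div_iff₀ c0]; nlinarith
      linarith
    nlinarith
  have kW : k * μ ≤ W := by
    rw [hWd]
    have : k * μ ≤ k * μ * (k * (1 + ρ)) := le_mul_of_one_le_right (by positivity) (by nlinarith)
    linarith
  have hDd : D 0 ≤ 4 * ((q - c) / (1 - c)) ^ α := by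
    have h1 := (h.D0 h8).2
    simp only [hD, Function.iterate_zero, id]
    rw [div_le_iff₀ c0]
    have : 0 ≤ ((q - c) / (1 - c)) ^ α :=
      Real.rpow_nonneg (div_nonneg (by linarith [h.C.cq]) e0.le) _
    nlinarith
  have h1 : D (n + 1) * (1 / 2) ≤ 2 * α ^ (n + 1) * (4 * (1 - c)) * (4 * ((q - c) / (1 - c)) ^ α) := by
    calc D (n + 1) * (1 / 2) ≤ D (n + 1) * X 0 := by
          gcongr; exact (hD0 (n + 1) le_rfl).le
      _ ≤ k * μ * α * X n ^ (α - 1) * D n * X 0 := by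
          gcongr; exact stepD n (by omega)
      _ = k * μ * α * X n ^ (α - 1) * (D n * X 0) := by ring
      _ ≤ k * μ * α * X n ^ (α - 1) * (W ^ n * α ^ n * X n * D 0) := by gcongr
      _ = (k * μ) * W ^ n * α ^ (n + 1) * X n ^ α * D 0 := by rw [ey]; ring
      _ ≤ W * W ^ n * α ^ (n + 1) * X n ^ α * D 0 := by gcongr
      _ = W ^ (n + 1) * α ^ (n + 1) * X n ^ α * D 0 := by ring
      _ ≤ 2 * α ^ (n + 1) * (4 * (1 - c)) * (4 * ((q - c) / (1 - c)) ^ α) := by gcongr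
  have hDb : q - fl^[n + 1] (fr c) ≤ D (n + 1) := by
    simp only [hD, h.C.Rr]
    rw [le_div_iff₀ c0]
    have : fl^[n + 1] (fr c) < q := lt_trans h.C.Rd.2 h.C.cq
    exact mul_le_of_le_one_right (by linarith) h.P.c1.le
  linarith

lemma ratio_rpow {r e : ℝ} (hα : 1 < α) (hr : 0 ≤ r) (he : 0 < e) :
    e * (r / e) ^ α * e ^ (α - 1) = r ^ α := by
  rw [Real.div_rpow hr he.le]
  have : e ^ α = e ^ (α - 1) * e := by
    rw [← Real.rpow_add_one he.ne']; congr 1; ring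
  rw [this]
  field_simp

lemma Lev.E78 (h : Lev α k fl fr c a b p q) (h8 : fr c ≤ c / 8) (hr : q - c ≤ (1 - c) / 2)
    (hkb : k ^ (2 * b) ≤ 2) {A : ℝ} (hA : 256 * C1 α < A)
    (hM : A * (1 - c) ^ (α - 1) ≤ α ^ b * (1 - c) ^ a) :
    q - c ≤ c - p ∧ A * (q - c) ^ α ≤ 256 * C1 α * (c - p) ^ α := by
  have hα := h.hα
  have e0 := h.e0
  have l0 : 0 < c - p := by linarith [h.C.pc]
  have r0 : 0 < q - c := by linarith [h.C.cq]
  have h6 := h.E6 h8 hr hkb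
  have h1 := h.E1
  have C0 := C1_pos hα
  have hd := h.C.Rd.1
  have ep : 0 < (1 - c) ^ (α - 1) := by positivity
  have ea : 0 < (1 - c) ^ a := by positivity
  have h6' : α ^ b * (q - c) ^ α ≤ 128 * (q - p) * (1 - c) ^ (α - 1) := by
    rw [← ratio_rpow hα r0.le e0]
    have : α ^ b * (1 - c) * ((q - c) / (1 - c)) ^ α ≤ 128 * (q - p) := by linarith
    calc _ = α ^ b * (1 - c) * ((q - c) / (1 - c)) ^ α * (1 - c) ^ (α - 1) := by ring
      _ ≤ _ := by gcongr
  have er : (q - c) ^ α = (q - c) ^ (α - 1) * (q - c) := by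
    rw [← Real.rpow_add_one r0.ne']; congr 1; ring
  have el : (c - p) ^ α = (c - p) ^ (α - 1) * (c - p) := by
    rw [← Real.rpow_add_one l0.ne']; congr 1; ring
  have hrl : q - c ≤ c - p := by
    by_contra hlt
    push Not at hlt
    have h2 : (c - p) ^ (α - 1) ≤ (q - c) ^ (α - 1) :=
      Real.rpow_le_rpow l0.le hlt.le (by linarith)
    have h3 : α ^ b * (q - c) ^ (α - 1) ≤ 256 * (1 - c) ^ (α - 1) := by
      refine le_of_mul_le_mul_right ?_ r0
      calc _ = α ^ b * (q - c) ^ α := by rw [er]; ring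
        _ ≤ _ := h6'
        _ ≤ 128 * (2 * (q - c)) * (1 - c) ^ (α - 1) := by gcongr; linarith
        _ = _ := by ring
    have h4 : A * (1 - c) ^ (α - 1) ≤ 256 * C1 α * (1 - c) ^ (α - 1) := by
      calc _ ≤ _ := hM
        _ ≤ α ^ b * (C1 α * (q - c) ^ (α - 1)) := by
            gcongr; exact h1.trans (by gcongr)
        _ = C1 α * (α ^ b * (q - c) ^ (α - 1)) := by ring
        _ ≤ C1 α * (256 * (1 - c) ^ (α - 1)) := by gcongr
        _ = _ := by ring
    linarith [le_of_mul_le_mul_right h4 ep]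
  refine ⟨hrl, ?_⟩
  refine le_of_mul_le_mul_right ?_ ep
  calc A * (q - c) ^ α * (1 - c) ^ (α - 1) = A * (1 - c) ^ (α - 1) * (q - c) ^ α := by ring
    _ ≤ α ^ b * (1 - c) ^ a * (q - c) ^ α := by gcongr
    _ = α ^ b * (q - c) ^ α * (1 - c) ^ a := by ring
    _ ≤ 128 * (q - p) * (1 - c) ^ (α - 1) * (1 - c) ^ a := by gcongr
    _ ≤ 128 * (2 * (c - p)) * (1 - c) ^ (α - 1) * (C1 α * (c - p) ^ (α - 1)) := by
        gcongr; linarith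
    _ = _ := by rw [el]; ring

lemma Lev.E9 (h : Lev α k fl fr c a b p q) (h8 : fr c ≤ c / 8) (hrl : q - c ≤ c - p) :
    (c - p) ^ (α - 1) ≤ 8 * (8 * (1 - c)) ^ a := by
  have l0 : 0 < c - p := by linarith [h.C.pc]
  have e0 := h.e0
  have h5 := h.E5 h8
  have el : (c - p) ^ α = (c - p) ^ (α - 1) * (c - p) := by
    rw [← Real.rpow_add_one l0.ne']; congr 1; ring
  rw [el] at h5
  refine le_of_mul_le_mul_right (h5.trans ?_) l0
  calc _ ≤ 4 * (8 * (1 - c)) ^ a * (2 * (c - p)) := by gcongr; linarith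
    _ = _ := by ring
end LW

namespace LW

structure Par (α K η κ lo hi wlo ρ A : ℝ) (a b : ℕ) : Prop where
  hα : 1 < α
  K1 : 1 ≤ K
  η0 : 0 ≤ η
  η1 : η ≤ 1
  κe : κ = K * (1 + η)
  κ2 : κ ^ 2 ≤ 2
  W : ((κ ^ 2) ^ 2 * (1 + 2 * hi) * (1 + ρ)) ^ b ≤ 2
  hi1 : hi ≤ 1 / 16
  hi2 : 8 * α * hi ≤ 1
  wlo0 : 0 < wlo
  wl : wlo ≤ lo
  ρ0 : 0 ≤ ρ
  ρh : ∀ e, 0 < e → e ≤ hi → e ≤ ρ * (e / 8) ^ (1 / α)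
  hk : κ ^ 2 * (1 - xz α) ^ ((α - 1) / 2) ≤ 1
  hA : ∀ e l, wlo ≤ e → 0 < l → e ^ a ≤ C1 α * l ^ (α - 1) →
    (1 - xz α) ^ (((1 + α) / 2) ^ (b - 1)) < l
  a2 : (a : ℝ) + 1 ≤ 2 * α
  M : ∀ e, lo ≤ e → e ≤ hi → A * e ^ (α - 1) ≤ α ^ b * e ^ a
  A1 : 256 * C1 α < A
  up : ∀ r l, 0 < r → 0 < l → A * r ^ α ≤ 256 * C1 α * l ^ α → r ≤ hi * l
  ko : ∀ e l, 0 < e → e ≤ hi → 0 < l → l ^ (α - 1) ≤ 8 * (8 * e) ^ a → 8 * l ≤ η * e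
  wk : ∀ e r, 0 < e → 0 < r → e ^ (α - 1) ≤ 64 * α ^ b * r ^ (α - 1) → wlo * e ≤ r
  low : ∀ e l r, 0 < e → e ≤ hi → 0 < l → 0 < r →
    l ^ α * e ^ (α - 1) ≤ 1024 * 8 ^ a * e ^ a * α ^ b * r ^ α → lo * (2 * l) ≤ r

variable {α K η κ lo hi wlo ρ A c p q : ℝ} {fl fr : ℝ → ℝ} {a b : ℕ}

lemma Par.κ1 (P : Par α K η κ lo hi wlo ρ A a b) : 1 ≤ κ := by
  rw [P.κe]; nlinarith [P.K1, P.η0]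

lemma Par.lev (P : Par α K η κ lo hi wlo ρ A a b) (hc : 0 < c) (hc1 : c < 1)
    (hl : Half α K κ fl c) (hr : Half α K κ (flp fr) (1 - c)) (C : Comb fl fr c a b p q)
    (he : 1 - c ≤ hi) : Lev α (κ ^ 2) fl fr c a b p q where
  hα := P.hα
  k1 := one_le_pow₀ P.κ1
  k2 := P.κ2
  P := pair_of_half P.hα hc hc1 hl hr
  E := est_of_half P.hα P.κ1 hc hc1 hl hr
  C := C
  eps := he.trans P.hi1
  aeps := le_trans (by have := P.hα; gcongr) P.hi2
  a2 := P.a2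

lemma Par.cv (P : Par α K η κ lo hi wlo ρ A a b) (h : Lev α (κ ^ 2) fl fr c a b p q)
    (he : wlo ≤ 1 - c) : fr c ≤ c / 8 ∧ q - c ≤ (1 - c) / 2 :=
  h.cv0_small P.hk (P.hA _ _ he (by linarith [h.C.pc]) h.E1)

lemma Par.step (P : Par α K η κ lo hi wlo ρ A a b) (hl : Half α K κ fl c)
    (hr : Half α K κ (flp fr) (1 - c)) (h : Lev α (κ ^ 2) fl fr c a b p q)
    (he : lo ≤ 1 - c) (he2 : 1 - c ≤ hi) :
    fr c ≤ c / 8 ∧ q - c ≤ c - p ∧ 8 * (c - p) ≤ (1 - c) ∧ q - c ≤ hi * (c - p) ∧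
    wlo * (1 - c) ≤ q - c ∧ q - fl^[b] (fr c) ≤ 64 * (α ^ b * (1 - c) * ((q - c) / (1 - c)) ^ α) ∧
    Half α K κ (nextL fl fr a p q) ((c - p) / (q - p)) ∧
    Half α K κ (nextL (flp fr) (flp fl) b (1 - q) (1 - p)) (1 - (c - p) / (q - p)) := by
  have hα := P.hα
  obtain ⟨h8, hrr⟩ := P.cv h (P.wl.trans he)
  have e0 := h.e0
  have l0 : 0 < c - p := by linarith [h.C.pc]
  have r0 : 0 < q - c := by linarith [h.C.cq]
  have hk4 : ((κ ^ 2) ^ 2) ^ b ≤ 2 := by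
    refine le_trans ?_ P.W
    have h1 : 0 ≤ hi := by linarith
    have h2 := P.ρ0
    have h3 : 0 ≤ (κ ^ 2) ^ 2 := by positivity
    have h4 : 1 ≤ (1 + 2 * hi) * (1 + ρ) := by nlinarith
    apply pow_le_pow_left₀ h3
    rw [mul_assoc]
    exact le_mul_of_one_le_right h3 h4
  have hkb : (κ ^ 2) ^ (2 * b) ≤ 2 := by rwa [pow_mul]
  obtain ⟨hrl, h78⟩ := h.E78 h8 hrr hkb P.A1 (P.M _ he he2)
  have h9 := P.ko _ _ e0 he2 l0 (h.E9 h8 hrl)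
  have h9' : 8 * (c - p) ≤ 1 - c := h9.trans (mul_le_of_le_one_left e0.le P.η1)
  have hW : ((κ ^ 2) ^ 2 * (1 + 2 * (1 - c)) * (1 + ρ)) ^ b ≤ 2 := by
    refine le_trans ?_ P.W
    have h2 := P.ρ0
    gcongr
  have h10 := h.E10 h8 hrr (by linarith) P.ρ0 (P.ρh _ e0 he2) hW
  have hup := P.up _ _ r0 l0 h78
  have hwk : wlo * (1 - c) ≤ q - c := by
    apply P.wk _ _ e0 r0
    have h1 : q - c ≤ 64 * (α ^ b * (1 - c) * ((q - c) / (1 - c)) ^ α) := by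
      linarith [h.C.Rd.2]
    have ep : 0 < (1 - c) ^ (α - 1) := by positivity
    refine le_of_mul_le_mul_right ?_ r0
    have er : (q - c) ^ α = (q - c) ^ (α - 1) * (q - c) := by
      rw [← Real.rpow_add_one r0.ne']; congr 1; ring
    calc (1 - c) ^ (α - 1) * (q - c) ≤
        (1 - c) ^ (α - 1) * (64 * (α ^ b * (1 - c) * ((q - c) / (1 - c)) ^ α)) := by gcongr
      _ = 64 * α ^ b * ((1 - c) * ((q - c) / (1 - c)) ^ α * (1 - c) ^ (α - 1)) := by ring
      _ = _ := by rw [ratio_rpow hα r0.le e0, er]; ring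
  have ep := h.eps
  have η0 := P.η0
  have hflq := h.flq h8 hrr
  have hpq : q - p ≤ η * ((1 - c) / 4) := by linarith
  refine ⟨h8, hrl, h9', hup, hwk, h10, ?_, ?_⟩
  · rw [P.κe] at hl hr ⊢
    have hq : QCR 1 fr c 1 := by
      obtain ⟨_, _, _, _, _, _, hq⟩ := hr
      have := hq.flip
      simpa [flp_flp] using this
    refine Half.next hα P.K1 h.P hl hq h.C η0 (hpq.trans ?_) (hpq.trans ?_)
    · gcongr; linarith
    · gcongr; linarith
  · rw [P.κe] at hl hr ⊢
    have hq : QCR 1 (flp fl) (1 - c) 1 := by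
      obtain ⟨_, _, _, _, _, _, hq⟩ := hl
      have := hq.flip
      simpa using this
    have := Half.next hα P.K1 h.P.flip hr hq h.C.flip η0 (by
      simp only [flp, sub_sub_cancel]
      calc _ = q - p := by ring
        _ ≤ _ := hpq
        _ ≤ _ := by gcongr; linarith) (by
      simp only [sub_sub_cancel]
      calc _ = q - p := by ring
        _ ≤ _ := hpq
        _ ≤ _ := by gcongr; linarith)
    convert this using 1
    have : q - p ≠ 0 := by linarith
    rw [show 1 - p - (1 - q) = q - p by ring, eq_div_iff this]
    field_simp
    ring

lemma Par.lowb (P : Par α K η κ lo hi wlo ρ A a b) (h : Lev α (κ ^ 2) fl fr c a b p q)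
    (he2 : 1 - c ≤ hi) (h8 : fr c ≤ c / 8) (hrl : q - c ≤ c - p)
    (h10 : q - fl^[b] (fr c) ≤ 64 * (α ^ b * (1 - c) * ((q - c) / (1 - c)) ^ α))
    (hn : (fl^[b] (fr c) - p) / (q - p) ≤ ((c - p) / (q - p)) / 8) : lo * (2 * (c - p)) ≤ q - c := by
  have hα := P.hα
  have e0 := h.e0
  have l0 : 0 < c - p := by linarith [h.C.pc]
  have r0 : 0 < q - c := by linarith [h.C.cq]
  have qp : 0 < q - p := by linarith
  have h1 : fl^[b] (fr c) - p ≤ (c - p) / 8 := by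
    rw [div_right_comm, div_le_div_iff_of_pos_right qp] at hn
    exact hn
  have h2 : (c - p) / 2 ≤ 64 * (α ^ b * (1 - c) * ((q - c) / (1 - c)) ^ α) := by linarith
  apply P.low _ _ _ e0 he2 l0 r0
  have el : (c - p) ^ α = (c - p) ^ (α - 1) * (c - p) := by
    rw [← Real.rpow_add_one l0.ne']; congr 1; ring
  have ep : 0 < (1 - c) ^ (α - 1) := by positivity
  have h3 : (c - p) * (1 - c) ^ (α - 1) ≤ 128 * α ^ b * (q - c) ^ α := by
    rw [← ratio_rpow hα r0.le e0]
    calc _ ≤ 2 * (64 * (α ^ b * (1 - c) * ((q - c) / (1 - c)) ^ α)) * (1 - c) ^ (α - 1) := by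
          gcongr; linarith
      _ = _ := by ring
  have h9 := h.E9 h8 hrl
  calc _ = (c - p) ^ (α - 1) * ((c - p) * (1 - c) ^ (α - 1)) := by rw [el]; ring
    _ ≤ 8 * (8 * (1 - c)) ^ a * (128 * α ^ b * (q - c) ^ α) := by gcongr
    _ = _ := by rw [mul_pow]; ring

/-- all levels -/
theorem levels (g : ℕ → LorenzMap α) (p q : ℕ → ℝ) (ω : ℕ → ℕ × ℕ)
    (par : ∀ n, Par α K η κ lo hi wlo ρ A (ω n).1 (ω n).2)
    (hC : ∀ n, Comb (lb (g n)) (rb (g n)) (g n).c (ω n).1 (ω n).2 (p n) (q n))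
    (hc : ∀ n, (g (n + 1)).c = ((g n).c - p n) / (q n - p n))
    (hL : ∀ n, ∀ y ∈ Icc 0 (g (n + 1)).c, lb (g (n + 1)) y =
      nextL (lb (g n)) (rb (g n)) (ω n).1 (p n) (q n) y)
    (hR : ∀ n, ∀ y ∈ Icc 0 (1 - (g (n + 1)).c), flp (rb (g (n + 1))) y =
      nextL (flp (rb (g n))) (flp (lb (g n))) (ω n).2 (1 - q n) (1 - p n) y)
    (h0l : Half α K κ (lb (g 0)) (g 0).c) (h0r : Half α K κ (flp (rb (g 0))) (1 - (g 0).c))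
    (e1 : lo ≤ 1 - (g 0).c) (e2 : 1 - (g 0).c ≤ hi) (n : ℕ) :
    (Half α K κ (lb (g n)) (g n).c ∧ Half α K κ (flp (rb (g n))) (1 - (g n).c)) ∧
    lo ≤ 1 - (g n).c ∧ 1 - (g n).c ≤ hi ∧ 1 / 2 ≤ p n ∧ lo / 2 ≤ 1 - q n := by
  have main : (Half α K κ (lb (g n)) (g n).c ∧ Half α K κ (flp (rb (g n))) (1 - (g n).c)) ∧
    lo ≤ 1 - (g n).c ∧ 1 - (g n).c ≤ hi := by
    induction n with
    | zero => exact ⟨⟨h0l, h0r⟩, e1, e2⟩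
    | succ n ih =>
      obtain ⟨⟨hl, hr⟩, i1, i2⟩ := ih
      have P := par n
      have Lv := P.lev (g n).hc.1 (g n).hc.2 hl hr (hC n) i2
      obtain ⟨h8, hrl, hl8, hup, hwk, h10, H1, H2⟩ := P.step hl hr Lv i1 i2
      have l0 : 0 < (g n).c - p n := by linarith [(hC n).pc]
      have r0 : 0 < q n - (g n).c := by linarith [(hC n).cq]
      have qp : 0 < q n - p n := by linarith
      have e0 := Lv.e0
      rw [← hc n] at H1 H2
      have G1 := H1.congr (hL n)
      have G2 := H2.congr (hR n)
      have ee : 1 - (g (n + 1)).c = (q n - (g n).c) / (q n - p n) := by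
        rw [hc n]; field_simp; ring
      have hi' : 1 - (g (n + 1)).c ≤ hi := by
        rw [ee, div_le_iff₀ qp]
        nlinarith
      have P' := par (n + 1)
      have Lv' := P'.lev (g (n + 1)).hc.1 (g (n + 1)).hc.2 G1 G2 (hC (n + 1)) hi'
      have w : wlo ≤ 1 - (g (n + 1)).c := by
        rw [ee, le_div_iff₀ qp]
        refine le_trans ?_ hwk
        exact mul_le_mul_of_nonneg_left (by linarith) P.wlo0.le
      have cv := (P'.cv Lv' w).1
      have er : rb (g (n + 1)) (g (n + 1)).c =
          ((lb (g n))^[(ω n).2] (rb (g n) (g n).c) - p n) / (q n - p n) := by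
        have h1 := hR n (1 - (g (n + 1)).c) ⟨by linarith [(g (n + 1)).hc.2], le_rfl⟩
        rw [← flp_next (by linarith)] at h1
        simp only [flp, sub_sub_cancel, nextL] at h1
        have h2 : p n + (g (n + 1)).c * (q n - p n) = (g n).c := by
          rw [hc n]; field_simp; ring
        rw [h2] at h1
        linarith
      rw [er, hc n] at cv
      have := P.lowb Lv i2 h8 hrl h10 cv
      refine ⟨⟨G1, G2⟩, ?_, hi'⟩
      rw [ee, le_div_iff₀ qp]
      refine le_trans ?_ this
      have := P.wlo0.trans_le P.wl
      gcongr
      linarith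
  obtain ⟨⟨hl, hr⟩, i1, i2⟩ := main
  have Lv := (par n).lev (g n).hc.1 (g n).hc.2 hl hr (hC n) i2
  obtain ⟨h8, hrl, hl8, hup, hwk, h10, H1, H2⟩ := (par n).step hl hr Lv i1 i2
  have := Lv.eps
  have := (par n).wlo0.trans_le (par n).wl
  exact ⟨⟨hl, hr⟩, i1, i2, by linarith, by linarith⟩
end LW

namespace LW

lemma nat_rpow_bound {x : ℝ} (hx : 1 ≤ x) {a : ℕ} {α : ℝ} (h : (a:ℝ) + 1 ≤ 2 * α) :
    x ^ a ≤ x ^ (2 * α) := by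
  rw [← Real.rpow_natCast]
  exact Real.rpow_le_rpow_of_exponent_le hx (by linarith)

/-- `e^a ≤ e^(α-1) hi^σ` -/
lemma pow_split {e hi α σ : ℝ} {a : ℕ} (he : 0 < e) (heh : e ≤ hi) (h1 : hi ≤ 1) (hσ : 0 < σ)
    (ha : α + σ ≤ (a : ℝ) + 1) : e ^ a ≤ e ^ (α - 1) * hi ^ σ := by
  have : e ^ a = e ^ (α - 1) * e ^ ((a : ℝ) - (α - 1)) := by
    rw [← Real.rpow_add he, ← Real.rpow_natCast]; congr 1; ring
  rw [this]
  gcongr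
  calc e ^ ((a : ℝ) - (α - 1)) ≤ e ^ σ :=
        Real.rpow_le_rpow_of_exponent_ge he (heh.trans h1) (by linarith)
    _ ≤ _ := Real.rpow_le_rpow he.le heh hσ.le

set_option maxHeartbeats 2000000 in
lemma par_core {α σ β θ' N hi wlo ρ η K κ A : ℝ} (hα : 1 < α) (hσ : σ ∈ Ioo (0:ℝ) 1)
    (hβ : β ∈ Ioo (0 : ℝ) ((σ / α) ^ 2))
    (hθ' : 0 < θ') (hθC : 256 * C1 α ≤ θ' ^ α) (hN : 20 ≤ N)
    (hη : η = (1 / N) ^ 2) (hK : K = Real.exp (4 * (1 / N) ^ 2)) (hκ : κ = K * (1 + η))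
    (hhi : hi = θ' * α ^ (-N * σ / α ^ 2)) (hwlo : wlo = (64 * α ^ (2 * N)) ^ (-1 / (α - 1)))
    (hρ : ρ = 8 ^ (1 / α) * hi ^ (1 - 1 / α)) (hA : A = α ^ (N * σ / α))
    (c2 : 40 / N + 4 * N * hi + 2 * N * ρ ≤ 1 / 2) (c3 : hi ≤ 1 / 16) (c3' : 8 * α * hi ≤ 1)
    (c4 : Real.exp (10 * (1 / N) ^ 2) * (1 - xz α) ^ ((α - 1) / 2) ≤ 1)
    (c5 : Real.log (C1 α) + (2 * α / (α - 1)) * (Real.log 64 + 2 * N * Real.log α) <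
      (α - 1) * (-Real.log (1 - xz α)) * ((1 + α) / 2) ^ (N - 1))
    (c6 : 256 * C1 α < A)
    (c7 : 8 * 8 ^ (2 * α) * hi ^ σ ≤ (η / 8) ^ (α - 1))
    (c8 : 1024 * 8 ^ (2 * α) * 2 ^ α * θ' ^ σ * α ^ (-β * N) ≤ 1)
    {a b : ℕ} (h2 : 1 ≤ b) (h3 : α + σ ≤ (a:ℝ) + 1)
    (h4 : (a:ℝ) + 1 ≤ 2 * α - σ) (h5 : N ≤ b) (h6 : (b:ℝ) ≤ (1 + (σ / α) ^ 2 - β) * N) :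
    Par α K η κ (α ^ (-N / α)) hi wlo ρ A a b := by
  have α0 : 0 < α := by linarith
  have hi0 : 0 < hi := by rw [hhi]; positivity
  have N0 : 0 < N := by linarith
  have a2 : (a:ℝ) + 1 ≤ 2 * α := by linarith [hσ.1]
  have b2 : (b:ℝ) ≤ 2 * N := by
    refine h6.trans ?_
    have : (σ / α) ^ 2 ≤ 1 := by
      apply pow_le_one₀ (div_nonneg hσ.1.le α0.le)
      rw [div_le_one α0]; linarith [hσ.2]
    have := hβ.1
    gcongr
    linarith
  have η0 : 0 < η := by rw [hη]; positivity
  have ρ0 : 0 < ρ := by rw [hρ]; positivity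
  have x0 : (1 / N) ≤ 1 / 20 := one_div_le_one_div_of_le (by norm_num) hN
  have xp : 0 < 1 / N := by positivity
  have x2 : (1 / N) ^ 2 ≤ 1 / 400 := by nlinarith
  have K1 : 1 ≤ K := by rw [hK]; exact Real.one_le_exp (by positivity)
  have κ0 : 0 < κ := by rw [hκ]; positivity
  have κle : κ ≤ Real.exp (5 * (1 / N) ^ 2) := by
    rw [hκ, hK, show 5 * (1 / N) ^ 2 = 4 * (1 / N) ^ 2 + η by rw [hη]; ring, Real.exp_add]
    gcongr
    linarith [Real.add_one_le_exp η]
  have κ2 : κ ^ 2 ≤ Real.exp (10 * (1 / N) ^ 2) := by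
    calc κ ^ 2 ≤ Real.exp (5 * (1 / N) ^ 2) ^ 2 := by gcongr
      _ = _ := by rw [← Real.exp_nat_mul]; congr 1; push_cast; ring
  have ehalf : Real.exp (1 / 2) ≤ 2 := by
    have h := Real.add_one_le_exp (-(1/2:ℝ))
    rw [Real.exp_neg] at h
    have hp := Real.exp_pos (1/2)
    have : (1/2:ℝ) ≤ (Real.exp (1/2))⁻¹ := by linarith
    rw [le_inv_comm₀ (by norm_num) hp] at this
    linarith
  have z1 := xz_le hα
  have z0 := xz_pos α
  have w0 : 0 < 64 * α ^ (2 * N) := by positivity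
  have w1 : 1 ≤ 64 * α ^ (2 * N) := by
    have : 1 ≤ α ^ (2 * N) := Real.one_le_rpow hα.le (by positivity)
    linarith
  have a1 : 0 < α - 1 := by linarith
  have wlo0 : 0 < wlo := by rw [hwlo]; positivity
  have wlo1 : wlo ≤ 1 := by
    rw [hwlo]
    apply Real.rpow_le_one_of_one_le_of_nonpos w1
    exact div_nonpos_of_nonpos_of_nonneg (by norm_num) a1.le
  have C0 := C1_pos hα
  have A0 : 0 < A := by rw [hA]; positivity
  have lo0 : 0 < α ^ (-N / α) := by positivity
  refine ⟨hα, K1, η0.le, by rw [hη]; linarith, hκ, ?_, ?_, c3, c3', wlo0, ?_, ρ0.le, ?_, ?_, ?_,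
    a2, ?_, c6, ?_, ?_, ?_, ?_⟩
  · refine κ2.trans (le_trans (Real.exp_le_exp.2 ?_) ehalf)
    linarith
  · have e1 : (κ ^ 2) ^ 2 * (1 + 2 * hi) * (1 + ρ) ≤ Real.exp (20 * (1 / N) ^ 2 + 2 * hi + ρ) := by
      rw [Real.exp_add, Real.exp_add]
      have s1 : (κ ^ 2) ^ 2 ≤ Real.exp (20 * (1 / N) ^ 2) := by
        calc (κ ^ 2) ^ 2 ≤ Real.exp (10 * (1 / N) ^ 2) ^ 2 := by gcongr
          _ = _ := by rw [← Real.exp_nat_mul]; congr 1; push_cast; ring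
      have s2 := Real.add_one_le_exp (2 * hi)
      have s3 := Real.add_one_le_exp ρ
      gcongr <;> linarith
    calc _ ≤ Real.exp (20 * (1 / N) ^ 2 + 2 * hi + ρ) ^ b := by gcongr
      _ = Real.exp (b * (20 * (1 / N) ^ 2 + 2 * hi + ρ)) := by rw [← Real.exp_nat_mul]
      _ ≤ Real.exp (1 / 2) := by
          apply Real.exp_le_exp.2
          calc _ ≤ (2 * N) * (20 * (1 / N) ^ 2 + 2 * hi + ρ) := by gcongr
            _ = 40 / N + 4 * N * hi + 2 * N * ρ := by field_simp; ring
            _ ≤ _ := c2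
      _ ≤ 2 := ehalf
  · rw [hwlo]
    calc (64 * α ^ (2 * N)) ^ (-1 / (α - 1)) ≤ (α ^ (2 * N)) ^ (-1 / (α - 1)) := by
          apply Real.rpow_le_rpow_of_nonpos (by positivity)
          · have : 0 < α ^ (2 * N) := by positivity
            linarith
          · exact div_nonpos_of_nonpos_of_nonneg (by norm_num) a1.le
      _ = α ^ (2 * N * (-1 / (α - 1))) := by rw [← Real.rpow_mul α0.le]
      _ ≤ _ := by
          apply Real.rpow_le_rpow_of_exponent_le hα.le
          rw [mul_div_assoc', div_le_div_iff₀ a1 α0]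
          nlinarith
  · intro e e0 eh
    rw [hρ, Real.div_rpow e0.le (by norm_num)]
    have : e = e ^ (1 - 1 / α) * e ^ (1 / α) := by
      rw [← Real.rpow_add e0]; simp
    have h1 : e ^ (1 - 1 / α) ≤ hi ^ (1 - 1 / α) := by
      apply Real.rpow_le_rpow e0.le eh
      rw [sub_nonneg, div_le_one α0]; exact hα.le
    have h8 : (0:ℝ) < 8 ^ (1 / α) := by positivity
    calc e = e ^ (1 - 1 / α) * e ^ (1 / α) := this
      _ ≤ hi ^ (1 - 1 / α) * e ^ (1 / α) := by gcongr
      _ = _ := by field_simp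
  · refine le_trans ?_ c4
    have : 0 ≤ 1 - xz α := by linarith
    gcongr
  · intro e l ew l0 hel
    by_contra hlt
    push Not at hlt
    have q1 : wlo ^ (2 * α) ≤ C1 α * ((1 - xz α) ^ (((1 + α) / 2) ^ (b - 1))) ^ (α - 1) := by
      calc wlo ^ (2 * α) ≤ wlo ^ a := by
            rw [← Real.rpow_natCast]
            exact Real.rpow_le_rpow_of_exponent_ge wlo0 wlo1 (by linarith)
        _ ≤ e ^ a := by gcongr
        _ ≤ _ := hel
        _ ≤ _ := by gcongr
    have zp : 0 < 1 - xz α := by linarith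
    have q2 := Real.log_le_log (by positivity) q1
    rw [Real.log_mul C0.ne' (by positivity), Real.log_rpow wlo0, Real.log_rpow (by positivity),
      Real.log_rpow zp, hwlo, Real.log_rpow w0, Real.log_mul (by norm_num) (by positivity),
      Real.log_rpow α0] at q2
    have q3 : ((1 + α) / 2) ^ (N - 1) ≤ ((1 + α) / 2) ^ (b - 1) := by
      rw [← Real.rpow_natCast]
      apply Real.rpow_le_rpow_of_exponent_le (by linarith)
      rw [Nat.cast_sub h2]; push_cast; linarith
    have q4 : 0 < -Real.log (1 - xz α) := by
      have := Real.log_neg zp (by linarith)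
      linarith
    have q5 : (α - 1) * (-Real.log (1 - xz α)) * ((1 + α) / 2) ^ (N - 1) ≤
        (α - 1) * (-Real.log (1 - xz α)) * ((1 + α) / 2) ^ (b - 1) := by gcongr
    have q6 : 2 * α * (-1 / (α - 1) * (Real.log 64 + 2 * N * Real.log α)) =
      - ((2 * α / (α - 1)) * (Real.log 64 + 2 * N * Real.log α)) := by ring
    rw [q6] at q2
    linarith
  · intro e el eh
    have e0 : 0 < e := lo0.trans_le el
    have : e ^ a = e ^ (α - 1) * e ^ ((a : ℝ) - (α - 1)) := by
      rw [← Real.rpow_add e0, ← Real.rpow_natCast]; congr 1; ring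
    rw [this]
    have q1 : α ^ (-N / α * (α - σ)) ≤ e ^ ((a : ℝ) - (α - 1)) := by
      rw [Real.rpow_mul α0.le]
      calc (α ^ (-N / α)) ^ (α - σ) ≤ (α ^ (-N / α)) ^ ((a : ℝ) - (α - 1)) := by
            apply Real.rpow_le_rpow_of_exponent_ge lo0 (by linarith) (by linarith)
        _ ≤ _ := by
            apply Real.rpow_le_rpow lo0.le el
            linarith [hσ.1]
    have q2 : A ≤ α ^ b * α ^ (-N / α * (α - σ)) := by
      rw [hA, ← Real.rpow_natCast, ← Real.rpow_add α0]
      apply Real.rpow_le_rpow_of_exponent_le hα.le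
      have : -N / α * (α - σ) = -N + N * σ / α := by field_simp; ring
      linarith
    calc A * e ^ (α - 1) ≤ (α ^ b * e ^ ((a : ℝ) - (α - 1))) * e ^ (α - 1) := by
          gcongr
          exact q2.trans (by gcongr)
      _ = _ := by ring
  · intro r l r0 l0 h
    by_contra hlt
    push Not at hlt
    have q1 : (hi * l) ^ α < r ^ α := Real.rpow_lt_rpow (by positivity) hlt α0
    rw [Real.mul_rpow hi0.le l0.le] at q1
    have q2 : A * hi ^ α = θ' ^ α := by
      rw [hA, hhi, Real.mul_rpow hθ'.le (by positivity), ← Real.rpow_mul α0.le]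
      rw [mul_left_comm, ← Real.rpow_add α0]
      have : N * σ / α + -N * σ / α ^ 2 * α = 0 := by field_simp; ring
      rw [this]; simp
    have q3 : A * (hi ^ α * l ^ α) < A * r ^ α := by gcongr
    have q4 : 256 * C1 α * l ^ α ≤ A * (hi ^ α * l ^ α) := by
      rw [← mul_assoc, q2]; gcongr
    linarith
  · intro e l e0 eh l0 h
    by_contra hlt
    push Not at hlt
    have q1 : (η / 8 * e) ^ (α - 1) < l ^ (α - 1) :=
      Real.rpow_lt_rpow (by positivity) (by linarith) a1
    rw [Real.mul_rpow (by positivity) e0.le] at q1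
    have q2 : 8 * (8 * e) ^ a ≤ 8 * 8 ^ (2 * α) * hi ^ σ * e ^ (α - 1) := by
      rw [mul_pow]
      have := nat_rpow_bound (x := 8) (by norm_num) a2
      have := pow_split e0 eh (by linarith) hσ.1 h3
      calc 8 * (8 ^ a * e ^ a) ≤ 8 * (8 ^ (2 * α) * (e ^ (α - 1) * hi ^ σ)) := by gcongr
        _ = _ := by ring
    have q3 : 8 * 8 ^ (2 * α) * hi ^ σ * e ^ (α - 1) ≤ (η / 8) ^ (α - 1) * e ^ (α - 1) := by
      gcongr
    linarith
  · intro e r e0 r0 h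
    by_contra hlt
    push Not at hlt
    have q1 : r ^ (α - 1) < (wlo * e) ^ (α - 1) := Real.rpow_lt_rpow r0.le hlt a1
    rw [Real.mul_rpow wlo0.le e0.le] at q1
    have q2 : wlo ^ (α - 1) = (64 * α ^ (2 * N))⁻¹ := by
      rw [hwlo, ← Real.rpow_mul w0.le, div_mul_cancel₀ _ a1.ne', Real.rpow_neg_one]
    have q3 : α ^ b ≤ α ^ (2 * N) := by
      rw [← Real.rpow_natCast]
      exact Real.rpow_le_rpow_of_exponent_le hα.le b2
    have : e ^ (α - 1) < e ^ (α - 1) := by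
      calc e ^ (α - 1) ≤ 64 * α ^ b * r ^ (α - 1) := h
        _ < 64 * α ^ b * (wlo ^ (α - 1) * e ^ (α - 1)) := by gcongr
        _ ≤ 64 * α ^ (2 * N) * (wlo ^ (α - 1) * e ^ (α - 1)) := by gcongr
        _ = _ := by rw [q2]; field_simp
    exact lt_irrefl _ this
  · intro e l r e0 eh l0 r0 h
    by_contra hlt
    push Not at hlt
    have q1 : r ^ α < (α ^ (-N / α) * (2 * l)) ^ α := Real.rpow_lt_rpow r0.le hlt α0
    rw [Real.mul_rpow lo0.le (by positivity), Real.mul_rpow (by norm_num) l0.le,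
      ← Real.rpow_mul α0.le, div_mul_cancel₀ _ α0.ne'] at q1
    have q2 := nat_rpow_bound (x := 8) (by norm_num) a2
    have q3 := pow_split e0 eh (by linarith) hσ.1 h3
    have q4 : α ^ b ≤ α ^ ((1 + (σ / α) ^ 2 - β) * N) := by
      rw [← Real.rpow_natCast]
      exact Real.rpow_le_rpow_of_exponent_le hα.le h6
    have q5 : hi ^ σ = θ' ^ σ * α ^ (-N * σ / α ^ 2 * σ) := by
      rw [hhi, Real.mul_rpow hθ'.le (by positivity), ← Real.rpow_mul α0.le]
    have q6 : α ^ (-N * σ / α ^ 2 * σ) * α ^ ((1 + (σ / α) ^ 2 - β) * N) * α ^ (-N) =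
        α ^ (-β * N) := by
      rw [← Real.rpow_add α0, ← Real.rpow_add α0]; congr 1; field_simp; ring
    have ep : 0 < e ^ (α - 1) := by positivity
    have lp : 0 < l ^ α := by positivity
    have : l ^ α * e ^ (α - 1) < l ^ α * e ^ (α - 1) := by
      calc l ^ α * e ^ (α - 1) ≤ 1024 * 8 ^ a * e ^ a * α ^ b * r ^ α := h
        _ < 1024 * 8 ^ a * e ^ a * α ^ b * (α ^ (-N) * (2 ^ α * l ^ α)) := by gcongr
        _ ≤ 1024 * 8 ^ (2 * α) * (e ^ (α - 1) * hi ^ σ) * α ^ ((1 + (σ / α) ^ 2 - β) * N) *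
            (α ^ (-N) * (2 ^ α * l ^ α)) := by gcongr
        _ = (1024 * 8 ^ (2 * α) * 2 ^ α * θ' ^ σ * (α ^ (-N * σ / α ^ 2 * σ) *
            α ^ ((1 + (σ / α) ^ 2 - β) * N) * α ^ (-N))) * (l ^ α * e ^ (α - 1)) := by
            rw [q5]; ring
        _ ≤ 1 * (l ^ α * e ^ (α - 1)) := by rw [q6]; gcongr
        _ = _ := one_mul _
    exact lt_irrefl _ this
end LW

namespace LW

lemma dec1 {d : ℝ} (hd : 0 < d) (s C ε : ℝ) (hε : 0 < ε) :
    ∀ᶠ N : ℝ in atTop, C * (N ^ s * Real.exp (-d * N)) < ε := by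
  have := (tendsto_rpow_mul_exp_neg_mul_atTop_nhds_zero s d hd).const_mul C
  rw [mul_zero] at this
  exact this.eventually (eventually_lt_nhds hε)

lemma par_ev {α σ β θ : ℝ} (hα : 1 < α) (hσ : σ ∈ Ioo (0:ℝ) 1)
    (hβ : β ∈ Ioo (0 : ℝ) ((σ / α) ^ 2)) (hθ : 0 < θ) (hθC : 256 * C1 α ≤ θ ^ α) :
    ∀ᶠ N : ℝ in atTop, ∃ η κ wlo ρ A : ℝ, κ = Real.exp (4 * (1 / N) ^ 2) * (1 + η) ∧ 0 ≤ η ∧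
      20 ≤ N ∧ ∀ a b : ℕ, 1 ≤ b → α + σ ≤ (a:ℝ) + 1 → (a:ℝ) + 1 ≤ 2 * α - σ → N ≤ b →
      (b:ℝ) ≤ (1 + (σ / α) ^ 2 - β) * N →
      Par α (Real.exp (4 * (1 / N) ^ 2)) η κ (α ^ (-N / α)) (θ * α ^ (-N * σ / α ^ 2)) wlo ρ A a b := by
  have α0 : 0 < α := by linarith
  have L0 : 0 < Real.log α := Real.log_pos hα
  have s0 := hσ.1
  have b0 := hβ.1
  obtain ⟨d, hd⟩ : ∃ d, d = Real.log α * (σ / α ^ 2) := ⟨_, rfl⟩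
  have d0 : 0 < d := by rw [hd]; positivity
  have hie : ∀ N : ℝ, α ^ (-N * σ / α ^ 2) = Real.exp (-d * N) := by
    intro N; rw [Real.rpow_def_of_pos α0, hd]; congr 1; ring
  have r0 : 0 < 1 - 1 / α := by rw [sub_pos, div_lt_one α0]; exact hα
  have z1 := xz_le hα
  have z0 := xz_pos α
  have lz : 0 < -Real.log (1 - xz α) := by
    have := Real.log_neg (x := 1 - xz α) (by linarith) (by linarith)
    linarith
  have a1 : 0 < α - 1 := by linarith
  have g0 : 0 < Real.log ((1 + α) / 2) := Real.log_pos (by linarith)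
  have t4 : ∀ᶠ N : ℝ in atTop,
      Real.exp (10 * (1 / N) ^ 2) * (1 - xz α) ^ ((α - 1) / 2) < 1 := by
    have h1 : Tendsto (fun N : ℝ => Real.exp (10 * (1 / N) ^ 2) * (1 - xz α) ^ ((α - 1) / 2)) atTop
        (𝓝 (Real.exp (10 * 0 ^ 2) * (1 - xz α) ^ ((α - 1) / 2))) := by
      apply Tendsto.mul_const
      apply (Real.continuous_exp.tendsto _).comp
      apply Tendsto.const_mul
      apply Tendsto.pow
      exact tendsto_const_nhds.div_atTop tendsto_id
    refine h1.eventually (eventually_lt_nhds ?_)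
    have := Real.rpow_lt_one (x := 1 - xz α) (by linarith) (by linarith) (half_pos a1)
    simpa using this
  have g6 : ∀ᶠ N : ℝ in atTop, 256 * C1 α < α ^ (N * σ / α) := by
    have : Tendsto (fun N : ℝ => Real.exp ((Real.log α * (σ / α)) * N)) atTop atTop :=
      Real.tendsto_exp_atTop.comp (tendsto_id.const_mul_atTop (by positivity))
    filter_upwards [this.eventually_gt_atTop (256 * C1 α)] with N h
    rw [Real.rpow_def_of_pos α0, show Real.log α * (N * σ / α) = (Real.log α * (σ / α)) * N by ring]
    exact h
  set X := Real.log (C1 α) + (2 * α / (α - 1)) * Real.log 64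
  set Y := (2 * α / (α - 1)) * (2 * Real.log α)
  set D := (α - 1) * (-Real.log (1 - xz α)) * Real.exp (-Real.log ((1 + α) / 2)) with hD
  have D0 : 0 < D := by positivity
  filter_upwards [eventually_ge_atTop 320, dec1 d0 1 (4 * θ) (1/8) (by norm_num),
    dec1 (d := d * (1 - 1 / α)) (by positivity) 1 (2 * (8 ^ (1/α) * θ ^ (1 - 1/α))) (1/8) (by norm_num),
    dec1 d0 0 θ (1/16) (by norm_num), dec1 d0 0 (8 * α * θ) 1 (by norm_num), t4, g6,
    dec1 g0 0 X (D/2) (by positivity), dec1 g0 1 Y (D/2) (by positivity),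
    dec1 (d := d * σ) (by positivity) (2 * (α - 1)) (8 * 8 ^ (2*α) * θ ^ σ * 8 ^ (α - 1)) 1 (by norm_num),
    dec1 (d := Real.log α * β) (by positivity) 0 (1024 * 8 ^ (2 * α) * 2 ^ α * θ ^ σ) 1 (by norm_num)]
    with N n0 n1 n2 n3 n4 n5 n6 n7 n8 n9 n10
  have N0 : 0 < N := by linarith
  refine ⟨(1/N)^2, Real.exp (4 * (1 / N) ^ 2) * (1 + (1/N)^2), (64 * α ^ (2 * N)) ^ (-1 / (α - 1)),
    8 ^ (1 / α) * (θ * α ^ (-N * σ / α ^ 2)) ^ (1 - 1 / α), α ^ (N * σ / α), rfl, by positivity, by linarith, fun a b h2 h3 h4 h5 h6 => ?_⟩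
  rw [Real.rpow_one] at n1 n2 n8
  rw [Real.rpow_zero, one_mul] at n3 n4 n7 n10
  have er : (θ * α ^ (-N * σ / α ^ 2)) ^ (1 - 1 / α) = θ ^ (1 - 1/α) * Real.exp (-(d * (1 - 1 / α)) * N) := by
    rw [hie, Real.mul_rpow hθ.le (Real.exp_pos _).le, ← Real.exp_mul]; congr 2; ring
  have es : (θ * α ^ (-N * σ / α ^ 2)) ^ σ = θ ^ σ * Real.exp (-(d * σ) * N) := by
    rw [hie, Real.mul_rpow hθ.le (Real.exp_pos _).le, ← Real.exp_mul]; congr 2; ring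
  refine par_core hα hσ hβ hθ hθC (by linarith) rfl rfl rfl rfl rfl rfl rfl ?_ ?_ ?_ n5.le ?_ n6 ?_ ?_
    h2 h3 h4 h5 h6
  · rw [er, hie]
    have : 40 / N ≤ 1/8 := by rw [div_le_iff₀ N0]; linarith
    linarith
  · rw [hie]; exact n3.le
  · rw [hie]; linarith
  · have : ((1 + α) / 2) ^ (N - 1) = Real.exp (-Real.log ((1 + α) / 2)) *
        Real.exp (Real.log ((1 + α) / 2) * N) := by
      rw [Real.rpow_def_of_pos (by linarith), ← Real.exp_add]; congr 1; ring
    rw [this, ← mul_assoc, ← hD]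
    have h : (X + Y * N) * Real.exp (-Real.log ((1 + α) / 2) * N) < D := by linarith
    have e := Real.exp_pos (Real.log ((1 + α) / 2) * N)
    have h' := mul_lt_mul_of_pos_right h e
    rw [mul_assoc, ← Real.exp_add, show -Real.log ((1 + α) / 2) * N + Real.log ((1 + α) / 2) * N = 0
      by ring, Real.exp_zero, mul_one] at h'
    refine lt_of_eq_of_lt ?_ h'
    simp only [X, Y]; ring
  · rw [es]
    have e1 : ((1 / N) ^ 2 / 8) ^ (α - 1) = (N ^ (2 * (α - 1)) * 8 ^ (α - 1))⁻¹ := by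
      rw [Real.rpow_mul N0.le, ← Real.mul_rpow (by positivity) (by norm_num),
        ← Real.inv_rpow (by positivity)]
      congr 1
      rw [Real.rpow_two]; field_simp
    rw [e1, ← one_div, le_div_iff₀ (by positivity)]
    linarith
  · have : α ^ (-β * N) = Real.exp (-(Real.log α * β) * N) := by
      rw [Real.rpow_def_of_pos α0]; congr 1; ring
    rw [this]; exact n10.le

lemma par_exists {α σ β θ : ℝ} (hα : 1 < α) (hσ : σ ∈ Ioo (0:ℝ) 1)
    (hβ : β ∈ Ioo (0 : ℝ) ((σ / α) ^ 2)) (hθ : 1 < θ) :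
    ∃ b0 : ℕ, ∀ bb : ℕ, b0 ≤ bb → ∃ η κ hi wlo ρ A : ℝ, Real.exp ((1 / (bb:ℝ)) ^ 2) ≤ κ ∧
      θ * α ^ (-(bb:ℝ) * σ / α ^ 2) ≤ hi ∧ ∀ a b : ℕ, memOmega α σ β bb (a, b) →
      2 ≤ b ∧ Par α (Real.exp (4 * (1 / (bb:ℝ)) ^ 2)) η κ (α ^ (-(bb:ℝ) / α)) hi wlo ρ A a b := by
  have C0 := C1_pos hα
  have α0 : 0 < α := by linarith
  obtain ⟨θ', h1, h2⟩ : ∃ θ' : ℝ, θ ≤ θ' ∧ 256 * C1 α ≤ θ' ^ α := by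
    refine ⟨max θ ((256 * C1 α) ^ (1 / α)), le_max_left _ _, ?_⟩
    calc 256 * C1 α = ((256 * C1 α) ^ (1 / α)) ^ α := by
          rw [← Real.rpow_mul (by positivity)]; field_simp; simp
      _ ≤ _ := Real.rpow_le_rpow (by positivity) (le_max_right _ _) α0.le
  have := tendsto_natCast_atTop_atTop.eventually (par_ev hα hσ hβ (by linarith) h2)
  obtain ⟨b0, hb⟩ := eventually_atTop.1 this
  refine ⟨b0, fun bb hbb => ?_⟩
  obtain ⟨η, κ, wlo, ρ, A, k1, k2, k3, k4⟩ := hb bb hbb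
  refine ⟨η, κ, _, wlo, ρ, A, ?_, mul_le_mul_of_nonneg_right h1 (by positivity), fun a b hm => ?_⟩
  · rw [k1]
    have : Real.exp ((1 / (bb:ℝ)) ^ 2) ≤ Real.exp (4 * (1 / (bb:ℝ)) ^ 2) :=
      Real.exp_le_exp.2 (by nlinarith [sq_nonneg (1 / (bb:ℝ))])
    nlinarith [Real.exp_pos (4 * (1 / (bb:ℝ)) ^ 2)]
  · obtain ⟨_, m2, m3, m4, m5, m6⟩ := hm
    refine ⟨?_, k4 a b m2 m3 m4 m5 m6⟩
    have : (2:ℝ) ≤ b := by linarith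
    exact_mod_cast this
end LW

namespace LW

section
variable {fl fr : ℝ → ℝ} {c p q p' q' : ℝ} {a b a' b' : ℕ}

lemma Comb.L (C : Comb fl fr c a b p q) (P : Pair fl fr c) : ∀ i ≤ a,
    ContinuousOn (fun x => fr^[i] (fl x)) (Icc p c) ∧ StrictMonoOn (fun x => fr^[i] (fl x)) (Icc p c) ∧
    (i < a → ∀ x ∈ Icc p c, fr^[i] (fl x) ∈ Ico q 1) := by
  have hp : p ∈ Icc p c := ⟨le_rfl, C.pc.le⟩
  have hc : c ∈ Icc p c := ⟨C.pc.le, le_rfl⟩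
  have rng : ∀ i < a, StrictMonoOn (fun x => fr^[i] (fl x)) (Icc p c) →
      ∀ x ∈ Icc p c, fr^[i] (fl x) ∈ Ico q 1 := fun i hi m x hx =>
    ⟨(C.Lp i hi).1.trans (m.monotoneOn hp hx hx.1), (m.monotoneOn hx hc hx.2).trans_lt (C.Lc i hi).2⟩
  have sub : Icc p c ⊆ Icc 0 c := Icc_subset_Icc_left C.p0.le
  intro i
  induction i with
  | zero => intro hi; exact ⟨P.cL.mono sub, P.mL.mono sub, fun h => rng 0 h (P.mL.mono sub)⟩
  | succ i ih =>
    intro hi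
    obtain ⟨h1, h2, h3⟩ := ih (by omega)
    have h3 := h3 (by omega)
    have mp : MapsTo (fun x => fr^[i] (fl x)) (Icc p c) (Icc c 1) := fun x hx =>
      ⟨C.cq.le.trans (h3 x hx).1, (h3 x hx).2.le⟩
    have e : (fun x => fr^[i + 1] (fl x)) = fr ∘ (fun x => fr^[i] (fl x)) := by
      funext x; simp [Function.iterate_succ_apply']
    have m : StrictMonoOn (fun x => fr^[i + 1] (fl x)) (Icc p c) := e ▸ P.mR.comp h2 mp
    exact ⟨e ▸ P.cR.comp h1 mp, m, fun h => rng _ h m⟩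

lemma Comb.R (C : Comb fl fr c a b p q) (P : Pair fl fr c) : ∀ i ≤ b,
    ContinuousOn (fun x => fl^[i] (fr x)) (Icc c q) ∧ StrictMonoOn (fun x => fl^[i] (fr x)) (Icc c q) ∧
    (i < b → ∀ x ∈ Icc c q, fl^[i] (fr x) ∈ Ioc 0 p) := by
  have hq : q ∈ Icc c q := ⟨C.cq.le, le_rfl⟩
  have hc : c ∈ Icc c q := ⟨le_rfl, C.cq.le⟩
  have rng : ∀ i < b, StrictMonoOn (fun x => fl^[i] (fr x)) (Icc c q) →
      ∀ x ∈ Icc c q, fl^[i] (fr x) ∈ Ioc 0 p := fun i hi m x hx =>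
    ⟨(C.Rc i hi).1.trans_le (m.monotoneOn hc hx hx.1), (m.monotoneOn hx hq hx.2).trans (C.Rq i hi).2⟩
  have sub : Icc c q ⊆ Icc c 1 := Icc_subset_Icc_right C.q1.le
  intro i
  induction i with
  | zero => intro hi; exact ⟨P.cR.mono sub, P.mR.mono sub, fun h => rng 0 h (P.mR.mono sub)⟩
  | succ i ih =>
    intro hi
    obtain ⟨h1, h2, h3⟩ := ih (by omega)
    have h3 := h3 (by omega)
    have mp : MapsTo (fun x => fl^[i] (fr x)) (Icc c q) (Icc 0 c) := fun x hx =>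
      ⟨(h3 x hx).1.le, (h3 x hx).2.trans C.pc.le⟩
    have e : (fun x => fl^[i + 1] (fr x)) = fl ∘ (fun x => fl^[i] (fr x)) := by
      funext x; simp [Function.iterate_succ_apply']
    have m : StrictMonoOn (fun x => fl^[i + 1] (fr x)) (Icc c q) := e ▸ P.mL.comp h2 mp
    exact ⟨e ▸ P.cL.comp h1 mp, m, fun h => rng _ h m⟩

lemma cross_ab (P : Pair fl fr c) (C : Comb fl fr c a b p q) (C' : Comb fl fr c a' b' p' q')
    (hp : p ≤ p') (hq : q ≤ q') : a = a' ∧ b = b' := by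
  have pc := C'.pc
  have cq := C.cq
  constructor
  · rcases lt_trichotomy a a' with h | h | h
    · have h1 := (C.L P a le_rfl).2.1 (⟨hp, pc.le⟩ : p' ∈ Icc p c) ⟨hp.trans pc.le, le_rfl⟩ pc
      have h2 := (C'.Lp a h).1
      have := C.Ld.2
      simp only at h1; linarith
    · exact h
    · have := ((C.L P a' h.le).2.2 h p' ⟨hp, pc.le⟩).1
      rw [C'.Lr] at this; linarith
  · rcases lt_trichotomy b b' with h | h | h
    · have := ((C'.R P b h.le).2.2 h q ⟨cq.le, hq⟩).2
      rw [C.Rr] at this; linarith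
    · exact h
    · have h1 := (C'.R P b' le_rfl).2.1 (⟨le_rfl, cq.le.trans hq⟩ : c ∈ Icc c q') ⟨cq.le, hq⟩ cq
      have h2 := (C.Rq b' h).2
      have := C'.Rd.1
      simp only at h1; linarith

lemma cross_un (P : Pair fl fr c) (C : Comb fl fr c a b p q) (C' : Comb fl fr c a b p' q')
    (hp : p < p') (hq : q < q') (hb : 2 ≤ b) :
    (∀ i < a, q' ≤ fr^[i] (fl p)) ∧ (∀ j < b, fl^[j] (fr q') ≤ p) := by
  have pc := C'.pc
  have cq := C.cq
  have q1 := C'.q1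
  have p0 := C.p0
  have A1 : ∀ i < a, q' ≤ fr^[i] (fl p) := by
    intro i hi
    by_contra! h
    have h1 := (C.Lp i hi).1
    have h2 := P.mR (⟨by linarith, by linarith⟩ : _ ∈ Icc c 1) ⟨by linarith, q1.le⟩ h
    have h3 := C'.Rq 0 (by omega)
    simp only [Function.iterate_zero, id] at h3
    rw [← Function.iterate_succ_apply' fr] at h2
    by_cases hi' : i + 1 < a
    · have := (C.Lp (i+1) hi').1
      simp only [Nat.succ_eq_add_one] at h2
      linarith [h3.2]
    · have e : i + 1 = a := by omega
      rw [Nat.succ_eq_add_one, e, C.Lr] at h2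
      have h4 := P.mL (⟨by linarith, by linarith⟩ : p ∈ Icc 0 c) ⟨by linarith, by linarith [h3.2]⟩ h2
      have h5 := (C'.Rq 1 (by omega)).2
      have h6 := (C.Lp 0 (by omega)).1
      simp only [Function.iterate_one, Function.iterate_zero, id] at h5 h6
      linarith
  refine ⟨A1, fun j hj => ?_⟩
  by_contra! h
  have h1 := (C'.Rq j hj).2
  have h2 := P.mL (⟨by linarith, by linarith⟩ : p ∈ Icc 0 c) ⟨by linarith, by linarith⟩ h
  rw [← Function.iterate_succ_apply' fl] at h2
  have h3 := A1 0 C.ha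
  simp only [Function.iterate_zero, id] at h3
  by_cases hj' : j + 1 < b
  · have := (C'.Rq (j+1) hj').2
    simp only [Nat.succ_eq_add_one] at h2
    linarith
  · have e : j + 1 = b := by omega
    rw [Nat.succ_eq_add_one, e, C'.Rr] at h2
    linarith
end

section
variable {α : ℝ} {f g g' : LorenzMap α} {a b a' b' : ℕ} {p q p' q' : ℝ}

lemma orbL (h : ReturnCond f a b p q) : ∀ x ∈ Ioo p f.c, ∀ i ≤ a,
    f.toFun^[i + 1] x = (rb f)^[i] (lb f x) := by
  obtain ⟨ha, hb, hp, hpc, hcq, hq, -, hL, hR⟩ := h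
  exact orbit_eq (fun x hx => toFun_lt f hx.2) (fun x hx => toFun_ge f hx.1.le) hp
    (fun x hx i h1 h2 => ((hL x hx).1 i h1 h2).1)

lemma orbR (h : ReturnCond f a b p q) : ∀ x ∈ Ioo f.c q, ∀ i ≤ b,
    f.toFun^[i + 1] x = (lb f)^[i] (rb f x) := by
  obtain ⟨ha, hb, hp, hpc, hcq, hq, -, hL, hR⟩ := h
  intro x hx i
  induction i with
  | zero => intro _; simp [toFun_ge f hx.1.le]
  | succ i ih =>
    intro hi
    rw [Function.iterate_succ_apply', Function.iterate_succ_apply' (lb f), ← ih (by omega)]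
    exact toFun_lt f ((hR x hx).1 (i + 1) (by omega) hi).1.2

lemma no_cross (P : Pair (lb f) (rb f) f.c) (h : IsMaxReturnInterval f a b p q)
    (h' : ReturnCond f a' b' p' q') (C : Comb (lb f) (rb f) f.c a b p q)
    (C' : Comb (lb f) (rb f) f.c a' b' p' q') (hp : p < p') (hq : q < q') (hb : 2 ≤ b) : False := by
  obtain ⟨rfl, rfl⟩ := cross_ab P C C' hp.le hq.le
  obtain ⟨u1, u2⟩ := cross_un P C C' hp hq hb
  have oL := orbL h.1
  have oR := orbR h'
  obtain ⟨ha, hb, hp0, hpc, hcq, hq1, -, hL, hR⟩ := h.1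
  obtain ⟨ha', hb', hp0', hpc', hcq', hq1', -, hL', hR'⟩ := h'
  have : ReturnCond f a b p q' := by
    refine ⟨ha, hb, hp0, hpc, hcq', hq1', Or.inl C.p0, fun x hx => ⟨fun i i1 i2 => ?_, ?_⟩,
      fun x hx => ⟨fun i i1 i2 => ?_, ?_⟩⟩
    · refine ⟨((hL x hx).1 i i1 i2).1, fun hm => ?_⟩
      obtain ⟨k, rfl⟩ : ∃ k, i = k + 1 := ⟨i - 1, by omega⟩
      rw [oL x hx k (by omega)] at hm
      have m := (C.L P k (by omega)).2.1 (⟨le_rfl, hpc.le⟩ : p ∈ Icc p f.c) ⟨hx.1.le, hx.2.le⟩ hx.1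
      have := u1 k (by omega)
      simp only at m
      linarith [hm.2]
    · exact ⟨(hL x hx).2.1, (hL x hx).2.2.trans hq⟩
    · refine ⟨((hR' x hx).1 i i1 i2).1, fun hm => ?_⟩
      obtain ⟨k, rfl⟩ : ∃ k, i = k + 1 := ⟨i - 1, by omega⟩
      rw [oR x hx k (by omega)] at hm
      have m := (C'.R P k (by omega)).2.1 (⟨hx.1.le, hx.2.le⟩ : x ∈ Icc f.c q') ⟨hcq'.le, le_rfl⟩ hx.2
      have := u2 k (by omega)
      simp only at m
      linarith [hm.1]
    · exact ⟨hp.trans (hR' x hx).2.1, (hR' x hx).2.2⟩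
  have := (h.2 _ _ _ _ this (Ioo_subset_Ioo_right hq.le)).2
  linarith

lemma renorm_uniq (hα : 1 < α) (h : RenormOf f a b g) (h' : RenormOf f a' b' g') (hb : 2 ≤ b) :
    a = a' ∧ b = b' := by
  obtain ⟨p, q, hm, e1, e2, e3, e4⟩ := h
  obtain ⟨p', q', hm', e1', e2', e3', e4'⟩ := h'
  obtain ⟨P, -, C, -⟩ := comb_of_interval hα f g hm.1 e1 e2 e3 e4
  obtain ⟨-, -, C', -⟩ := comb_of_interval hα f g' hm'.1 e1' e2' e3' e4'
  rcases lt_or_ge p p' with h1 | h1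
  · rcases lt_or_ge q q' with h2 | h2
    · exact (no_cross P hm hm'.1 C C' h1 h2 hb).elim
    · have := hm'.2 _ _ _ _ hm.1 (Ioo_subset_Ioo h1.le h2)
      exact cross_ab P C C' this.1.ge this.2.ge
  · rcases lt_or_ge q' q with h2 | h2
    · rcases h1.lt_or_eq with h1 | h1
      · have := cross_ab P C' C h1.le h2.le
        exact (no_cross P hm' hm.1 C' C h1 h2 (by omega)).elim
      · exact absurd (hm'.2 _ _ _ _ hm.1 (Ioo_subset_Ioo h1.ge h2.le)).2 h2.ne
    · have := hm.2 _ _ _ _ hm'.1 (Ioo_subset_Ioo h1 h2)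
      exact cross_ab P C C' this.1.le this.2.le

lemma renormOp_spec (hα : 1 < α) (h : MonRenormalizable f a b) (hb : 2 ≤ b) :
    RenormOf f a b (renormOp α f) := by
  obtain ⟨g, hg⟩ := h
  have ex : ∃ g : LorenzMap α, ∃ a b : ℕ, RenormOf f a b g := ⟨g, a, b, hg⟩
  have e : renormOp α f = ex.choose := by rw [renormOp, dif_pos ex]
  obtain ⟨a', b', hs⟩ := ex.choose_spec
  obtain ⟨rfl, rfl⟩ := renorm_uniq hα hg hs hb
  rw [e]; exact hs
end
end LW

namespace LW

def Adm (T : ℝ → ℝ) (d0 y0 y1 d1 x0 x1 : ℝ) : Prop :=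
  ∃ (e0 e1 : ℝ) (F : ℝ → ℝ) (n : ℕ), e0 < x0 ∧ x0 ≤ x1 ∧ x1 < e1 ∧ StrictMonoOn F (Icc e0 e1) ∧
    ContinuousOn F (Icc e0 e1) ∧ QCR 1 F e0 e1 ∧ F e0 = d0 ∧ F x0 = y0 ∧ F x1 = y1 ∧ F e1 = d1 ∧
    ∀ x ∈ Icc x0 x1, F x = T^[n] x

section
variable {T G : ℝ → ℝ} {d0 y0 y1 d1 x0 x1 p q c : ℝ}

lemma Adm.le (h : Adm T d0 y0 y1 d1 x0 x1) : x0 ≤ x1 := by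
  obtain ⟨e0, e1, F, n, h1, h2, h3, -⟩ := h
  exact h2

lemma Adm.step (h : Adm T d0 y0 y1 d1 x0 x1) (mG : StrictMonoOn G (Icc d0 d1))
    (cG : ContinuousOn G (Icc d0 d1)) (qG : QCR 1 G d0 d1) (hG : ∀ y ∈ Icc y0 y1, T y = G y) :
    Adm T (G d0) (G y0) (G y1) (G d1) x0 x1 := by
  obtain ⟨e0, e1, F, n, h1, h2, h3, mF, cF, qF, rfl, rfl, rfl, rfl, hF⟩ := h
  have le : e0 ≤ e1 := by linarith
  have mp : MapsTo F (Icc e0 e1) (Icc (F e0) (F e1)) := fun x hx =>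
    ⟨mF.monotoneOn ⟨le_rfl, le⟩ hx hx.1, mF.monotoneOn hx ⟨le, le_rfl⟩ hx.2⟩
  refine ⟨e0, e1, fun x => G (F x), n + 1, h1, h2, h3, mG.comp mF mp, cG.comp cF mp,
    qF.comp qG mF mG mp, rfl, rfl, rfl, rfl, fun x hx => ?_⟩
  have mem : ∀ z, x0 ≤ z → z ≤ x1 → z ∈ Icc e0 e1 := fun z a b => ⟨by linarith, by linarith⟩
  rw [Function.iterate_succ_apply', ← hF x hx, hG]
  exact ⟨mF.monotoneOn (mem _ le_rfl h2) (mem _ hx.1 hx.2) hx.1,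
    mF.monotoneOn (mem _ hx.1 hx.2) (mem _ h2 le_rfl) hx.2⟩

lemma ivt {F : ℝ → ℝ} {a b y : ℝ} (hab : a ≤ b) (c : ContinuousOn F (Icc a b)) (h1 : F a ≤ y)
    (h2 : y ≤ F b) : ∃ x ∈ Icc a b, F x = y := intermediate_value_Icc hab c ⟨h1, h2⟩

lemma Adm.shrink (h : Adm T d0 y0 y1 d1 x0 x1) {d0' d1' : ℝ} (a1 : d0 ≤ d0') (a2 : d0' < y0)
    (a3 : y1 < d1') (a4 : d1' ≤ d1) : Adm T d0' y0 y1 d1' x0 x1 := by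
  obtain ⟨e0, e1, F, n, h1, h2, h3, mF, cF, qF, rfl, rfl, rfl, rfl, hF⟩ := h
  have s1 : Icc e0 x0 ⊆ Icc e0 e1 := Icc_subset_Icc_right (by linarith)
  have s2 : Icc x1 e1 ⊆ Icc e0 e1 := Icc_subset_Icc_left (by linarith)
  obtain ⟨u, hu, rfl⟩ := ivt h1.le (cF.mono s1) a1 a2.le
  obtain ⟨v, hv, rfl⟩ := ivt h3.le (cF.mono s2) a3.le a4
  have k1 : u < x0 := lt_of_le_of_ne hu.2 (fun e => by rw [e] at a2; exact lt_irrefl _ a2)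
  have k2 : x1 < v := lt_of_le_of_ne hv.1 (fun e => by rw [e] at a3; exact lt_irrefl _ a3)
  have s : Icc u v ⊆ Icc e0 e1 := Icc_subset_Icc hu.1 hv.2
  exact ⟨u, v, F, n, k1, h2, k2, mF.mono s, cF.mono s, qF.mono hu.1 hv.2, rfl, rfl, rfl, rfl, hF⟩

lemma Adm.split (h : Adm T d0 y0 y1 d1 x0 x1) (h0 : y0 ≤ p) (hpc : p < c) (hcq : c < q)
    (hq : q ≤ y1) {g : ℝ} (g0 : 0 < g) (hg0 : g ≤ y0 - d0) (hg1 : g ≤ d1 - y1) (hd0 : 0 ≤ d0)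
    (hd1 : d1 ≤ 1) : ∃ m0 m1, x0 ≤ m0 ∧ m0 < m1 ∧ m1 ≤ x1 ∧ Adm T d0 y0 p c x0 m0 ∧
      Adm T c q y1 d1 m1 x1 ∧ (∃ n, ∀ x ∈ Ioo m0 m1, T^[n] x ∈ Ioo p q) ∧
      g * (q - p) * (m0 - x0) ≤ m1 - m0 ∧ g * (q - p) * (x1 - m1) ≤ m1 - m0 := by
  obtain ⟨e0, e1, F, n, h1, h2, h3, mF, cF, qF, rfl, rfl, rfl, rfl, hF⟩ := h
  have s1 : Icc x0 x1 ⊆ Icc e0 e1 := Icc_subset_Icc (by linarith) (by linarith)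
  obtain ⟨m0, ⟨a1, a2⟩, rfl⟩ := ivt h2 (cF.mono s1) h0 (by linarith)
  obtain ⟨mc, ⟨b1, b2⟩, rfl⟩ := ivt h2 (cF.mono s1) (h0.trans hpc.le) (by linarith)
  obtain ⟨m1, ⟨c1, c2⟩, rfl⟩ := ivt h2 (cF.mono s1) (y := q) (by linarith) hq
  have M : ∀ z, x0 ≤ z → z ≤ x1 → z ∈ Icc e0 e1 := fun z a b => ⟨by linarith, by linarith⟩
  have l1 : m0 < mc := (mF.lt_iff_lt (M _ a1 a2) (M _ b1 b2)).1 hpc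
  have l2 : mc < m1 := (mF.lt_iff_lt (M _ b1 b2) (M _ c1 c2)).1 hcq
  have E0 : e0 ∈ Icc e0 e1 := ⟨le_rfl, by linarith⟩
  have E1 : e1 ∈ Icc e0 e1 := ⟨by linarith, le_rfl⟩
  have t1 : Icc e0 mc ⊆ Icc e0 e1 := Icc_subset_Icc_right (by linarith)
  have t2 : Icc mc e1 ⊆ Icc e0 e1 := Icc_subset_Icc_left (by linarith)
  have w : 0 < F m1 - F m0 := by linarith
  refine ⟨m0, m1, a1, l1.trans l2, c2,
    ⟨e0, mc, F, n, h1, a1, l1, mF.mono t1, cF.mono t1, qF.mono le_rfl (by linarith), rfl, rfl, rfl, rfl,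
      fun x hx => hF x ⟨hx.1, by linarith [hx.2]⟩⟩,
    ⟨mc, e1, F, n, l2, c2, h3, mF.mono t2, cF.mono t2, qF.mono (by linarith) le_rfl, rfl, rfl, rfl, rfl,
      fun x hx => hF x ⟨by linarith [hx.1], hx.2⟩⟩, ⟨n, fun x hx => ?_⟩, ?_, ?_⟩
  · have hx' : x0 ≤ x ∧ x ≤ x1 := ⟨by linarith [hx.1], by linarith [hx.2]⟩
    rw [← hF x hx']
    exact ⟨mF (M _ a1 a2) (M _ hx'.1 hx'.2) hx.1, mF (M _ hx'.1 hx'.2) (M _ c1 c2) hx.2⟩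
  · rcases a1.eq_or_lt with e | e
    · rw [← e]; simp; linarith
    · have k := qF e0 x0 m0 m1 le_rfl h1 e (l1.trans l2) (by linarith)
      have f1 : F m0 - F x0 ≤ 1 := by linarith
      have f2 : F m1 - F e0 ≤ 1 := by linarith
      have f3 : 0 ≤ F m0 - F x0 := by linarith
      have u1 : 0 < x0 - e0 := by linarith
      have u2 : 0 < m0 - x0 := by linarith
      have u3 : 0 < m1 - m0 := by linarith
      have b0 : 0 ≤ F x0 - F e0 := by linarith
      have L : (x0 - e0) * (g * (F m1 - F m0) * (m0 - x0)) ≤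
          (F x0 - F e0) * (F m1 - F m0) * ((m0 - x0) * (m1 - e0)) := by
        calc _ = g * (F m1 - F m0) * ((m0 - x0) * (x0 - e0)) := by ring
          _ ≤ _ := by gcongr <;> linarith
      have R : 1 * ((x0 - e0) * (m1 - m0) * ((F m0 - F x0) * (F m1 - F e0))) ≤
          (x0 - e0) * (m1 - m0) := by
        rw [one_mul]
        apply mul_le_of_le_one_right (by positivity)
        exact mul_le_one₀ f1 (by linarith) f2
      exact le_of_mul_le_mul_left (L.trans (k.trans R)) u1
  · rcases c2.eq_or_lt with e | e
    · rw [e]; simp; linarith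
    · have k := qF m0 m1 x1 e1 (by linarith) (l1.trans l2) e h3 le_rfl
      have f1 : F x1 - F m1 ≤ 1 := by linarith
      have f2 : F e1 - F m0 ≤ 1 := by linarith
      have f3 : 0 ≤ F x1 - F m1 := by linarith
      have u1 : 0 < e1 - x1 := by linarith
      have u2 : 0 < x1 - m1 := by linarith
      have u3 : 0 < m1 - m0 := by linarith
      have b0 : 0 ≤ F e1 - F x1 := by linarith
      have L : (e1 - x1) * (g * (F m1 - F m0) * (x1 - m1)) ≤
          (F m1 - F m0) * (F e1 - F x1) * ((x1 - m1) * (e1 - m0)) := by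
        calc _ = (F m1 - F m0) * g * ((x1 - m1) * (e1 - x1)) := by ring
          _ ≤ _ := by gcongr <;> linarith
      have R : 1 * ((m1 - m0) * (e1 - x1) * ((F x1 - F m1) * (F e1 - F m0))) ≤
          (e1 - x1) * (m1 - m0) := by
        rw [one_mul, mul_comm (m1 - m0)]
        apply mul_le_of_le_one_right (by positivity)
        exact mul_le_one₀ f1 (by linarith) f2
      exact le_of_mul_le_mul_left (L.trans (k.trans R)) u1
end

def TL (T : ℝ → ℝ) (fl fr : ℝ → ℝ) (c p q : ℝ) (j : ℕ) : ℝ → ℝ → Prop :=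
  Adm T (fl^[j] (fr c)) (fl^[j] (fr q)) p c
def TR (T : ℝ → ℝ) (fl fr : ℝ → ℝ) (c p q : ℝ) (i : ℕ) : ℝ → ℝ → Prop :=
  Adm T c q (fr^[i] (fl p)) (fr^[i] (fl c))

section
variable {T fl fr : ℝ → ℝ} {c p q x0 x1 g : ℝ} {a b : ℕ}

lemma TL_next (C : Comb fl fr c a b p q) (P : Pair fl fr c) (ql : QCR 1 fl 0 c)
    (hTl : ∀ x < c, T x = fl x) {j : ℕ} (hj : j < b) (h : TL T fl fr c p q j x0 x1) :
    Adm T (fl^[j+1] (fr c)) (fl^[j+1] (fr q)) (fl p) (fl c) x0 x1 := by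
  have r := C.Rc j hj
  have s : Icc (fl^[j] (fr c)) c ⊆ Icc 0 c := Icc_subset_Icc_left r.1.le
  have := Adm.step h (P.mL.mono s) (P.cL.mono s) (ql.mono r.1.le le_rfl)
    (fun y hy => hTl y (by linarith [hy.2, C.pc]))
  rw [Function.iterate_succ_apply', Function.iterate_succ_apply']
  exact this

lemma TR_next (C : Comb fl fr c a b p q) (P : Pair fl fr c) (qr : QCR 1 fr c 1)
    (hTr : ∀ x, c ≤ x → T x = fr x) {j : ℕ} (hj : j < a) (h : TR T fl fr c p q j x0 x1) :
    Adm T (fr c) (fr q) (fr^[j+1] (fl p)) (fr^[j+1] (fl c)) x0 x1 := by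
  have r := C.Lc j hj
  have s : Icc c (fr^[j] (fl c)) ⊆ Icc c 1 := Icc_subset_Icc_right r.2.le
  have := Adm.step h (P.mR.mono s) (P.cR.mono s) (qr.mono le_rfl r.2.le)
    (fun y hy => hTr y (by linarith [hy.1, C.cq]))
  rw [Function.iterate_succ_apply', Function.iterate_succ_apply']
  exact this

structure Gap (fl fr : ℝ → ℝ) (c p q : ℝ) (a b : ℕ) (g : ℝ) : Prop where
  g0 : 0 < g
  l : ∀ j < b, g ≤ fl^[j] (fr q) - fl^[j] (fr c)
  r : ∀ i < a, g ≤ fr^[i] (fl c) - fr^[i] (fl p)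

lemma fin_gap (u : ℕ → ℝ) : ∀ n, (∀ i < n, 0 < u i) → ∃ g > 0, ∀ i < n, g ≤ u i := by
  intro n
  induction n with
  | zero => intro _; exact ⟨1, one_pos, fun i hi => by omega⟩
  | succ n ih =>
    intro h
    obtain ⟨g, h1, h2⟩ := ih (fun i hi => h i (by omega))
    refine ⟨min g (u n), lt_min h1 (h n (by omega)), fun i hi => ?_⟩
    rcases Nat.lt_succ_iff_lt_or_eq.1 hi with e | rfl
    · exact (min_le_left _ _).trans (h2 i e)
    · exact min_le_right _ _

lemma gap_exists (C : Comb fl fr c a b p q) (P : Pair fl fr c) : ∃ g, Gap fl fr c p q a b g := by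
  obtain ⟨g1, h1, h2⟩ := fin_gap (fun j => fl^[j] (fr q) - fl^[j] (fr c)) b (fun j hj => by
    have := (C.R P j hj.le).2.1 (⟨le_rfl, C.cq.le⟩ : c ∈ Icc c q) ⟨C.cq.le, le_rfl⟩ C.cq
    simp only at this; linarith)
  obtain ⟨g2, h3, h4⟩ := fin_gap (fun j => fr^[j] (fl c) - fr^[j] (fl p)) a (fun j hj => by
    have := (C.L P j hj.le).2.1 (⟨le_rfl, C.pc.le⟩ : p ∈ Icc p c) ⟨C.pc.le, le_rfl⟩ C.pc
    simp only at this; linarith)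
  exact ⟨min g1 g2, lt_min h1 h3, fun j hj => (min_le_left _ _).trans (h2 j hj),
    fun j hj => (min_le_right _ _).trans (h4 j hj)⟩

/-- measure of the part of the exceptional set in an interval -/
def mu (E : Set ℝ) (x0 x1 : ℝ) : ℝ := volume.real (E ∩ Icc x0 x1)

lemma mu_fin (E : Set ℝ) (x0 x1 : ℝ) : volume (E ∩ Icc x0 x1) ≠ ⊤ :=
  ne_top_of_le_ne_top (by simp) (measure_mono inter_subset_right)

lemma mu_split {E : Set ℝ} {m0 m1 : ℝ} (hE : ∀ x ∈ Ioo m0 m1, x ∉ E) :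
    mu E x0 x1 ≤ mu E x0 m0 + mu E m1 x1 := by
  refine le_trans (measureReal_mono ?_ ?_) (measureReal_union_le _ _)
  · rintro x ⟨h1, h2⟩
    rcases le_or_gt x m0 with h | h
    · exact Or.inl ⟨h1, h2.1, h⟩
    · exact Or.inr ⟨h1, by by_contra! h'; exact hE x ⟨h, h'⟩ h1, h2.2⟩
  · exact measure_union_ne_top (mu_fin _ _ _) (mu_fin _ _ _)

def SS (T fl fr : ℝ → ℝ) (c p q : ℝ) (a b : ℕ) (E : Set ℝ) (ρ : ℝ) : Prop :=
  (∀ j < b, ∀ x0 x1, TL T fl fr c p q j x0 x1 → mu E x0 x1 ≤ ρ * (x1 - x0)) ∧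
  (∀ i < a, ∀ x0 x1, TR T fl fr c p q i x0 x1 → mu E x0 x1 ≤ ρ * (x1 - x0))

lemma SS_step (C : Comb fl fr c a b p q) (P : Pair fl fr c) (ql : QCR 1 fl 0 c) (qr : QCR 1 fr c 1)
    (hTl : ∀ x < c, T x = fl x) (hTr : ∀ x, c ≤ x → T x = fr x) (G : Gap fl fr c p q a b g)
    (hb : 2 ≤ b) {E : Set ℝ} (hE : ∀ x ∈ E, ∀ n, T^[n] x ∉ Ioo p q) {ρ : ℝ} (ρ0 : 0 ≤ ρ)
    (h : SS T fl fr c p q a b E ρ) :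
    SS T fl fr c p q a b E (1 / (1 + g * (q - p) / 2) * ρ) := by
  have w : 0 < g * (q - p) := mul_pos G.g0 (by linarith [C.pc, C.cq])
  have calc1 : ∀ x0 x1 m0 m1 : ℝ, m0 < m1 → g * (q - p) * (m0 - x0) ≤ m1 - m0 →
      g * (q - p) * (x1 - m1) ≤ m1 - m0 → mu E x0 x1 ≤ ρ * (m0 - x0) + ρ * (x1 - m1) →
      mu E x0 x1 ≤ 1 / (1 + g * (q - p) / 2) * ρ * (x1 - x0) := by
    intro x0 x1 m0 m1 hm h1 h2 h3
    refine h3.trans ?_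
    rw [show 1 / (1 + g * (q - p) / 2) * ρ * (x1 - x0) = ρ * (x1 - x0) / (1 + g * (q - p) / 2) by ring,
      le_div_iff₀ (by positivity)]
    have : (m0 - x0 + (x1 - m1)) * (1 + g * (q - p) / 2) ≤ x1 - x0 := by nlinarith
    calc _ = ρ * ((m0 - x0 + (x1 - m1)) * (1 + g * (q - p) / 2)) := by ring
      _ ≤ _ := by gcongr
  have A : ∀ j, j + 1 < b → ∀ x0 x1, TL T fl fr c p q j x0 x1 →
      mu E x0 x1 ≤ 1 / (1 + g * (q - p) / 2) * ρ * (x1 - x0) := by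
    intro j hj x0 x1 hx
    have hx := TL_next C P ql hTl (by omega) hx
    obtain ⟨m0, m1, a1, a2, a3, a4, a5, ⟨n, a6⟩, a7, a8⟩ := hx.split (C.Rq _ hj).2 C.pc C.cq
      (C.Lp 0 C.ha).1 G.g0 (G.l _ hj) (G.r 0 C.ha) (C.Rc _ hj).1.le P.l1
    refine calc1 _ _ _ _ a2 a7 a8 ((mu_split fun x hx hxE => hE x hxE n (a6 x hx)).trans
      (add_le_add (h.1 _ hj _ _ a4) (h.2 0 C.ha _ _ a5)))
  have B : ∀ i < a, ∀ x0 x1, TR T fl fr c p q i x0 x1 →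
      mu E x0 x1 ≤ 1 / (1 + g * (q - p) / 2) * ρ * (x1 - x0) := by
    intro i hi x0 x1 hx
    have hx := TR_next C P qr hTr hi hx
    have h1 := (C.Rq 0 C.hb)
    have h2 := (C.Rc 0 C.hb)
    have gl := G.l 0 C.hb
    simp only [Function.iterate_zero, id] at h1 h2 gl
    by_cases hi' : i + 1 < a
    · obtain ⟨m0, m1, a1, a2, a3, a4, a5, ⟨n, a6⟩, a7, a8⟩ := hx.split h1.2 C.pc C.cq
        (C.Lp _ hi').1 G.g0 gl (G.r _ hi') P.r0 (C.Lc _ hi').2.le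
      refine calc1 _ _ _ _ a2 a7 a8 ((mu_split fun x hx hxE => hE x hxE n (a6 x hx)).trans
        (add_le_add (h.1 0 C.hb _ _ a4) (h.2 _ hi' _ _ a5)))
    · have e : i + 1 = a := by omega
      rw [e, C.Lr] at hx
      exact A 0 (by omega) _ _ (hx.shrink (d0' := fr c) le_rfl (by linarith [G.g0]) C.pc C.Ld.1.le)
  refine ⟨fun j hj x0 x1 hx => ?_, B⟩
  by_cases hj' : j + 1 < b
  · exact A j hj' _ _ hx
  · have hx := TL_next C P ql hTl hj hx
    have e : j + 1 = b := by omega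
    rw [e, C.Rr] at hx
    have gr := G.r 0 C.ha
    simp only [Function.iterate_zero, id] at gr
    exact B 0 C.ha _ _ (hx.shrink (d1' := fl c) C.Rd.2.le C.cq (by linarith [G.g0]) le_rfl)

lemma SS_zero (C : Comb fl fr c a b p q) (P : Pair fl fr c) (ql : QCR 1 fl 0 c) (qr : QCR 1 fr c 1)
    (hTl : ∀ x < c, T x = fl x) (hTr : ∀ x, c ≤ x → T x = fr x)
    (hb : 2 ≤ b) {E : Set ℝ} (hE : ∀ x ∈ E, ∀ n, T^[n] x ∉ Ioo p q) :
    volume (E ∩ Icc (fr q) p) = 0 ∧ volume (E ∩ Icc q (fl p)) = 0 := by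
  obtain ⟨g, G⟩ := gap_exists C P
  have w : 0 < g * (q - p) := mul_pos G.g0 (by linarith [C.pc, C.cq])
  set l := 1 / (1 + g * (q - p) / 2) with hl
  have l0 : 0 ≤ l := by positivity
  have l1 : l < 1 := by rw [hl, div_lt_one (by positivity)]; linarith
  have triv : ∀ x0 x1 : ℝ, x0 ≤ x1 → mu E x0 x1 ≤ 1 * (x1 - x0) := fun x0 x1 hx => by
    refine (measureReal_mono inter_subset_right (by simp)).trans ?_
    simp [hx]
  have S : ∀ n, SS T fl fr c p q a b E (l ^ n) := by
    intro n
    induction n with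
    | zero =>
      rw [pow_zero]
      exact ⟨fun j _ x0 x1 h => triv _ _ h.le, fun j _ x0 x1 h => triv _ _ h.le⟩
    | succ n ih => rw [pow_succ']; exact SS_step C P ql qr hTl hTr G hb hE (by positivity) ih
  have lim : ∀ x0 x1, (∀ n : ℕ, mu E x0 x1 ≤ l ^ n * (x1 - x0)) → volume (E ∩ Icc x0 x1) = 0 := by
    intro x0 x1 h
    have t := (tendsto_pow_atTop_nhds_zero_of_lt_one l0 l1).mul_const (x1 - x0)
    rw [zero_mul] at t
    have := ge_of_tendsto' t h
    have z : mu E x0 x1 = 0 := le_antisymm this measureReal_nonneg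
    exact (measureReal_eq_zero_iff (mu_fin _ _ _)).1 z
  have h1 := C.Rq 0 C.hb
  have h2 := C.Rc 0 C.hb
  have gl := G.l 0 C.hb
  have h3 := C.Lp 0 C.ha
  have gr := G.r 0 C.ha
  simp only [Function.iterate_zero, id] at h1 h2 gl h3 gr
  have g0 := G.g0
  have idq : ∀ u v : ℝ, QCR 1 (fun x => x) u v := fun u v x1 x2 x3 x4 _ _ _ _ _ => by linarith
  constructor
  · refine lim _ _ fun n => (S n).1 0 C.hb _ _ ⟨fr c, c, fun x => x, 0, by linarith, h1.2, C.pc,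
      strictMono_id.strictMonoOn _, continuousOn_id, idq _ _, rfl, rfl, rfl, rfl, fun x _ => rfl⟩
  · refine lim _ _ fun n => (S n).2 0 C.ha _ _ ⟨c, fl c, fun x => x, 0, C.cq, h3.1, by linarith,
      strictMono_id.strictMonoOn _, continuousOn_id, idq _ _, rfl, rfl, rfl, rfl, fun x _ => rfl⟩
end
end LW

namespace LW

section
variable {α k c p q : ℝ} {fl fr : ℝ → ℝ} {a b : ℕ}

lemma xz_key (hα : 1 < α) : 1 ≤ α * ((1 - xz α) ^ ((α - 1) / 2)) ^ 3 := by
  have z0 := xz_pos α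
  have z1 := xz_le hα
  have z2 : xz α * (4 * (1 + α)) ≤ 1 := by
    have h := one_add_mul_self_le_rpow_one_add (s := 1) (p := α) (by norm_num) hα.le
    have e : xz α * (4 * (1 + 1 : ℝ) ^ α) = 1 := by
      unfold xz
      rw [show (1 + 1 : ℝ) = 2 by norm_num, show (4 : ℝ) = 2 ^ (2 : ℝ) by norm_num,
        ← Real.rpow_add two_pos, ← Real.rpow_add two_pos]
      ring_nf; simp
    rw [← e]; gcongr; linarith
  have p0 : 0 < 1 - xz α := by linarith
  have h1 := Real.one_sub_inv_le_log_of_pos p0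
  have h2 := Real.one_sub_inv_le_log_of_pos (show 0 < α by linarith)
  have h3 : (1 - xz α)⁻¹ ≤ 1 + 8 / 7 * xz α := by
    rw [inv_le_comm₀ p0 (by positivity), inv_le_iff_one_le_mul₀ (by positivity)]; nlinarith
  have h4 : α⁻¹ * α = 1 := inv_mul_cancel₀ (by linarith)
  have i0 : 0 < α⁻¹ := by positivity
  have h5 : 12 / 7 * xz α ≤ α⁻¹ := by
    have : 12 / 7 * xz α * α ≤ α⁻¹ * α := by rw [h4]; nlinarith
    exact le_of_mul_le_mul_right this (by linarith)
  have : 0 ≤ Real.log (α * ((1 - xz α) ^ ((α - 1) / 2)) ^ 3) := by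
    rw [Real.log_mul (by linarith) (by positivity), Real.log_pow, Real.log_rpow p0]
    have h6 : -(8 / 7 * xz α) ≤ Real.log (1 - xz α) := by linarith
    have h7 : (α - 1) / 2 * -(8 / 7 * xz α) ≤ (α - 1) / 2 * Real.log (1 - xz α) :=
      mul_le_mul_of_nonneg_left h6 (by linarith)
    have h8 : (α - 1) * (12 / 7 * xz α) ≤ (α - 1) * α⁻¹ := mul_le_mul_of_nonneg_left h5 (by linarith)
    push_cast
    nlinarith
  exact (Real.log_nonneg_iff (by positivity)).1 this

lemma Lev.fl_gt (h : Lev α k fl fr c a b p q) (hk : k * (1 - xz α) ^ ((α - 1) / 2) ≤ 1) {x : ℝ}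
    (hx : x ∈ Ioo 0 c) : x < fl x := by
  have hα := h.hα
  have c0 := h.P.c0
  have z0 := xz_pos α
  have z1 := xz_le hα
  have k1 := h.k1
  have p0 : 0 < 1 - xz α := by linarith
  have t0 : 0 < x / c := div_pos hx.1 c0
  have t1 : x / c < 1 := (div_lt_one c0).2 hx.2
  have s0 : 0 < 1 - x / c := by linarith
  set r := (1 - xz α) ^ ((α - 1) / 2) with hr
  have r0 : 0 < r := by positivity
  have r1 : r < 1 := Real.rpow_lt_one p0.le (by linarith) (by linarith)
  have rr : (1 - xz α) ^ (α - 1) = r * r := by rw [hr, ← Real.rpow_add p0]; congr 1; ring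
  have es : (1 - x / c) ^ α = (1 - x / c) ^ (α - 1) * (1 - x / c) := by
    rw [← Real.rpow_add_one s0.ne']; congr 1; ring
  rcases le_or_gt (xz α) (x / c) with ht | ht
  · have y := h.ystep hx.1.le hx.2.le
    have m : (1 - x / c) ^ (α - 1) ≤ r * r := by
      rw [← rr]; exact Real.rpow_le_rpow s0.le (by linarith) (by linarith)
    have m2 : k * (1 - x / c) ^ (α - 1) < 1 := by
      calc _ ≤ k * (r * r) := by gcongr
        _ = (k * r) * r := by ring
        _ ≤ 1 * r := by gcongr
        _ < 1 := by linarith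
    have m3 : 1 - fl x / c < 1 - x / c := by
      rw [es] at y; nlinarith
    have := (div_lt_div_iff_of_pos_right c0).1 (show x / c < fl x / c by linarith)
    exact this
  · have y := (h.E.L 0 x le_rfl hx.1.le hx.2.le).2
    have e0 : Sf α c 0 = 1 := by unfold Sf; rw [sub_zero, div_self c0.ne', Real.one_rpow]
    have e1 : Sf α c x = (1 - x / c) ^ α := by unfold Sf; congr 1; field_simp
    rw [e0, e1, h.P.fl0, sub_zero] at y
    have tg := tangent hα zero_le_one s0.le
    have m : r * r ≤ (1 - x / c) ^ (α - 1) := by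
      rw [← rr]; exact Real.rpow_le_rpow p0.le (by linarith) (by linarith)
    rw [Real.one_rpow] at tg
    have lc : c < fl c := by linarith [h.lq, h.C.cq]
    have kk : k ≤ α * (r * r) := by
      have := xz_key hα
      rw [← hr] at this
      calc k ≤ k * (α * r ^ 3) := le_mul_of_one_le_right (by linarith) this
        _ = (k * r) * (α * (r * r)) := by ring
        _ ≤ 1 * (α * (r * r)) := by gcongr
        _ = _ := one_mul _
    have w : k * (x / c) ≤ 1 - (1 - x / c) ^ α := by
      calc k * (x / c) ≤ α * (1 - x / c) ^ (α - 1) * (x / c) := by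
            gcongr; exact kk.trans (by gcongr)
        _ ≤ _ := by linarith
    have w0 : 0 < k * (x / c) := by positivity
    have : k * x < k * fl x := by
      calc k * x = c * (k * (x / c)) := by field_simp
        _ < fl c * (k * (x / c)) := by gcongr
        _ ≤ fl c * (1 - (1 - x / c) ^ α) := by gcongr; linarith
        _ ≤ _ := y
    exact lt_of_mul_lt_mul_left this (by linarith)

lemma Lev.fr_lt (h : Lev α k fl fr c a b p q) (h8 : fr c ≤ c / 8) {z : ℝ} (hz : z ∈ Ico c 1) :
    fr z < z := by
  have h1 := h.E4 h8 hz.1 hz.2.le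
  have h2 := h.eps
  have h3 : 0 ≤ 1 - fr z := by
    rw [← h.P.fr1]
    have := h.P.mR.monotoneOn ⟨hz.1, hz.2.le⟩ ⟨h.P.c1.le, le_rfl⟩ hz.2.le
    linarith
  have h4 := hz.2
  nlinarith

/-- exit lemma -/
lemma exit_right {F : ℝ → ℝ} {x d : ℝ} (hF : ContinuousOn F (Icc x d)) (h : ∀ y ∈ Icc x d, y < F y) :
    ∃ n, (∀ i < n, F^[i] x ∈ Icc x d) ∧ d < F^[n] x := by
  rcases lt_or_ge d x with hd | hd
  · exact ⟨0, by simp, hd⟩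
  obtain ⟨m, hm, hmin⟩ := isCompact_Icc.exists_isMinOn (nonempty_Icc.2 hd) (hF.sub continuousOn_id)
  have g0 : 0 < F m - m := by linarith [h m hm]
  have key : ∀ n, (∀ i < n, F^[i] x ≤ d) → x + n * (F m - m) ≤ F^[n] x := by
    intro n
    induction n with
    | zero => intro _; simp
    | succ n ih =>
      intro hn
      have h1 := ih (fun i hi => hn i (by omega))
      have h2 := hn n (by omega)
      have : 0 ≤ (n:ℝ) * (F m - m) := by positivity
      have h3 : F m - m ≤ F (F^[n] x) - F^[n] x := hmin (⟨by linarith, h2⟩ : F^[n] x ∈ Icc x d)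
      rw [Function.iterate_succ_apply']; push_cast; linarith
  have ex : ∃ n, d < F^[n] x := by
    by_contra! hc
    obtain ⟨n, hn⟩ := exists_nat_gt ((d - x) / (F m - m))
    rw [div_lt_iff₀ g0] at hn
    linarith [key n (fun i _ => hc i), hc n]
  refine ⟨Nat.find ex, fun i hi => ⟨?_, not_lt.1 (Nat.find_min ex hi)⟩, Nat.find_spec ex⟩
  have := key i (fun j hj => not_lt.1 (Nat.find_min ex (hj.trans hi)))
  have : 0 ≤ (i:ℝ) * (F m - m) := by positivity
  linarith

lemma exit_left {F : ℝ → ℝ} {x d : ℝ} (hF : ContinuousOn F (Icc d x)) (h : ∀ y ∈ Icc d x, F y < y) :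
    ∃ n, (∀ i < n, F^[i] x ∈ Icc d x) ∧ F^[n] x < d := by
  obtain ⟨n, h1, h2⟩ := exit_right (F := flp F) (x := 1 - x) (d := 1 - d)
    (continuousOn_const.sub (hF.comp (continuousOn_const.sub continuousOn_id)
      (fun y hy => ⟨by show d ≤ 1 - y; linarith [hy.2], by show 1 - y ≤ x; linarith [hy.1]⟩)))
    (fun y hy => by
      have := h (1 - y) ⟨by linarith [hy.2], by linarith [hy.1]⟩
      simp only [flp]; linarith)
  refine ⟨n, fun i hi => ?_, ?_⟩
  · have := h1 i hi
    rw [flp_iter, sub_sub_cancel] at this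
    exact ⟨by linarith [this.2], by linarith [this.1]⟩
  · rw [flp_iter, sub_sub_cancel] at h2; linarith

/-- preimages of null sets -/
lemma null_lip {F : ℝ → ℝ} {m u v : ℝ} (m0 : 0 < m)
    (h : ∀ x y, u ≤ x → x ≤ y → y ≤ v → m * (y - x) ≤ F y - F x) {N : Set ℝ} (hN : volume N = 0) :
    volume {x ∈ Icc u v | F x ∈ N} = 0 := by
  set S := {x ∈ Icc u v | F x ∈ N}
  have lo : ∀ x ∈ S, ∀ y ∈ S, m * |x - y| ≤ |F x - F y| := by
    intro x hx y hy
    rcases le_total x y with hxy | hxy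
    · have := h x y hx.1.1 hxy hy.1.2
      rw [abs_sub_comm x, abs_sub_comm (F x), abs_of_nonneg (sub_nonneg.2 hxy)]
      exact this.trans (le_abs_self _)
    · have := h y x hy.1.1 hxy hx.1.2
      rw [abs_of_nonneg (sub_nonneg.2 hxy)]
      exact this.trans (le_abs_self _)
  have inj : InjOn F S := fun x hx y hy e => by
    have := lo x hx y hy
    rw [e, sub_self, abs_zero] at this
    have : |x - y| ≤ 0 := by nlinarith [abs_nonneg (x - y)]
    linarith [abs_eq_zero.1 (le_antisymm this (abs_nonneg _))]
  set G := Function.invFunOn F S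
  have L : LipschitzOnWith (Real.toNNReal m⁻¹) G (F '' S) := by
    refine LipschitzOnWith.of_dist_le_mul ?_
    rintro _ ⟨x, hx, rfl⟩ _ ⟨y, hy, rfl⟩
    have gl : ∀ x ∈ S, G (F x) = x := fun x hx => inj.leftInvOn_invFunOn hx
    rw [gl x hx, gl y hy, Real.dist_eq, Real.dist_eq,
      Real.coe_toNNReal _ (by positivity), inv_mul_eq_div, le_div_iff₀ m0, mul_comm]
    exact lo x hx y hy
  have h1 : volume (G '' (F '' S)) = 0 := by
    have z : volume (F '' S) = 0 := measure_mono_null (by rintro _ ⟨x, hx, rfl⟩; exact hx.2) hN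
    have := L.hausdorffMeasure_image_le (d := 1) zero_le_one
    rw [hausdorffMeasure_real, z, mul_zero] at this
    exact le_antisymm this bot_le
  refine measure_mono_null (fun x hx => ?_) h1
  exact ⟨F x, ⟨x, hx, rfl⟩, inj.leftInvOn_invFunOn hx⟩

lemma half_null {K κ : ℝ} {F : ℝ → ℝ} (hα : 1 < α) (hκ : 1 ≤ κ) (hc : 0 < c) (h : Half α K κ F c)
    {N : Set ℝ} (hN : volume N = 0) : volume {x ∈ Ico 0 c | F x ∈ N} = 0 := by
  obtain ⟨b0, bm, bc, b1⟩ := h.basic hα hc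
  have fc : 0 < F c := by rw [← b0]; exact bm ⟨le_rfl, hc.le⟩ ⟨hc.le, le_rfl⟩ hc
  have key : ∀ n : ℕ, volume {x ∈ Icc 0 (c - 1 / (n + 1 : ℝ)) | F x ∈ N} = 0 := by
    intro n
    set d := c - 1 / (n + 1 : ℝ) with hd
    have n0 : (0:ℝ) < 1 / (n + 1) := by positivity
    have m0 : 0 < F c * (α * ((c - d) / c) ^ (α - 1) * (1 / c)) / κ ^ 2 := by
      have : 0 < c - d := by rw [hd]; linarith
      positivity
    refine null_lip m0 (fun x y hx hxy hy => ?_) hN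
    have i := (h.ineq hα hκ hc hx hxy (by linarith)).2
    rw [div_mul_eq_mul_div, div_le_iff₀ (by positivity), mul_comm (F y - F x)]
    refine le_trans ?_ i
    rw [mul_assoc]
    refine mul_le_mul_of_nonneg_left ?_ fc.le
    have tg := tangent (s := (c - x) / c) (t := (c - y) / c) hα (div_nonneg (by linarith) hc.le)
      (div_nonneg (by linarith) hc.le)
    have : ((c - d) / c) ^ (α - 1) ≤ ((c - y) / c) ^ (α - 1) := by
      apply Real.rpow_le_rpow (div_nonneg (by linarith) hc.le) (by gcongr) (by linarith)
    have yx : 0 ≤ y - x := by linarith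
    calc α * ((c - d) / c) ^ (α - 1) * (1 / c) * (y - x)
        ≤ α * ((c - y) / c) ^ (α - 1) * (1 / c) * (y - x) := by gcongr
      _ = α * ((c - y) / c) ^ (α - 1) * ((c - x) / c - (c - y) / c) := by ring
      _ ≤ _ := by unfold Sf; linarith
  refine measure_mono_null (fun x hx => ?_) (measure_iUnion_null key)
  obtain ⟨n, hn⟩ := exists_nat_one_div_lt (sub_pos.2 hx.1.2)
  exact mem_iUnion.2 ⟨n, ⟨hx.1.1, by linarith⟩, hx.2⟩

lemma null_refl {N : Set ℝ} (hN : volume N = 0) : volume {x | 1 - x ∈ N} = 0 := by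
  have := (Measure.measurePreserving_sub_left volume (1:ℝ)).quasiMeasurePreserving.preimage_null hN
  exact this

lemma null_pre {K κ : ℝ} {T : ℝ → ℝ} (hα : 1 < α) (hκ : 1 ≤ κ) (hc : 0 < c) (hc1 : c < 1)
    (hl : Half α K κ fl c) (hr : Half α K κ (flp fr) (1 - c)) (hTl : ∀ x < c, T x = fl x)
    (hTr : ∀ x, c ≤ x → T x = fr x) {N : Set ℝ} (hN : volume N = 0) :
    volume {x ∈ Icc 0 1 | T x ∈ N} = 0 := by
  have h1 := half_null hα hκ hc hl hN
  have h2 := null_refl (half_null hα hκ (by linarith) hr (null_refl hN))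
  refine measure_mono_null (t := {x ∈ Ico 0 c | fl x ∈ N} ∪ ({c} ∪ _)) (fun x hx => ?_)
    (measure_union_null h1 (measure_union_null (by simp) h2))
  rcases lt_trichotomy x c with h | h | h
  · exact Or.inl ⟨⟨hx.1.1, h⟩, by rw [← hTl x h]; exact hx.2⟩
  · exact Or.inr (Or.inl h)
  · refine Or.inr (Or.inr ⟨⟨by linarith [hx.1.2], by linarith⟩, ?_⟩)
    simp only [flp, sub_sub_cancel, mem_ofPred_eq]
    rw [← hTr x h.le]; exact hx.2

lemma null_iter {T : ℝ → ℝ} (hT : MapsTo T (Icc 0 1) (Icc 0 1))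
    (h : ∀ N : Set ℝ, volume N = 0 → volume {x ∈ Icc (0:ℝ) 1 | T x ∈ N} = 0) {N : Set ℝ}
    (hN : volume N = 0) (n : ℕ) : volume {x ∈ Icc (0:ℝ) 1 | T^[n] x ∈ N} = 0 := by
  induction n with
  | zero => exact measure_mono_null (fun x hx => hx.2) hN
  | succ n ih =>
    refine measure_mono_null (fun x hx => ?_) (h {x ∈ Icc (0:ℝ) 1 | T^[n] x ∈ N} ih)
    exact ⟨hx.1, hT hx.1, hx.2⟩

lemma E_null {T : ℝ → ℝ} (C : Comb fl fr c a b p q) (P : Pair fl fr c) (ql : QCR 1 fl 0 c)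
    (qr : QCR 1 fr c 1) (hTl : ∀ x < c, T x = fl x) (hTr : ∀ x, c ≤ x → T x = fr x) (hb : 2 ≤ b)
    (gt : ∀ x ∈ Ioo 0 c, x < fl x) (lt : ∀ x ∈ Ico c 1, fr x < x)
    (hT : MapsTo T (Icc 0 1) (Icc 0 1))
    (hn : ∀ N : Set ℝ, volume N = 0 → volume {x ∈ Icc (0:ℝ) 1 | T x ∈ N} = 0) :
    volume {x ∈ Icc (0:ℝ) 1 | ∀ n, T^[n] x ∉ Ioo p q} = 0 := by
  set E := {x ∈ Icc (0:ℝ) 1 | ∀ n, T^[n] x ∉ Ioo p q} with hE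
  obtain ⟨z1, z2⟩ := SS_zero C P ql qr hTl hTr hb (E := E) (fun x hx => hx.2)
  have Einv : ∀ x ∈ E, ∀ n, T^[n] x ∈ E := fun x hx n => ⟨hT.iterate n hx.1, fun m => by
    rw [← Function.iterate_add_apply]; exact hx.2 _⟩
  have key : ∀ x ∈ E, x ≠ 0 → x ≠ 1 → ∃ k, T^[k] x ∈ (E ∩ Icc (fr q) p) ∪ (E ∩ Icc q (fl p)) := by
    -- from the left
    have left : ∀ x ∈ E, 0 < x → x ≤ p → ∃ k, T^[k] x ∈ E ∩ Icc q (fl p) := by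
      intro x hx x0 xp
      have s : Icc x p ⊆ Icc 0 c := Icc_subset_Icc x0.le C.pc.le
      obtain ⟨n, h1, h2⟩ := exit_right (P.cL.mono s) (fun y hy => gt y ⟨by linarith [hy.1], by linarith [hy.2, C.pc]⟩)
      have eq : ∀ i ≤ n, T^[i] x = fl^[i] x := by
        intro i
        induction i with
        | zero => intro _; rfl
        | succ i ih =>
          intro hi
          rw [Function.iterate_succ_apply', Function.iterate_succ_apply', ih (by omega)]
          exact hTl _ (by linarith [(h1 i (by omega)).2, C.pc])
      refine ⟨n, Einv x hx n, ?_, ?_⟩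
      · have := (Einv x hx n).2 0
        rw [Function.iterate_zero, id, eq n le_rfl] at this
        rw [eq n le_rfl]
        by_contra! hq
        exact this ⟨h2, hq⟩
      · rw [eq n le_rfl]
        obtain ⟨m, rfl⟩ : ∃ m, n = m + 1 := Nat.exists_eq_succ_of_ne_zero (by
          rintro rfl; simp at h2; linarith)
        rw [Function.iterate_succ_apply']
        exact P.mL.monotoneOn (s (h1 m (by omega))) (s ⟨xp, le_rfl⟩) (h1 m (by omega)).2
    have right : ∀ x ∈ E, x < 1 → q ≤ x → ∃ k, T^[k] x ∈ E ∩ Icc (fr q) p := by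
      intro x hx x0 xp
      have s : Icc q x ⊆ Icc c 1 := Icc_subset_Icc C.cq.le x0.le
      obtain ⟨n, h1, h2⟩ := exit_left (P.cR.mono s) (fun y hy => lt y ⟨by linarith [hy.1, C.cq], by linarith [hy.2]⟩)
      have eq : ∀ i ≤ n, T^[i] x = fr^[i] x := by
        intro i
        induction i with
        | zero => intro _; rfl
        | succ i ih =>
          intro hi
          rw [Function.iterate_succ_apply', Function.iterate_succ_apply', ih (by omega)]
          exact hTr _ (by linarith [(h1 i (by omega)).1, C.cq])
      refine ⟨n, Einv x hx n, ?_, ?_⟩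
      · rw [eq n le_rfl]
        obtain ⟨m, rfl⟩ : ∃ m, n = m + 1 := Nat.exists_eq_succ_of_ne_zero (by
          rintro rfl; simp at h2; linarith)
        rw [Function.iterate_succ_apply']
        exact P.mR.monotoneOn (s ⟨le_rfl, xp⟩) (s (h1 m (by omega))) (h1 m (by omega)).1
      · have := (Einv x hx n).2 0
        rw [Function.iterate_zero, id, eq n le_rfl] at this
        rw [eq n le_rfl]
        by_contra! hq
        exact this ⟨hq, h2⟩
    intro x hx x0 x1
    rcases le_or_gt x p with h | h
    · obtain ⟨k, hk⟩ := left x hx (lt_of_le_of_ne hx.1.1 (Ne.symm x0)) h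
      exact ⟨k, Or.inr hk⟩
    · have : q ≤ x := by
        by_contra! hq
        exact hx.2 0 ⟨h, hq⟩
      obtain ⟨k, hk⟩ := right x hx (lt_of_le_of_ne hx.1.2 x1) this
      exact ⟨k, Or.inl hk⟩
  refine measure_mono_null (t := {0} ∪ ({1} ∪ ⋃ k, {x ∈ Icc (0:ℝ) 1 |
    T^[k] x ∈ (E ∩ Icc (fr q) p) ∪ (E ∩ Icc q (fl p))})) (fun x hx => ?_)
    (measure_union_null (by simp) (measure_union_null (by simp) (measure_iUnion_null fun k =>
      null_iter hT hn (measure_union_null z1 z2) k)))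
  by_cases x0 : x = 0
  · exact Or.inl x0
  by_cases x1 : x = 1
  · exact Or.inr (Or.inl x1)
  obtain ⟨k, hk⟩ := key x hx x0 x1
  exact Or.inr (Or.inr (mem_iUnion.2 ⟨k, hx.1, hk⟩))
end
end LW

namespace LW

structure Tow (T : ℕ → ℝ → ℝ) (c p q : ℕ → ℝ) : Prop where
  p0 : ∀ n, 0 < p n
  pc : ∀ n, p n < c n
  cq : ∀ n, c n < q n
  q1 : ∀ n, q n < 1
  t0 : ∀ n, T n 0 = 0
  t1 : ∀ n, T n 1 = 1
  mp : ∀ n, MapsTo (T n) (Icc 0 1) (Icc 0 1)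
  cc : ∀ n, c (n + 1) = (c n - p n) / (q n - p n)
  ret : ∀ n, ∀ x ∈ Ioo (p n) (q n), x ≠ c n → ∃ N, 0 < N ∧
    (∀ i, 0 < i → i < N → (T n)^[i] x ∈ Ioo 0 1 \ Ioo (p n) (q n)) ∧
    T (n + 1) ((x - p n) / (q n - p n)) = ((T n)^[N] x - p n) / (q n - p n)
  perp : ∀ n j, (T n)^[j] (p n) ∈ Ioo 0 1 \ Ioo (p n) (q n)
  perq : ∀ n j, (T n)^[j] (q n) ∈ Ioo 0 1 \ Ioo (p n) (q n)
  nul : ∀ n, volume {x ∈ Icc (0:ℝ) 1 | ∀ j, (T n)^[j] x ∉ Ioo (p n) (q n)} = 0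
  pre : ∀ N : Set ℝ, volume N = 0 → volume {x ∈ Icc (0:ℝ) 1 | T 0 x ∈ N} = 0

/-- rescaling maps -/
def HH (p q : ℕ → ℝ) : ℕ → ℝ → ℝ
  | 0, y => y
  | n + 1, y => HH p q n (p n + (q n - p n) * y)

section
variable {T : ℕ → ℝ → ℝ} {c p q : ℕ → ℝ}

lemma Tow.aff (t : Tow T c p q) (n : ℕ) : ∃ A B, 0 < B ∧ 0 ≤ A ∧ A + B ≤ 1 ∧
    ∀ y, HH p q n y = A + B * y := by
  induction n with
  | zero => exact ⟨0, 1, one_pos, le_rfl, by norm_num, fun y => by simp [HH]⟩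
  | succ n ih =>
    obtain ⟨A, B, h1, h2, h3, h4⟩ := ih
    have := t.p0 n
    have := t.pc n
    have := t.cq n
    have := t.q1 n
    refine ⟨A + B * p n, B * (q n - p n), mul_pos h1 (by linarith), by positivity, by nlinarith,
      fun y => ?_⟩
    rw [HH, h4]; ring

lemma Tow.mono (t : Tow T c p q) (n : ℕ) : StrictMono (HH p q n) := by
  obtain ⟨A, B, h1, h2, h3, h4⟩ := t.aff n
  intro x y h
  rw [h4, h4]; nlinarith

lemma Tow.img (t : Tow T c p q) (n : ℕ) {y u v : ℝ} : HH p q n y ∈ Ioo (HH p q n u) (HH p q n v) ↔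
    y ∈ Ioo u v := by
  simp [(t.mono n).lt_iff_lt]

lemma Tow.crit (t : Tow T c p q) (n : ℕ) : HH p q n (c n) = c 0 := by
  induction n with
  | zero => rfl
  | succ n ih =>
    have : q n - p n ≠ 0 := by linarith [t.pc n, t.cq n]
    rw [HH, t.cc, mul_div_cancel₀ _ this, add_sub_cancel, ih]

lemma HH0 (n : ℕ) : HH p q (n + 1) 0 = HH p q n (p n) := by rw [HH]; simp
lemma HH1 (n : ℕ) : HH p q (n + 1) 1 = HH p q n (q n) := by rw [HH]; simp

def Rel (T : ℕ → ℝ → ℝ) (c p q : ℕ → ℝ) (n : ℕ) : Prop :=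
  ∀ y ∈ Ioo (0:ℝ) 1, y ≠ c n → ∃ m, 0 < m ∧ (T 0)^[m] (HH p q n y) = HH p q n (T n y) ∧
    ∀ i, 0 < i → i < m → (T 0)^[i] (HH p q n y) ∉ Ioo (HH p q n 0) (HH p q n 1)

lemma Tow.chain (t : Tow T c p q) {n : ℕ} (r : Rel T c p q n) {x : ℝ} (k : ℕ)
    (h1 : ∀ i < k, (T n)^[i] x ∈ Ioo 0 1 ∧ (T n)^[i] x ≠ c n)
    (h2 : ∀ i, 0 < i → i < k → (T n)^[i] x ∉ Ioo (p n) (q n)) :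
    ∃ m, k ≤ m ∧ (k = 0 → m = 0) ∧ (T 0)^[m] (HH p q n x) = HH p q n ((T n)^[k] x) ∧
      ∀ i, 0 < i → i < m → (T 0)^[i] (HH p q n x) ∉ Ioo (HH p q n (p n)) (HH p q n (q n)) := by
  induction k with
  | zero => exact ⟨0, le_rfl, fun _ => rfl, rfl, fun i _ hi => by omega⟩
  | succ k ih =>
    obtain ⟨m, a1, a2, a3, a4⟩ := ih (fun i hi => h1 i (by omega)) (fun i h hi => h2 i h (by omega))
    obtain ⟨m', b1, b2, b3⟩ := r _ (h1 k (by omega)).1 (h1 k (by omega)).2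
    refine ⟨m' + m, by omega, by omega, ?_, fun i i0 hi => ?_⟩
    · rw [Function.iterate_add_apply, a3, b2, Function.iterate_succ_apply']
    · rcases lt_trichotomy i m with h | h | h
      · exact a4 i i0 h
      · rw [h, a3, t.img]
        rcases Nat.eq_zero_or_pos k with e | e
        · have := a2 e; omega
        · exact h2 k e (by omega)
      · obtain ⟨j, rfl⟩ : ∃ j, i = j + m := ⟨i - m, by omega⟩
        rw [Function.iterate_add_apply, a3]
        intro hh
        refine b3 j (by omega) (by omega) ⟨lt_of_lt_of_le ((t.mono n) (t.p0 n)) hh.1.le, hh.2.trans ((t.mono n) (t.q1 n))⟩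

lemma Tow.rel (t : Tow T c p q) (n : ℕ) : Rel T c p q n := by
  induction n with
  | zero =>
    intro y _ _
    exact ⟨1, one_pos, rfl, fun i h1 h2 => by omega⟩
  | succ n ih =>
    intro y hy hyc
    have pc := t.pc n
    have cq := t.cq n
    have w : 0 < q n - p n := by linarith
    set x := p n + (q n - p n) * y with hx
    have xy : (x - p n) / (q n - p n) = y := by rw [hx]; field_simp; ring
    have hx1 : x ∈ Ioo (p n) (q n) := ⟨by nlinarith [hy.1], by nlinarith [hy.2]⟩
    have hxc : x ≠ c n := by
      rintro e; apply hyc; rw [t.cc, ← e, xy]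
    obtain ⟨N, N0, h1, h2⟩ := t.ret n x hx1 hxc
    obtain ⟨m, a1, a2, a3, a4⟩ := t.chain ih (x := x) N (fun i hi => by
      rcases Nat.eq_zero_or_pos i with rfl | e
      · exact ⟨⟨(t.p0 n).trans hx1.1, hx1.2.trans (t.q1 n)⟩, hxc⟩
      · exact ⟨(h1 i e hi).1, fun e' => (h1 i e hi).2 (by rw [e']; exact ⟨pc, cq⟩)⟩)
      (fun i e hi => (h1 i e hi).2)
    rw [xy] at h2
    refine ⟨m, by omega, ?_, ?_⟩
    · rw [HH, a3, h2, HH, mul_div_cancel₀ _ w.ne', add_sub_cancel]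
    · rw [HH0, HH1]; exact a4

lemma Tow.nice (t : Tow T c p q) {n : ℕ} {x : ℝ}
    (h : ∀ j, (T n)^[j] x ∈ Ioo 0 1 \ Ioo (p n) (q n)) (i : ℕ) :
    (T 0)^[i] (HH p q n x) ∉ Ioo (HH p q n (p n)) (HH p q n (q n)) := by
  rcases Nat.eq_zero_or_pos i with rfl | e
  · rw [Function.iterate_zero, id, t.img]; exact (h 0).2
  · obtain ⟨m, a1, a2, a3, a4⟩ := t.chain (t.rel n) (x := x) (i + 1)
      (fun i _ => ⟨(h i).1, fun e => (h i).2 (by rw [e]; exact ⟨t.pc n, t.cq n⟩)⟩)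
      (fun i _ _ => (h i).2)
    exact a4 i e (by omega)

lemma Tow.bad (t : Tow T c p q) (n : ℕ) :
    volume {x ∈ Icc (0:ℝ) 1 | ∀ k, (T 0)^[k] x ∉ Ioo (HH p q n 0) (HH p q n 1)} = 0 := by
  induction n with
  | zero =>
    refine measure_mono_null (t := {0, 1}) (fun x hx => ?_) (Set.Finite.measure_zero (by simp) _)
    have := hx.2 0
    simp only [Function.iterate_zero, id, HH] at this
    by_contra hc
    simp only [mem_insert_iff, mem_singleton_iff, not_or] at hc
    exact this ⟨lt_of_le_of_ne hx.1.1 (Ne.symm hc.1), lt_of_le_of_ne hx.1.2 hc.2⟩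
  | succ n ih =>
    obtain ⟨A, B, B0, A0, AB, hAB⟩ := t.aff n
    set E := {x ∈ Icc (0:ℝ) 1 | ∀ j, (T n)^[j] x ∉ Ioo (p n) (q n)} with hE
    have z := null_lip (F := fun z => (z - A) / B) (m := 1 / B) (u := 0) (v := 1) (by positivity)
      (fun x y _ _ _ => le_of_eq (by ring)) (t.nul n)
    have z2 := fun k => null_iter (t.mp 0) t.pre z k
    refine measure_mono_null (fun x hx => ?_) (measure_union_null ih (measure_iUnion_null z2))
    by_contra hc
    simp only [mem_union, not_or] at hc
    obtain ⟨hc1, hc2⟩ := hc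
    have : ∃ k, (T 0)^[k] x ∈ Ioo (HH p q n 0) (HH p q n 1) := by
      by_contra! h; exact hc1 ⟨hx.1, h⟩
    obtain ⟨k, hk⟩ := this
    set y := ((T 0)^[k] x - A) / B with hy
    have Hy : HH p q n y = (T 0)^[k] x := by rw [hAB, hy]; field_simp; ring
    rw [← Hy, t.img] at hk
    apply hc2
    refine mem_iUnion.2 ⟨k, hx.1, (t.mp 0).iterate k hx.1, ⟨hk.1.le, hk.2.le⟩, ?_⟩
    by_contra! hj
    have hj : ∃ j, (T n)^[j] y ∈ Ioo (p n) (q n) := hj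
    have sp := Nat.find_spec hj
    set j := Nat.find hj
    have mn : ∀ i < j, (T n)^[i] y ∉ Ioo (p n) (q n) := fun i hi => Nat.find_min hj hi
    have mem : ∀ i < j, (T n)^[i] y ∈ Ioo 0 1 := by
      intro i hi
      have m1 : (T n)^[i] y ∈ Icc 0 1 := (t.mp n).iterate i ⟨hk.1.le, hk.2.le⟩
      have e : (T n)^[j] y = (T n)^[j - i] ((T n)^[i] y) := by
        rw [← Function.iterate_add_apply]; congr 1; omega
      rw [e] at sp
      refine ⟨lt_of_le_of_ne m1.1 (fun h => ?_), lt_of_le_of_ne m1.2 (fun h => ?_)⟩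
      · rw [← h, Function.iterate_fixed (t.t0 n)] at sp; linarith [sp.1, t.p0 n]
      · rw [h, Function.iterate_fixed (t.t1 n)] at sp; linarith [sp.2, t.q1 n]
    obtain ⟨m, a1, a2, a3, a4⟩ := t.chain (t.rel n) (x := y) j
      (fun i hi => ⟨mem i hi, fun e => mn i hi (by rw [e]; exact ⟨t.pc n, t.cq n⟩)⟩)
      (fun i _ hi => mn i hi)
    apply hx.2 (m + k)
    rw [Function.iterate_add_apply, ← Hy, a3, HH0, HH1, t.img]
    exact sp

lemma Tow.weak {α : ℝ} {f : LorenzMap α} (t : Tow T c p q) (hT : T 0 = f.toFun) (hc : c 0 = f.c)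
    {lo : ℝ} (l0 : 0 < lo) (hp : ∀ n, 1 / 2 ≤ p n) (hq : ∀ n, lo / 2 ≤ 1 - q n) : f.WeakMarkov := by
  refine ⟨lo / 4, by positivity, fun n => HH p q n (p n), fun n => HH p q n (q n), fun n => ?_,
    fun n => ?_, fun n => ?_⟩
  · obtain ⟨A, B, B0, A0, AB, hAB⟩ := t.aff n
    refine ⟨?_, ?_, ?_, ?_, ?_, ?_⟩
    · show 0 ≤ HH p q n (p n)
      rw [hAB]; have := t.p0 n; positivity
    · rw [← hc, ← t.crit n]; exact t.mono n (t.pc n)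
    · rw [← hc, ← t.crit n]; exact t.mono n (t.cq n)
    · show HH p q n (q n) ≤ 1
      rw [hAB]; nlinarith [t.q1 n]
    · rw [← hT]; exact t.nice (t.perp n)
    · rw [← hT]; exact t.nice (t.perq n)
  · obtain ⟨A, B, B0, A0, AB, hAB⟩ := t.aff (n + 1)
    have h1 := hp (n + 1)
    have h2 := hq (n + 1)
    have h3 := t.pc (n + 1)
    have h4 := t.cq (n + 1)
    have h5 := t.q1 (n + 1)
    show ScaledInside _ (HH p q n (p n)) (HH p q n (q n)) _ _
    rw [← HH0 n, ← HH1 n]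
    have k1 : lo / 4 * (q (n+1) - p (n+1)) < p (n+1) := by nlinarith
    have k2 : lo / 4 * (q (n+1) - p (n+1)) < 1 - q (n+1) := by nlinarith
    refine ⟨t.mono _ (t.p0 _), t.mono _ h5, ?_, ?_⟩
    · simp only [hAB]; nlinarith [mul_lt_mul_of_pos_left k1 B0]
    · simp only [hAB]; nlinarith [mul_lt_mul_of_pos_left k2 B0]
  · refine measure_mono_null (fun x hx => ?_) (t.bad (n + 1))
    refine ⟨hx.1, fun k hk => hx.2 ?_⟩
    rw [HH0, HH1, hT] at hk
    have ex : ∃ k, f.toFun^[k] x ∈ Ioo (HH p q n (p n)) (HH p q n (q n)) := ⟨k, hk⟩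
    refine ⟨hx.1, Nat.find ex, Nat.find_spec ex, fun j hj e => Nat.find_min ex hj ?_⟩
    rw [e, ← hc, ← t.crit n, t.img]
    exact ⟨t.pc n, t.cq n⟩
end

lemma Half.monoκ {α K κ κ' c : ℝ} {F : ℝ → ℝ} (h : Half α K κ F c) (hk : κ ≤ κ') : Half α K κ' F c := by
  obtain ⟨u, φ, u0, u1, d, e, Q⟩ := h
  refine ⟨u, φ, u0, u1, ⟨d.z, d.o, d.m, d.cn, d.q, fun x y h1 h2 h3 => ?_⟩, e, Q⟩
  obtain ⟨a1, a2⟩ := d.bl x y h1 h2 h3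
  have m : φ x ≤ φ y := d.m.monotoneOn ⟨h1, h2.trans h3⟩ ⟨h1.trans h2, h3⟩ h2
  exact ⟨a1.trans (mul_le_mul_of_nonneg_right hk (by linarith)),
    a2.trans (mul_le_mul_of_nonneg_right hk (by linarith))⟩

lemma orbit_inv {T : ℝ → ℝ} {S : Set ℝ} (h : MapsTo T S S) {x : ℝ} (hx : x ∈ S) (j : ℕ) : T^[j] x ∈ S :=
  h.iterate j hx

lemma Comb.perp {fl fr T : ℝ → ℝ} {c p q : ℝ} {a b : ℕ} (C : Comb fl fr c a b p q)
    (hTl : ∀ x < c, T x = fl x) (hTr : ∀ x, c ≤ x → T x = fr x) (j : ℕ) :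
    T^[j] p ∈ Ioo 0 1 \ Ioo p q := by
  have pc := C.pc
  have cq := C.cq
  have key : T^[j] p = p ∨ ∃ i < a, T^[j] p = fr^[i] (fl p) := by
    induction j with
    | zero => exact Or.inl rfl
    | succ j ih =>
      rw [Function.iterate_succ_apply']
      rcases ih with e | ⟨i, hi, e⟩
      · exact Or.inr ⟨0, C.ha, by rw [e]; exact hTl p pc⟩
      · have := C.Lp i hi
        rw [e, hTr _ (by linarith [this.1]), ← Function.iterate_succ_apply' fr]
        by_cases h : i + 1 < a
        · exact Or.inr ⟨i + 1, h, rfl⟩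
        · have e : i + 1 = a := by omega
          exact Or.inl (by rw [Nat.succ_eq_add_one, e]; exact C.Lr)
  rcases key with e | ⟨i, hi, e⟩
  · rw [e]; exact ⟨⟨C.p0, by linarith [C.q1]⟩, fun h => lt_irrefl _ h.1⟩
  · have := C.Lp i hi
    rw [e]; exact ⟨⟨by linarith [this.1, C.p0], this.2⟩, fun h => by linarith [h.2, this.1]⟩

lemma Comb.perq {fl fr T : ℝ → ℝ} {c p q : ℝ} {a b : ℕ} (C : Comb fl fr c a b p q)
    (hTl : ∀ x < c, T x = fl x) (hTr : ∀ x, c ≤ x → T x = fr x) (j : ℕ) :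
    T^[j] q ∈ Ioo 0 1 \ Ioo p q := by
  have pc := C.pc
  have cq := C.cq
  have key : T^[j] q = q ∨ ∃ i < b, T^[j] q = fl^[i] (fr q) := by
    induction j with
    | zero => exact Or.inl rfl
    | succ j ih =>
      rw [Function.iterate_succ_apply']
      rcases ih with e | ⟨i, hi, e⟩
      · exact Or.inr ⟨0, C.hb, by rw [e]; exact hTr q cq.le⟩
      · have := C.Rq i hi
        rw [e, hTl _ (by linarith [this.2]), ← Function.iterate_succ_apply' fl]
        by_cases h : i + 1 < b
        · exact Or.inr ⟨i + 1, h, rfl⟩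
        · have e : i + 1 = b := by omega
          exact Or.inl (by rw [Nat.succ_eq_add_one, e]; exact C.Rr)
  rcases key with e | ⟨i, hi, e⟩
  · rw [e]; exact ⟨⟨by linarith [C.p0], C.q1⟩, fun h => lt_irrefl _ h.2⟩
  · have := C.Rq i hi
    rw [e]; exact ⟨⟨this.1, by linarith [this.2, C.q1]⟩, fun h => by linarith [h.1, this.2]⟩

lemma Pair.maps {fl fr T : ℝ → ℝ} {c : ℝ} (P : Pair fl fr c)
    (hTl : ∀ x < c, T x = fl x) (hTr : ∀ x, c ≤ x → T x = fr x) : MapsTo T (Icc 0 1) (Icc 0 1) := by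
  intro x hx
  have c0 := P.c0
  have c1 := P.c1
  rcases lt_or_ge x c with h | h
  · rw [hTl x h]
    have h1 := P.mL.monotoneOn ⟨le_rfl, c0.le⟩ ⟨hx.1, h.le⟩ hx.1
    have h2 := P.mL.monotoneOn ⟨hx.1, h.le⟩ ⟨c0.le, le_rfl⟩ h.le
    rw [P.fl0] at h1
    exact ⟨h1, h2.trans P.l1⟩
  · rw [hTr x h]
    have h1 := P.mR.monotoneOn ⟨le_rfl, c1.le⟩ ⟨h, hx.2⟩ h
    have h2 := P.mR.monotoneOn ⟨h, hx.2⟩ ⟨c1.le, le_rfl⟩ hx.2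
    rw [P.fr1] at h2
    exact ⟨P.r0.trans h1, h2⟩

theorem main {α σ β θ : ℝ} (hα : 1 < α) (hσ : σ ∈ Ioo (0 : ℝ) 1)
    (hβ : β ∈ Ioo (0 : ℝ) ((σ / α) ^ 2)) (hθ : 1 < θ) :
    ∃ b0 : ℕ, ∀ bbar : ℕ, b0 ≤ bbar →
      ∀ f : LorenzMap α, f.IsCk 3 → f.NegSchwarzian → memK α σ θ bbar f →
        ∀ ω : ℕ → ℕ × ℕ, (∀ n, memOmega α σ β bbar (ω n)) → InfRenormType α f ω →
          f.WeakMarkov := by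
  obtain ⟨b0, hb0⟩ := par_exists hα hσ hβ hθ
  refine ⟨b0, fun bb hbb f h3 hS hK ω hω hI => ?_⟩
  obtain ⟨η, κ, hi, wlo, ρ, A, hκ, hhi, hpar⟩ := hb0 bb hbb
  have par := fun n => (hpar _ _ (hω n)).2
  have b2 := fun n => (hpar _ _ (hω n)).1
  set g : ℕ → LorenzMap α := fun n => (renormOp α)^[n] f with hg
  have ren : ∀ n, RenormOf (g n) (ω n).1 (ω n).2 (g (n + 1)) := fun n => by
    have := renormOp_spec hα (hI n) (b2 n)
    simp only [hg, Function.iterate_succ_apply']; exact this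
  choose p q hM hc hn hGL hGR using ren
  have R := fun n => (hM n).1
  have cmb := fun n => comb_of_interval hα (g n) (g (n + 1)) (R n) (hc n) (hn n) (hGL n) (hGR n)
  have P := fun n => (cmb n).1
  have C := fun n => (cmb n).2.2.1
  obtain ⟨k1, k2, k3, k4, k5⟩ := hK
  have uv := return_uv (g 0) (R 0)
  obtain ⟨H1, H2⟩ := half_level0 hα f uv.1 uv.2 h3 hS (by positivity) k1 k4 k5
  have lev := levels g p q ω par C hc (fun n => (cmb n).2.2.2.1) (fun n => (cmb n).2.2.2.2)
    (H1.monoκ hκ) (H2.monoκ hκ) k2 (k3.trans hhi)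
  have hTl : ∀ n, ∀ x < (g n).c, (g n).toFun x = lb (g n) x := fun n x h => toFun_lt _ h
  have hTr : ∀ n, ∀ x, (g n).c ≤ x → (g n).toFun x = rb (g n) x := fun n x h => toFun_ge _ h
  have np : ∀ n, ∀ N : Set ℝ, volume N = 0 → volume {x ∈ Icc (0:ℝ) 1 | (g n).toFun x ∈ N} = 0 :=
    fun n N hN => null_pre hα (par n).κ1 (g n).hc.1 (g n).hc.2 (lev n).1.1 (lev n).1.2 (hTl n) (hTr n) hN
  have t : Tow (fun n => (g n).toFun) (fun n => (g n).c) p q := {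
    p0 := fun n => (C n).p0
    pc := fun n => (C n).pc
    cq := fun n => (C n).cq
    q1 := fun n => (C n).q1
    t0 := fun n => by rw [hTl n 0 (g n).hc.1, (P n).fl0]
    t1 := fun n => by rw [hTr n 1 (g n).hc.2.le, (P n).fr1]
    mp := fun n => (P n).maps (hTl n) (hTr n)
    cc := hc
    ret := fun n x hx hxc => by
      have r := R n
      rcases lt_or_gt_of_ne hxc with h | h
      · obtain ⟨-, -, -, -, -, -, -, hL, -⟩ := r
        have hx' : x ∈ Ioo (p n) (g n).c := ⟨hx.1, h⟩
        refine ⟨(ω n).1 + 1, by omega, fun i i0 hi => ?_, hGL n x hx'⟩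
        have := (hL x hx').1 i i0 (by omega)
        exact ⟨⟨(g n).hc.1.trans this.1.1, this.1.2⟩, this.2⟩
      · obtain ⟨-, -, -, -, -, -, -, -, hL⟩ := r
        have hx' : x ∈ Ioo (g n).c (q n) := ⟨h, hx.2⟩
        refine ⟨(ω n).2 + 1, by omega, fun i i0 hi => ?_, hGR n x hx'⟩
        have := (hL x hx').1 i i0 (by omega)
        exact ⟨⟨this.1.1, this.1.2.trans (g n).hc.2⟩, this.2⟩
    perp := fun n => (C n).perp (hTl n) (hTr n)
    perq := fun n => (C n).perq (hTl n) (hTr n)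
    nul := fun n => by
      have L := (par n).lev (g n).hc.1 (g n).hc.2 (lev n).1.1 (lev n).1.2 (C n) (lev n).2.2.1
      have h8 := ((par n).cv L ((par n).wl.trans (lev n).2.1)).1
      obtain ⟨-, -, -, -, -, -, ql⟩ := (lev n).1.1
      obtain ⟨-, -, -, -, -, -, qr⟩ := (lev n).1.2
      have qr := qr.flip
      have e : flp (flp (rb (g n))) = rb (g n) := by funext x; simp [flp]
      rw [e, sub_zero, sub_sub_cancel] at qr
      exact E_null (C n) (P n) ql qr (hTl n) (hTr n) (b2 n) (fun x hx => L.fl_gt (par n).hk hx)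
        (fun x hx => L.fr_lt h8 hx) ((P n).maps (hTl n) (hTr n)) (np n)
    pre := np 0 }
  exact t.weak (f := f) rfl rfl (lo := α ^ (-(bb:ℝ) / α)) (by positivity) (fun n => (lev n).2.2.2.1)
    (fun n => (lev n).2.2.2.2)
end LW

/-- for `b̄` large, if `f ∈ K(b̄)` is a C³ Lorenz map with negative
Schwarzian derivative which is infinitely renormalizable with combinatorial type in
`Ω(b̄)^ℕ`, then `f` satisfies the weak Markov property. -/
theorem inf_renormalizable_weak_markov (α σ β θ : ℝ) (hα : 1 < α)
    (hσ : σ ∈ Ioo (0 : ℝ) 1)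
    (hσa : ∃ a : ℕ, 1 ≤ a ∧ α + σ ≤ (a : ℝ) + 1 ∧ (a : ℝ) + 1 ≤ 2 * α - σ)
    (hβ : β ∈ Ioo (0 : ℝ) ((σ / α) ^ 2)) (hθ : 1 < θ) :
    ∃ b0 : ℕ, ∀ bbar : ℕ, b0 ≤ bbar →
      ∀ f : LorenzMap α, f.IsCk 3 → f.NegSchwarzian → memK α σ θ bbar f →
        ∀ ω : ℕ → ℕ × ℕ, (∀ n, memOmega α σ β bbar (ω n)) → InfRenormType α f ω →
          f.WeakMarkov := by
  exact LW.main hα hσ hβ hθ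

end
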